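/- Let σ : ℝ² → ℝ² be the homeomorphism σ(x,y) = (x+1, −y), and let M be the quotient topological space of ℝ² by the ℤ-action n·z = σⁿ(z) (the open Möbius band). Then there is no minimal homeomorphism of M: for every homeomorphism f of M there exists a point q ∈ M whose orbit {fⁿ(q) : n ∈ ℤ} is not dense in M. -/

import Mathlib

/-- The homeomorphism `σ (x, y) = (x + 1, -y)` of the plane. -/
noncomputable def mobiusSigma : (ℝ × ℝ) ≃ₜ (ℝ × ℝ) :=
  (Homeomorph.addRight (1 : ℝ)).prodCongr (Homeomorph.neg ℝ)

/-- The orbit equivalence relation of the ℤ-action generated by `σ`; note that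
`σ ^ n (x, y) = (x + n, (-1) ^ n * y)`. -/
def mobiusSetoid : Setoid (ℝ × ℝ) where
  r z w := ∃ n : ℤ, (mobiusSigma.toEquiv ^ n) z = w
  iseqv := by
    constructor
    · intro z
      exact ⟨0, rfl⟩
    · rintro z w ⟨n, rfl⟩
      refine ⟨-n, ?_⟩
      simp [← Equiv.Perm.mul_apply, ← zpow_add]
    · rintro z w u ⟨n, rfl⟩ ⟨m, rfl⟩
      refine ⟨m + n, ?_⟩
      simp [← Equiv.Perm.mul_apply, ← zpow_add]

/-- The open Möbius band: the quotient of the plane by the ℤ-action generated by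
`σ (x, y) = (x + 1, -y)`, equipped with the quotient topology. -/
def MobiusBand : Type := Quotient mobiusSetoid

instance : TopologicalSpace MobiusBand :=
  inferInstanceAs (TopologicalSpace (Quotient mobiusSetoid))

namespace Mob
open Polynomial

theorem exists_pinv {W : Type*} [AddCommGroup W] [Module ℚ W] (d : Module.End ℚ W) :
    ∃ k : Module.End ℚ W, d * k * d = d := by
  obtain ⟨s, hs⟩ := d.rangeRestrict.exists_rightInverse_of_surjective d.range_rangeRestrict
  obtain ⟨r, hr⟩ := (LinearMap.range d).subtype.exists_leftInverse_of_injective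
    (Submodule.ker_subtype _)
  refine ⟨s.comp r, ?_⟩
  ext x
  have h1 : r (d x) = d.rangeRestrict x := by
    have := LinearMap.congr_fun hr (d.rangeRestrict x)
    simpa using this
  have h2 := LinearMap.congr_fun hs (d.rangeRestrict x)
  have h3 := congrArg Subtype.val h2
  simp only [Module.End.mul_apply, LinearMap.comp_apply, h1]
  simpa using h3

theorem exists_splitting {W : Type*} [AddCommGroup W] [Module ℚ W] (d : Module.End ℚ W)
    (hd : d * d = 0) :
    ∃ k p : Module.End ℚ W, d * k + k * d = 1 - p ∧ d * p = 0 ∧ p * d = 0 ∧ p * p = p := by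
  obtain ⟨k, hk⟩ := exists_pinv d
  have h1 : ∀ a, d * (d * a) = 0 := fun a => by rw [← mul_assoc, hd, zero_mul]
  have h2 : d * (k * d) = d := by rw [← mul_assoc, hk]
  have h3 : ∀ a, d * (k * (d * a)) = d * a := fun a => by
    rw [← mul_assoc k, ← mul_assoc, h2]
  refine ⟨k - k * k * d, 1 - d * (k - k * k * d) - (k - k * k * d) * d, by abel, ?_, ?_, ?_⟩ <;>
  · simp only [mul_sub, sub_mul, mul_assoc, hd, h1, h2, h3, mul_one, one_mul, mul_zero, zero_mul]
    abel

theorem rank_trace_false {W : Type*} [AddCommGroup W] [Module ℚ W] [FiniteDimensional ℚ W]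
    (M : Module.End ℚ W) (R : ℕ) (hR : Module.finrank ℚ (LinearMap.range M) ≤ R)
    (htr : ∀ n, 1 ≤ n → n ≤ R → LinearMap.trace ℚ W (M ^ n) = 0)
    (x : W) (hx : x ≠ 0) (hMx : M x = x) : False := by
  have hmaps : ∀ y ∈ LinearMap.range M, M y ∈ LinearMap.range M := fun y _ => ⟨y, rfl⟩
  set N := M.restrict hmaps with hN
  set χ := N.charpoly with hχ
  have hχ0 : χ ≠ 0 := (LinearMap.charpoly_monic N).ne_zero
  have hdeg : χ.natDegree ≤ R := by rw [hχ, LinearMap.charpoly_natDegree]; exact hR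
  have hpow : ∀ (r : ℚ[X]) (y : LinearMap.range M), ((aeval N r) y : W) = aeval M r (y : W) := by
    intro r y
    induction r using Polynomial.induction_on' with
    | add p q hp hq => simp [hp, hq]
    | monomial n a =>
      have : ∀ n, ((N ^ n) y : W) = (M ^ n) (y : W) := by
        intro n
        induction n with
        | zero => simp
        | succ n ih => rw [pow_succ', pow_succ']; simp [hN, ← ih, LinearMap.restrict_apply]
      simp [aeval_monomial, this]
  have hkill : aeval M (X * χ) = 0 := by
    ext y
    rw [mul_comm, map_mul, Module.End.mul_apply, aeval_X]
    have := hpow χ ⟨M y, y, rfl⟩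
    rw [LinearMap.aeval_self_charpoly] at this
    simpa using this.symm
  have hev : ∀ r : ℚ[X], aeval M r x = r.eval 1 • x := by
    intro r
    induction r using Polynomial.induction_on' with
    | add p q hp hq => simp [hp, hq, add_smul]
    | monomial n a =>
      have : ∀ n, (M ^ n) x = x := by
        intro n
        induction n with
        | zero => simp
        | succ n ih => rw [pow_succ']; simp [ih, hMx]
      simp [aeval_monomial, this, Module.algebraMap_end_apply]
  have hroot : χ.IsRoot 1 := by
    have := hev (X * χ)
    rw [hkill] at this
    simp only [LinearMap.zero_apply, eval_mul, eval_X, one_mul] at this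
    rcases smul_eq_zero.1 this.symm with h | h
    · exact h
    · exact (hx h).elim
  obtain ⟨u, hu, hu1⟩ := exists_eq_pow_rootMultiplicity_mul_and_not_dvd χ hχ0 1
  set a := rootMultiplicity 1 χ with ha
  have ha1 : 1 ≤ a := (rootMultiplicity_pos hχ0).2 hroot
  have hmon : ((X - C (1:ℚ)) ^ a).Monic := (monic_X_sub_C 1).pow a
  have hcop : IsCoprime (X * u) ((X - C (1:ℚ)) ^ a) := by
    apply IsCoprime.pow_right
    refine (Irreducible.coprime_iff_not_dvd (irreducible_X_sub_C (1:ℚ))).2 ?_ |>.symm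
    intro h
    rcases (prime_X_sub_C (1:ℚ)).dvd_or_dvd h with h | h
    · rw [dvd_iff_isRoot] at h; simp at h
    · exact hu1 h
  obtain ⟨v', b, hvb⟩ := hcop
  set v := v' %ₘ (X - C (1:ℚ)) ^ a with hv
  set w := X * u * v with hw
  have hw1 : (X - C (1:ℚ)) ^ a ∣ w - 1 := by
    have h1 : v = v' - (X - C (1:ℚ)) ^ a * (v' /ₘ (X - C (1:ℚ)) ^ a) := by
      rw [hv]; exact modByMonic_eq_sub_mul_div (p := v') ((X - C (1:ℚ)) ^ a)
    refine ⟨- b - X * u * (v' /ₘ (X - C (1:ℚ)) ^ a), ?_⟩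
    rw [hw, h1, ← hvb]; ring
  have hu0 : u ≠ 0 := by rintro rfl; simp at hu1
  have hwdeg : w.natDegree ≤ R := by
    have h0 : χ.natDegree = a + u.natDegree := by
      conv_lhs => rw [hu]
      rw [hmon.natDegree_mul' hu0, natDegree_pow, natDegree_X_sub_C, mul_one]
    have h1 : v.natDegree < a := by
      have := natDegree_modByMonic_lt v' hmon (by
        intro h
        have := congrArg natDegree h
        rw [natDegree_pow, natDegree_X_sub_C] at this
        simp at this; omega)
      rwa [natDegree_pow, natDegree_X_sub_C, mul_one] at this
    have h2 : w.natDegree ≤ _ := natDegree_mul_le (p := X * u) (q := v)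
    have h3 := natDegree_mul_le (p := (X : ℚ[X])) (q := u)
    rw [natDegree_X] at h3
    omega
  have hidem : IsIdempotentElem (aeval M w) := by
    have hdvd : X * χ ∣ w * w - w := by
      obtain ⟨t, ht⟩ := hw1
      refine ⟨v * t, ?_⟩
      have : w * w - w = w * (w - 1) := by ring
      rw [this, ht]
      conv_rhs => rw [hu]
      rw [hw]; ring
    obtain ⟨t, ht⟩ := hdvd
    have := congrArg (aeval M) ht
    rw [map_mul, hkill, zero_mul, map_sub, map_mul, sub_eq_zero] at this
    exact this
  have htrw : LinearMap.trace ℚ W (aeval M w) = 0 := by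
    rw [aeval_eq_sum_range, map_sum]
    refine Finset.sum_eq_zero fun n hn => ?_
    rw [Finset.mem_range] at hn
    rw [map_smul]
    rcases Nat.eq_zero_or_pos n with rfl | hn0
    · simp [hw]
    · rw [htr n hn0 (by omega), smul_zero]
  have hrk : Module.finrank ℚ (LinearMap.range (aeval M w)) = 0 := by
    have := (LinearMap.IsIdempotentElem.isProj_range _ hidem).trace
    rw [htrw] at this
    exact_mod_cast this.symm
  have hz : aeval M w = 0 := by
    rw [← LinearMap.range_eq_bot]
    exact Submodule.finrank_eq_zero.1 hrk
  have := hev w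
  rw [hz] at this
  have hw11 : w.eval 1 = 1 := by
    obtain ⟨t, ht⟩ := hw1
    have := congrArg (eval 1) ht
    simp [zero_pow (by omega : a ≠ 0)] at this
    linarith
  rw [hw11, one_smul] at this
  exact hx this.symm

theorem theoremA {W : Type*} [AddCommGroup W] [Module ℚ W] [FiniteDimensional ℚ W]
    (d c ε k0 p0 : Module.End ℚ W) (R : ℕ)
    (hdd : d * d = 0) (hdc : d * c = c * d) (hεd : ε * d = - (d * ε)) (hεε : ε * ε = 1)
    (hεc : ε * c = c * ε) (hk0 : d * k0 + k0 * d = 1 - p0)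
    (hp0 : Module.finrank ℚ (LinearMap.range p0) ≤ R)
    (htr : ∀ n, 1 ≤ n → n ≤ R → LinearMap.trace ℚ W (ε * c ^ n) = 0)
    (m : ℕ) (hm : ∀ x, d x = 0 → ε x = x → (c ^ m) x ∈ LinearMap.range d)
    (γ : W) (hγ : d γ = 0) (hcγ : c γ - γ ∈ LinearMap.range d) (hγ' : γ ∉ LinearMap.range d) :
    False := by
  obtain ⟨k, p, hkp, hdp, hpd, hpp⟩ := exists_splitting d hdd
  have hp : p = 1 - (d * k + k * d) := by rw [hkp]; abel
  have hdcn : ∀ n, d * c ^ n = c ^ n * d := fun n => ((show Commute d c from hdc).pow_right n)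
  have hεcn : ∀ n, ε * c ^ n = c ^ n * ε := fun n => ((show Commute ε c from hεc).pow_right n)
  have key : ∀ A B : Module.End ℚ W, (∃ A', A * d = d * A') → (∃ B', d * B = B' * d) →
      p * A * p * B * p = p * A * B * p := by
    rintro A B ⟨A', hA⟩ ⟨B', hB⟩
    have : p * A * p * B * p = p * A * B * p - p * (A * d) * k * B * p - p * A * k * (d * B) * p := by
      have h1 : p * A * p * B * p = (p * A) * (1 - (d * k + k * d)) * (B * p) := by
        rw [← hp]; simp only [mul_assoc]
      rw [h1]; noncomm_ring
    have h2 : p * (A * d) * k * B * p = 0 := by rw [hA, ← mul_assoc p d, hpd]; simp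
    have h3 : p * A * k * (d * B) * p = 0 := by rw [hB, mul_assoc _ _ p, mul_assoc B', hdp]; simp
    rw [this, h2, h3]; simp
  set M := p * c * p with hM
  have hc' : ∀ n, ∃ A', c ^ n * d = d * A' := fun n => ⟨c ^ n, (hdcn n).symm⟩
  have hc'' : ∀ n, ∃ A', d * c ^ n = A' * d := fun n => ⟨c ^ n, (hdcn n)⟩
  have hMn : ∀ n, M ^ (n + 1) = p * c ^ (n + 1) * p := by
    intro n
    induction n with
    | zero => simp [hM]
    | succ n ih =>
      rw [pow_succ', ih, hM, show p * c * p * (p * c ^ (n+1) * p) = p * c * (p * p) * c ^ (n+1) * p by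
        simp only [mul_assoc], hpp, key c (c ^ (n+1)) (by simpa using hc' 1) (hc'' _),
        mul_assoc p, ← pow_succ']
  set E := p * ε * p with hE
  have hε1 : ∃ A', ε * d = d * A' := ⟨-ε, by rw [hεd]; simp⟩
  have hε2 : ∃ A', d * ε = A' * d := ⟨-ε, by rw [neg_mul, hεd]; simp⟩
  have hEc : ∀ n, E * (p * c ^ n * p) = p * (ε * c ^ n) * p := by
    intro n
    rw [hE, show p * ε * p * (p * c ^ n * p) = p * ε * (p * p) * c ^ n * p by simp only [mul_assoc],
      hpp, key ε _ hε1 (hc'' n)]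
    simp only [mul_assoc]
  have hcE : ∀ n, (p * c ^ n * p) * E = p * (ε * c ^ n) * p := by
    intro n
    rw [hE, show (p * c ^ n * p) * (p * ε * p) = p * c ^ n * (p * p) * ε * p by simp only [mul_assoc],
      hpp, key _ ε (hc' n) hε2, hεcn]
    simp only [mul_assoc]
  have hEM : Commute E M := by
    have h1 := hEc 1
    have h2 := hcE 1
    simp only [pow_one] at h1 h2
    exact h1.trans h2.symm
  have hpM : Commute p M := by
    show p * M = M * p
    rw [hM, show p * (p * c * p) = (p * p) * c * p by simp only [mul_assoc],
      show p * c * p * p = p * c * (p * p) by simp only [mul_assoc], hpp]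
  have htrE : ∀ n, 1 ≤ n → LinearMap.trace ℚ W (ε * c ^ n) = LinearMap.trace ℚ W (M ^ n * E) := by
    intro n hn
    obtain ⟨n, rfl⟩ := Nat.exists_eq_add_of_le' hn
    rw [hMn, hcE]
    have h1 : LinearMap.trace ℚ W (p * (ε * c ^ (n+1)) * p) =
        LinearMap.trace ℚ W ((ε * c ^ (n+1)) * p) := by
      rw [mul_assoc, LinearMap.trace_mul_comm, mul_assoc, hpp]
    rw [h1, hp, mul_sub, mul_add, mul_one, map_sub, map_add]
    have h2 : LinearMap.trace ℚ W (ε * c ^ (n+1) * (k * d)) =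
        - LinearMap.trace ℚ W (ε * c ^ (n+1) * (d * k)) := by
      rw [← mul_assoc, LinearMap.trace_mul_comm, ← map_neg]
      congr 1
      have : d * ε = - (ε * d) := by rw [hεd]; simp
      rw [← mul_assoc, ← mul_assoc, this, neg_mul, mul_assoc ε d, hdcn]
      simp only [neg_mul, mul_assoc]
    rw [h2]; ring
  have hnil : M ^ (m + 1) * (p + E) = 0 := by
    rw [hMn]
    have h1 : p * c ^ m * (1 + ε) * p = 0 := by
      ext x
      obtain ⟨y, hy⟩ := hm ((1 + ε) (p x)) (by
        have : d * (1 + ε) * p = 0 := by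
          have h : d * ε = - (ε * d) := by rw [hεd]; simp
          rw [mul_add, mul_one, h, add_mul, neg_mul, mul_assoc, hdp]; simp
        exact LinearMap.congr_fun this x) (by
        have : ε * (1 + ε) = 1 + ε := by rw [mul_add, hεε]; simp [add_comm]
        exact LinearMap.congr_fun this (p x))
      have : p (d y) = 0 := LinearMap.congr_fun hpd y
      rw [hy] at this
      exact this
    have h2 : p * c ^ (m+1) * p * (p + E) = p * c ^ (m+1) * p + p * (ε * c ^ (m+1)) * p := by
      rw [mul_add, hcE, mul_assoc _ p p, hpp]
    have h3 : M * (p * c ^ m * (1 + ε) * p) = p * c ^ (m+1) * p + p * (ε * c ^ (m+1)) * p := by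
      have h4 : ∃ B', d * (c ^ m * (1 + ε)) = B' * d :=
        ⟨c ^ m * (1 - ε), by
          have h : d * ε = - (ε * d) := by rw [hεd]; simp
          rw [← mul_assoc, hdcn, mul_assoc, mul_add, h]; noncomm_ring⟩
      rw [hM, show p * c * p * (p * c ^ m * (1 + ε) * p) = p * c * (p * p) * (c ^ m * (1 + ε)) * p by
        simp only [mul_assoc], hpp, key c _ (by simpa using hc' 1) h4, hεcn, pow_succ']
      noncomm_ring
    rw [h2, ← h3, h1, mul_zero]
  have hcomm : Commute (p + E) M := hpM.add_left hEM
  have htrM : ∀ n, 1 ≤ n → n ≤ R → LinearMap.trace ℚ W (M ^ n) = 0 := by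
    intro n hn hnR
    have hnil2 : IsNilpotent (M ^ n * (p + E)) := by
      refine ⟨m + 1, ?_⟩
      rw [((hcomm.pow_right n).symm).mul_pow, ← pow_mul, pow_succ' (p + E), ← mul_assoc,
        show n * (m + 1) = (n - 1) * (m + 1) + (m + 1) by
          rw [← Nat.succ_mul]; congr 1; omega, pow_add, mul_assoc (M ^ _) (M ^ (m+1)), hnil]
      simp
    have h1 := (LinearMap.isNilpotent_trace_of_isNilpotent hnil2).eq_zero
    rw [mul_add, map_add, ← htrE n hn, htr n hn hnR, add_zero] at h1
    obtain ⟨n, rfl⟩ := Nat.exists_eq_add_of_le' hn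
    rwa [hMn, mul_assoc, hpp, ← hMn] at h1
  have hrk : Module.finrank ℚ (LinearMap.range M) ≤ R := by
    have h1 : p * p0 * p = p := by
      have : p0 = 1 - (d * k0 + k0 * d) := by rw [hk0]; abel
      rw [this, mul_sub, sub_mul, mul_one, hpp, mul_add, ← mul_assoc, hpd, add_mul, mul_assoc p,
        mul_assoc k0, hdp]
      simp
    have h2 : M = p * (p0 * (p * c * p)) := by
      conv_lhs => rw [hM]
      rw [show p * (p0 * (p * c * p)) = (p * p0 * p) * c * p by simp only [mul_assoc], h1]
    have h3 : LinearMap.range M ≤ (LinearMap.range p0).map p := by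
      rintro _ ⟨y, rfl⟩
      rw [h2]
      exact ⟨_, ⟨(p * c * p) y, rfl⟩, rfl⟩
    exact (Submodule.finrank_mono h3).trans ((Submodule.finrank_map_le _ _).trans hp0)
  refine rank_trace_false M R hrk htrM (p γ) ?_ ?_
  · intro h
    apply hγ'
    have : γ = p γ + (d * k + k * d) γ := by rw [hkp]; simp
    rw [h, zero_add] at this
    refine ⟨k γ, ?_⟩
    conv_rhs => rw [this]
    simp [hγ]
  · obtain ⟨y, hy⟩ := hcγ
    have hpdy : ∀ z, p (d z) = 0 := fun z => LinearMap.congr_fun hpd z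
    have e1 : p γ = γ - d (k γ) := by rw [hp]; simp [hγ]
    have e2 : c (d (k γ)) = d (c (k γ)) := (LinearMap.congr_fun hdc (k γ)).symm
    have e3 : p (p γ) = p γ := LinearMap.congr_fun hpp γ
    have e4 : c γ = γ + d y := by rw [hy]; abel
    show p (c (p (p γ))) = p γ
    rw [e3]
    conv_lhs => rw [e1, map_sub, e2, map_sub, hpdy, e4, map_add, hpdy]
    simp

end Mob

namespace Mob
open TensorProduct

abbrev C1 := ℤ →₀ ℚ
abbrev C2 := (ℤ × ℤ) →₀ ℚ

/-- Linear extension of a function on cells. -/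
noncomputable def lin {α M : Type*} [AddCommGroup M] [Module ℚ M] (f : α → M) : (α →₀ ℚ) →ₗ[ℚ] M :=
  Finsupp.linearCombination ℚ f

theorem lin_single {α M : Type*} [AddCommGroup M] [Module ℚ M] (f : α → M) (x : α) (a : ℚ) :
    lin f (Finsupp.single x a) = a • f x := by
  simp [lin]

theorem lin_single_one {α M : Type*} [AddCommGroup M] [Module ℚ M] (f : α → M) (x : α) :
    lin f (Finsupp.single x 1) = f x := by
  simp [lin]

theorem ext1 {α M : Type*} [AddCommGroup M] [Module ℚ M] {f g : (α →₀ ℚ) →ₗ[ℚ] M}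
    (h : ∀ x, f (Finsupp.single x 1) = g (Finsupp.single x 1)) : f = g := by
  ext x; simpa using h x

noncomputable def path (b a : ℤ) : C1 :=
  ∑ t ∈ Finset.Ico b a, Finsupp.single (2 * t + 1) 1 - ∑ t ∈ Finset.Ico a b, Finsupp.single (2 * t + 1) 1

theorem path_self (a : ℤ) : path a a = 0 := by simp [path]

theorem path_succ (b a : ℤ) : path b (a + 1) = path b a + Finsupp.single (2 * a + 1) 1 := by
  unfold path
  rcases le_or_gt b a with h | h
  · rw [Finset.Ico_eq_empty_of_le h, Finset.Ico_eq_empty_of_le (show b ≤ a + 1 by omega),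
      ← Finset.insert_Ico_right_eq_Ico_add_one h, Finset.sum_insert (by simp)]
    simp [add_comm]
  · rw [Finset.Ico_eq_empty_of_le (show a + 1 ≤ b by omega), Finset.Ico_eq_empty_of_le h.le,
      ← Finset.insert_Ico_add_one_left_eq_Ico h, Finset.sum_insert (by simp)]
    simp

theorem path_ind (b : ℤ) {P : ℤ → Prop} (h0 : P b) (h1 : ∀ a, P a ↔ P (a + 1)) (a : ℤ) : P a := by
  induction a using Int.inductionOn' (b := b) with
  | zero => exact h0
  | succ k _ ih => exact (h1 k).1 ih
  | pred k _ ih => exact (h1 (k - 1)).2 (by simpa using ih)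

theorem path_add (a b c : ℤ) : path a b + path b c = path a c := by
  induction c using path_ind b with
  | h0 => simp [path_self]
  | h1 c => rw [path_succ, path_succ, ← add_assoc, add_left_inj]

theorem path_symm (a b : ℤ) : path a b = - path b a := by
  have := path_add a b a
  rw [path_self] at this
  exact eq_neg_of_add_eq_zero_left this

theorem path_apply_ne {b a i : ℤ} (h : path b a i ≠ 0) :
    i % 2 = 1 ∧ ((2 * b < i ∧ i < 2 * a) ∨ (2 * a < i ∧ i < 2 * b)) := by
  unfold path at h
  rw [Finsupp.sub_apply, Finsupp.finsetSum_apply, Finsupp.finsetSum_apply] at h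
  by_contra hc
  apply h
  rw [Finset.sum_eq_zero, Finset.sum_eq_zero, sub_zero] <;>
  · intro t ht
    rw [Finset.mem_Ico] at ht
    rw [Finsupp.single_apply, if_neg]
    intro h2; apply hc; omega

noncomputable def d1 : C1 →ₗ[ℚ] C1 :=
  lin fun i => if i % 2 = 1 then Finsupp.single (i + 1) 1 - Finsupp.single (i - 1) 1 else 0
noncomputable def s1 : C1 →ₗ[ℚ] C1 :=
  lin fun i => if i % 2 = 1 then - Finsupp.single i 1 else Finsupp.single i 1
noncomputable def k1 (l : ℤ → ℤ) : C1 →ₗ[ℚ] C1 :=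
  lin fun i => if i % 2 = 1 then 0 else path (l (i / 2)) (i / 2)
noncomputable def e1 (l : ℤ → ℤ) : C1 →ₗ[ℚ] C1 :=
  lin fun i => if i % 2 = 1 then path (l (i / 2)) (l (i / 2 + 1)) else Finsupp.single (2 * l (i / 2)) 1

theorem d1_even (a : ℤ) : d1 (Finsupp.single (2 * a) 1) = 0 := by
  rw [d1, lin_single_one, if_neg (by omega)]
theorem d1_odd (a : ℤ) : d1 (Finsupp.single (2 * a + 1) 1) =
    Finsupp.single (2 * (a + 1)) 1 - Finsupp.single (2 * a) 1 := by
  rw [d1, lin_single_one, if_pos (by omega)]; congr 2; ring; ring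
theorem s1_even (a : ℤ) : s1 (Finsupp.single (2 * a) 1) = Finsupp.single (2 * a) 1 := by
  rw [s1, lin_single_one, if_neg (by omega)]
theorem s1_odd (a : ℤ) : s1 (Finsupp.single (2 * a + 1) 1) = - Finsupp.single (2 * a + 1) 1 := by
  rw [s1, lin_single_one, if_pos (by omega)]
theorem k1_even (l : ℤ → ℤ) (a : ℤ) : k1 l (Finsupp.single (2 * a) 1) = path (l a) a := by
  rw [k1, lin_single_one, if_neg (by omega), show 2 * a / 2 = a by omega]
theorem k1_odd (l : ℤ → ℤ) (a : ℤ) : k1 l (Finsupp.single (2 * a + 1) 1) = 0 := by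
  rw [k1, lin_single_one, if_pos (by omega)]
theorem e1_even (l : ℤ → ℤ) (a : ℤ) : e1 l (Finsupp.single (2 * a) 1) = Finsupp.single (2 * l a) 1 := by
  rw [e1, lin_single_one, if_neg (by omega), show 2 * a / 2 = a by omega]
theorem e1_odd (l : ℤ → ℤ) (a : ℤ) : e1 l (Finsupp.single (2 * a + 1) 1) = path (l a) (l (a + 1)) := by
  rw [e1, lin_single_one, if_pos (by omega), show (2 * a + 1) / 2 = a by omega]

theorem ext_eo {M : Type*} [AddCommGroup M] [Module ℚ M] {f g : C1 →ₗ[ℚ] M}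
    (he : ∀ a : ℤ, f (Finsupp.single (2 * a) 1) = g (Finsupp.single (2 * a) 1))
    (ho : ∀ a : ℤ, f (Finsupp.single (2 * a + 1) 1) = g (Finsupp.single (2 * a + 1) 1)) : f = g := by
  apply ext1
  intro x
  rcases Int.even_or_odd' x with ⟨a, rfl | rfl⟩
  · exact he a
  · exact ho a

theorem d1_path (b a : ℤ) : d1 (path b a) = Finsupp.single (2 * a) 1 - Finsupp.single (2 * b) 1 := by
  induction a using path_ind b with
  | h0 => simp [path_self]
  | h1 a =>
    rw [path_succ, map_add, d1_odd]
    constructor <;> intro h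
    · rw [h]; abel
    · rw [eq_sub_of_add_eq h]; abel

theorem s1_path (b a : ℤ) : s1 (path b a) = - path b a := by
  induction a using path_ind b with
  | h0 => simp [path_self]
  | h1 a => rw [path_succ, map_add, s1_odd, neg_add, add_left_inj]
theorem d1_d1 : d1 ∘ₗ d1 = 0 := by
  apply ext_eo <;> intro a
  · simp [d1_even]
  · simp [d1_even, d1_odd]
theorem s1_s1 : s1 ∘ₗ s1 = LinearMap.id := by
  apply ext_eo <;> intro a
  · simp [s1_even]
  · simp [s1_odd]
theorem d1_s1 : d1 ∘ₗ s1 = - (s1 ∘ₗ d1) := by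
  apply ext_eo <;> intro a
  · simp [s1_even, d1_even]
  · simp [s1_odd, d1_odd, s1_even]
theorem k1_s1 (l) : k1 l ∘ₗ s1 = - (s1 ∘ₗ k1 l) := by
  apply ext_eo <;> intro a
  · simp [s1_even, k1_even, s1_path]
  · simp [s1_odd, k1_odd]
theorem e1_s1 (l) : e1 l ∘ₗ s1 = s1 ∘ₗ e1 l := by
  apply ext_eo <;> intro a
  · simp [s1_even, e1_even]
  · simp [s1_odd, e1_odd, s1_path]
theorem d1_k1 (l) : d1 ∘ₗ k1 l + k1 l ∘ₗ d1 = LinearMap.id - e1 l := by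
  apply ext_eo <;> intro a
  · simp [d1_even, k1_even, e1_even, d1_path]
  · simp only [LinearMap.add_apply, LinearMap.comp_apply, k1_odd, d1_odd, map_sub, k1_even, map_zero,
      LinearMap.sub_apply, LinearMap.id_apply, e1_odd, zero_add]
    have h1 := path_add (l (a + 1)) (l a) (a + 1)
    have h2 := path_succ (l a) a
    rw [← h1, h2, path_symm (l a) (l (a+1))]; abel
theorem d1_e1 (l) : d1 ∘ₗ e1 l = e1 l ∘ₗ d1 := by
  apply ext_eo <;> intro a
  · simp [d1_even, e1_even]
  · simp [d1_odd, e1_odd, e1_even, d1_path]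

/-! ### products -/
noncomputable def bil (u v : C1) : C2 := finsuppTensorFinsupp' ℚ ℤ ℤ (u ⊗ₜ v)
noncomputable def bx (f g : C1 →ₗ[ℚ] C1) : C2 →ₗ[ℚ] C2 :=
  (finsuppTensorFinsupp' ℚ ℤ ℤ).toLinearMap ∘ₗ TensorProduct.map f g ∘ₗ
    (finsuppTensorFinsupp' ℚ ℤ ℤ).symm.toLinearMap

theorem bil_apply (u v : C1) (x : ℤ × ℤ) : bil u v x = u x.1 * v x.2 := by
  rcases x with ⟨i, j⟩
  simp [bil]
theorem bil_single (i j : ℤ) : bil (Finsupp.single i 1) (Finsupp.single j 1) = Finsupp.single (i, j) 1 := by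
  simp [bil]
theorem bx_bil (f g) (u v : C1) : bx f g (bil u v) = bil (f u) (g v) := by
  simp [bx, bil]
theorem bx_single (f g) (i j : ℤ) : bx f g (Finsupp.single (i, j) 1) =
    bil (f (Finsupp.single i 1)) (g (Finsupp.single j 1)) := by
  rw [← bil_single, bx_bil]
theorem bx_comp (f g f' g') : bx f g ∘ₗ bx f' g' = bx (f ∘ₗ f') (g ∘ₗ g') := by
  apply ext1
  rintro ⟨i, j⟩
  simp [bx_single, bx_bil]
theorem bx_id : bx LinearMap.id LinearMap.id = LinearMap.id := by
  apply ext1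
  rintro ⟨i, j⟩
  simp [bx_single, bil_single]
theorem bx_add_left (f f' g) : bx (f + f') g = bx f g + bx f' g := by
  simp [bx, TensorProduct.map_add_left, LinearMap.comp_add, LinearMap.add_comp]
theorem bx_add_right (f g g') : bx f (g + g') = bx f g + bx f g' := by
  simp [bx, TensorProduct.map_add_right, LinearMap.comp_add, LinearMap.add_comp]
theorem bx_zero_left (g) : bx 0 g = 0 := by simp [bx]
theorem bx_zero_right (g) : bx g 0 = 0 := by simp [bx]
theorem bx_neg_left (f g) : bx (-f) g = - bx f g := by
  rw [eq_neg_iff_add_eq_zero, ← bx_add_left]; simp [bx_zero_left]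
theorem bx_neg_right (f g) : bx f (-g) = - bx f g := by
  rw [eq_neg_iff_add_eq_zero, ← bx_add_right]; simp [bx_zero_right]
theorem bx_sub_left (f f' g) : bx (f - f') g = bx f g - bx f' g := by
  rw [sub_eq_add_neg, bx_add_left, bx_neg_left, sub_eq_add_neg]
theorem bx_sub_right (f g g') : bx f (g - g') = bx f g - bx f g' := by
  rw [sub_eq_add_neg, bx_add_right, bx_neg_right, sub_eq_add_neg]

noncomputable def D : C2 →ₗ[ℚ] C2 := bx d1 LinearMap.id + bx s1 d1
noncomputable def K (l l' : ℤ → ℤ) : C2 →ₗ[ℚ] C2 := bx (k1 l) LinearMap.id + bx (s1 ∘ₗ e1 l) (k1 l')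
noncomputable def E (l l' : ℤ → ℤ) : C2 →ₗ[ℚ] C2 := bx (e1 l) (e1 l')
noncomputable def eps : C2 →ₗ[ℚ] C2 := bx s1 s1

theorem D_D : D ∘ₗ D = 0 := by
  simp only [D, LinearMap.comp_add, LinearMap.add_comp, bx_comp, d1_d1, LinearMap.id_comp,
    LinearMap.comp_id, s1_s1, d1_s1, bx_neg_left, bx_zero_left, bx_zero_right]
  abel

theorem D_K (l l') : D ∘ₗ K l l' + K l l' ∘ₗ D = LinearMap.id - E l l' := by
  have h1 : d1 ∘ₗ (s1 ∘ₗ e1 l) = - ((s1 ∘ₗ e1 l) ∘ₗ d1) := by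
    rw [← LinearMap.comp_assoc, d1_s1, LinearMap.comp_assoc, ← d1_e1]
    rw [LinearMap.neg_comp, LinearMap.comp_assoc]
  have h2 : s1 ∘ₗ (s1 ∘ₗ e1 l) = e1 l := by rw [← LinearMap.comp_assoc, s1_s1, LinearMap.id_comp]
  have h3 : (s1 ∘ₗ e1 l) ∘ₗ s1 = e1 l := by rw [LinearMap.comp_assoc, e1_s1, h2]
  have h4 := congrArg (fun f => bx f LinearMap.id) (d1_k1 l)
  have h5 := congrArg (fun f => bx (e1 l) f) (d1_k1 l')
  simp only [bx_add_left, bx_sub_left, bx_add_right, bx_sub_right, bx_id] at h4 h5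
  simp only [D, K, E, LinearMap.comp_add, LinearMap.add_comp, bx_comp, LinearMap.id_comp,
    LinearMap.comp_id, h1, h2, h3, k1_s1, bx_neg_left]
  rw [eq_sub_of_add_eq h4, eq_sub_of_add_eq h5]
  abel

theorem eps_eps : eps ∘ₗ eps = LinearMap.id := by
  simp only [eps, bx_comp, s1_s1, bx_id]
theorem eps_D : eps ∘ₗ D = - (D ∘ₗ eps) := by
  simp only [D, eps, LinearMap.comp_add, LinearMap.add_comp, bx_comp, LinearMap.id_comp,
    LinearMap.comp_id, s1_s1, d1_s1, bx_neg_left, bx_neg_right, neg_add, neg_neg]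
theorem eps_single (i j : ℤ) : eps (Finsupp.single (i, j) 1) =
    (if (i + j) % 2 = 0 then (1 : ℚ) else -1) • Finsupp.single (i, j) 1 := by
  rw [eps, bx_single]
  rcases Int.even_or_odd' i with ⟨a, rfl | rfl⟩ <;> rcases Int.even_or_odd' j with ⟨b, rfl | rfl⟩ <;>
    simp only [s1_even, s1_odd]
  · rw [if_pos (by omega), one_smul, bil_single]
  · rw [if_neg (by omega), ← bil_single]; simp [bil, tmul_neg]
  · rw [if_neg (by omega), ← bil_single]; simp [bil, neg_tmul]
  · rw [if_pos (by omega), ← bil_single]; simp [bil, neg_tmul, tmul_neg]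

end Mob

namespace Mob
open TensorProduct

noncomputable abbrev sg (x : ℤ × ℤ) : C2 := Finsupp.single x 1
noncomputable abbrev spt (P : Set (ℤ × ℤ)) : Submodule ℚ C2 := Finsupp.supported ℚ ℚ P

theorem mem_spt {P : Set (ℤ × ℤ)} {u : C2} : u ∈ spt P ↔ ∀ x, u x ≠ 0 → x ∈ P := by
  rw [spt, Finsupp.mem_supported]
  simp [Set.subset_def]

theorem spt_map {P Q : Set (ℤ × ℤ)} (A : C2 →ₗ[ℚ] C2) (h : ∀ x ∈ P, A (sg x) ∈ spt Q) {u : C2}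
    (hu : u ∈ spt P) : A u ∈ spt Q := by
  have h1 : u = u.sum fun x a => a • sg x := by
    conv_lhs => rw [← Finsupp.sum_single u]
    simp [sg]
  rw [h1, Finsupp.sum, map_sum]
  refine Submodule.sum_mem _ fun x hx => ?_
  rw [map_smul]
  exact Submodule.smul_mem _ _ (h x (hu hx))

theorem spt_zero {M : Type*} [AddCommGroup M] [Module ℚ M] {P : Set (ℤ × ℤ)} (A : C2 →ₗ[ℚ] M)
    (h : ∀ x ∈ P, A (sg x) = 0) {u : C2} (hu : u ∈ spt P) : A u = 0 := by
  have h1 : u = u.sum fun x a => a • sg x := by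
    conv_lhs => rw [← Finsupp.sum_single u]
    simp [sg]
  rw [h1, Finsupp.sum, map_sum]
  refine Finset.sum_eq_zero fun x hx => ?_
  rw [map_smul, h x (hu hx), smul_zero]

theorem sg_mem {P : Set (ℤ × ℤ)} {x : ℤ × ℤ} (h : x ∈ P) : sg x ∈ spt P :=
  Finsupp.single_mem_supported ℚ 1 h

theorem single_ne {i j : ℤ} (h : (Finsupp.single i (1:ℚ)) j ≠ 0) : j = i := by
  by_contra hc
  exact h (by rw [Finsupp.single_apply, if_neg (fun h => hc h.symm)])

theorem d1_ne {i j : ℤ} (h : d1 (Finsupp.single i 1) j ≠ 0) : i % 2 = 1 ∧ (j = i + 1 ∨ j = i - 1) := by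
  rw [d1, lin_single_one] at h
  split_ifs at h with h1
  · refine ⟨h1, ?_⟩
    by_contra hc
    push Not at hc
    rw [Finsupp.sub_apply, Finsupp.single_apply, Finsupp.single_apply, if_neg hc.1.symm,
      if_neg hc.2.symm] at h
    simp at h
  · simp at h
theorem s1_ne {i j : ℤ} (h : s1 (Finsupp.single i 1) j ≠ 0) : j = i := by
  rw [s1, lin_single_one] at h
  split_ifs at h with h1
  · rw [Finsupp.neg_apply, neg_ne_zero] at h; exact single_ne h
  · exact single_ne h
theorem k1_ne {l : ℤ → ℤ} {i j : ℤ} (h : k1 l (Finsupp.single i 1) j ≠ 0) :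
    i % 2 = 0 ∧ j % 2 = 1 ∧ ((2 * l (i / 2) < j ∧ j < i) ∨ (i < j ∧ j < 2 * l (i / 2))) := by
  rw [k1, lin_single_one] at h
  split_ifs at h with h1
  · simp at h
  · have := path_apply_ne h
    omega
theorem e1_ne {l : ℤ → ℤ} {i j : ℤ} (h : e1 l (Finsupp.single i 1) j ≠ 0) :
    (i % 2 = 0 ∧ j = 2 * l (i / 2)) ∨ (i % 2 = 1 ∧ j % 2 = 1 ∧ ((2 * l (i / 2) < j ∧ j < 2 * l (i / 2 + 1))
      ∨ (2 * l (i / 2 + 1) < j ∧ j < 2 * l (i / 2)))) := by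
  rw [e1, lin_single_one] at h
  split_ifs at h with h1
  · have := path_apply_ne h
    omega
  · have := single_ne h
    omega
theorem s1_apply_ne {u : C1} {j : ℤ} (h : s1 u j ≠ 0) : u j ≠ 0 := by
  have : ∀ v : C1, s1 v j = (if j % 2 = 1 then -1 else 1) * v j := by
    intro v
    induction v using Finsupp.induction_linear with
    | zero => simp
    | add f g hf hg => simp [hf, hg, mul_add]
    | single i a =>
      rw [s1, lin_single]
      by_cases hij : i = j
      · subst hij; split_ifs <;> simp
      · split_ifs <;> simp [hij]
  rw [this] at h
  exact right_ne_zero_of_mul h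

theorem bx_ne {f g : C1 →ₗ[ℚ] C1} {x y : ℤ × ℤ} (h : bx f g (sg x) y ≠ 0) :
    f (Finsupp.single x.1 1) y.1 ≠ 0 ∧ g (Finsupp.single x.2 1) y.2 ≠ 0 := by
  rw [show x = (x.1, x.2) from rfl, sg, bx_single, bil_apply] at h
  exact ⟨left_ne_zero_of_mul h, right_ne_zero_of_mul h⟩

theorem D_ne {x y : ℤ × ℤ} (h : D (sg x) y ≠ 0) :
    (x.1 % 2 = 1 ∧ (y.1 = x.1 + 1 ∨ y.1 = x.1 - 1) ∧ y.2 = x.2) ∨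
    (x.2 % 2 = 1 ∧ y.1 = x.1 ∧ (y.2 = x.2 + 1 ∨ y.2 = x.2 - 1)) := by
  rw [D, LinearMap.add_apply, Finsupp.add_apply] at h
  by_cases h1 : bx d1 LinearMap.id (sg x) y = 0
  · rw [h1, zero_add] at h
    obtain ⟨h2, h3⟩ := bx_ne h
    have h2 := s1_ne h2
    have h3 := d1_ne h3
    tauto
  · obtain ⟨h2, h3⟩ := bx_ne h1
    have h2 := d1_ne h2
    have h3 := single_ne h3
    tauto

theorem K_ne {l l' : ℤ → ℤ} {x y : ℤ × ℤ} (h : K l l' (sg x) y ≠ 0) :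
    (x.1 % 2 = 0 ∧ y.1 % 2 = 1 ∧ ((2 * l (x.1 / 2) < y.1 ∧ y.1 < x.1) ∨ (x.1 < y.1 ∧ y.1 < 2 * l (x.1 / 2)))
      ∧ y.2 = x.2) ∨
    ((x.2 % 2 = 0 ∧ y.2 % 2 = 1 ∧ ((2 * l' (x.2 / 2) < y.2 ∧ y.2 < x.2) ∨ (x.2 < y.2 ∧ y.2 < 2 * l' (x.2 / 2)))) ∧
      ((x.1 % 2 = 0 ∧ y.1 = 2 * l (x.1 / 2)) ∨ (x.1 % 2 = 1 ∧ y.1 % 2 = 1 ∧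
      ((2 * l (x.1 / 2) < y.1 ∧ y.1 < 2 * l (x.1 / 2 + 1))
      ∨ (2 * l (x.1 / 2 + 1) < y.1 ∧ y.1 < 2 * l (x.1 / 2)))))) := by
  rw [K, LinearMap.add_apply, Finsupp.add_apply] at h
  by_cases h1 : bx (k1 l) LinearMap.id (sg x) y = 0
  · rw [h1, zero_add] at h
    obtain ⟨h2, h3⟩ := bx_ne h
    have h2 := e1_ne (s1_apply_ne h2)
    have h3 := k1_ne h3
    exact Or.inr ⟨h3, h2⟩
  · obtain ⟨h2, h3⟩ := bx_ne h1
    have h2 := k1_ne h2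
    have h3 := single_ne h3
    exact Or.inl ⟨h2.1, h2.2.1, h2.2.2, h3⟩

def dg (x : ℤ × ℤ) : ℤ := x.1 % 2 + x.2 % 2
def cor (x : ℤ × ℤ) : ℤ × ℤ := (x.1 / 2, x.2 / 2)
def vc (v : ℤ × ℤ) : ℤ × ℤ := (2 * v.1, 2 * v.2)
noncomputable abbrev vtx (v : ℤ × ℤ) : C2 := sg (vc v)

theorem D_dg {x y : ℤ × ℤ} (h : D (sg x) y ≠ 0) : dg y + 1 = dg x := by
  have := D_ne h; unfold dg; omega
theorem K_dg {l l'} {x y : ℤ × ℤ} (h : K l l' (sg x) y ≠ 0) : dg y = dg x + 1 := by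
  have := K_ne h; unfold dg; omega

def DG (n : ℤ) : Set (ℤ × ℤ) := {x | dg x = n}

theorem D_DG {n : ℤ} {u : C2} (hu : u ∈ spt (DG n)) : D u ∈ spt (DG (n - 1)) :=
  spt_map D (fun x hx => mem_spt.2 fun y hy => by
    have := D_dg hy; simp only [DG, Set.mem_ofPred_eq] at *; omega) hu
theorem K_DG {n : ℤ} {l l'} {u : C2} (hu : u ∈ spt (DG n)) : K l l' u ∈ spt (DG (n + 1)) :=
  spt_map (K l l') (fun x hx => mem_spt.2 fun y hy => by
    have := K_dg hy; simp only [DG, Set.mem_ofPred_eq] at *; omega) hu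

theorem DG_neg {n : ℤ} (hn : n < 0 ∨ 2 < n) {u : C2} (hu : u ∈ spt (DG n)) : u = 0 := by
  have := spt_zero LinearMap.id (P := DG n) (fun x hx => by
    exfalso; simp only [DG, Set.mem_ofPred_eq, dg] at hx; omega) hu
  simpa using this

noncomputable def aug : C2 →ₗ[ℚ] ℚ := lin fun x => if dg x = 0 then 1 else 0

theorem aug_DG {n : ℤ} (hn : n ≠ 0) {u : C2} (hu : u ∈ spt (DG n)) : aug u = 0 :=
  spt_zero aug (fun x hx => by
    simp only [DG, Set.mem_ofPred_eq] at hx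
    rw [aug, lin_single_one, if_neg (by omega)]) hu

noncomputable def Kb (b : ℤ × ℤ) : C2 →ₗ[ℚ] C2 := K (fun _ => b.1) (fun _ => b.2)

theorem E_const (b : ℤ × ℤ) (z : C2) : E (fun _ => b.1) (fun _ => b.2) z = aug z • vtx b := by
  have : E (fun _ => b.1) (fun _ => b.2) = lin fun x => aug (sg x) • vtx b := by
    apply ext1
    rintro ⟨i, j⟩
    rw [lin_single_one, E, bx_single, aug, lin_single_one]
    rcases Int.even_or_odd' i with ⟨a, rfl | rfl⟩ <;> rcases Int.even_or_odd' j with ⟨b, rfl | rfl⟩ <;>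
    simp only [e1_even, e1_odd, path_self]
    · rw [bil_single, if_pos (by simp only [dg]; omega), one_smul]; rfl
    all_goals rw [if_neg (by simp only [dg]; omega)]; simp [bil]
  rw [this]
  induction z using Finsupp.induction_linear with
  | zero => simp
  | add f g hf hg => rw [map_add, map_add, hf, hg, add_smul]
  | single x a =>
    rw [lin_single, aug, lin_single_one, lin_single, smul_smul, smul_eq_mul]

theorem D_Kb (b : ℤ × ℤ) (z : C2) : D (Kb b z) = z - aug z • vtx b - Kb b (D z) := by
  have := LinearMap.congr_fun (D_K (fun _ => b.1) (fun _ => b.2)) z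
  simp only [LinearMap.add_apply, LinearMap.comp_apply, LinearMap.sub_apply, LinearMap.id_apply,
    E_const] at this
  rw [Kb, ← this]; abel

theorem D_vtx (v : ℤ × ℤ) : D (vtx v) = 0 :=
  DG_neg (n := 0 - 1) (by omega) (D_DG (sg_mem (by simp [DG, dg, vc])))

theorem vtx_DG (v : ℤ × ℤ) : vtx v ∈ spt (DG 0) := sg_mem (by simp [DG, dg, vc])
theorem sg_DG (x : ℤ × ℤ) : sg x ∈ spt (DG (dg x)) := sg_mem (by simp [DG])
theorem dg_cases (x : ℤ × ℤ) : dg x = 0 ∨ dg x = 1 ∨ dg x = 2 := by unfold dg; omega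

theorem bil_sub_left (u u' v : C1) : bil (u - u') v = bil u v - bil u' v := by
  simp [bil, sub_tmul]
theorem bil_zero_right (u : C1) : bil u 0 = 0 := by simp [bil]
theorem bil_zero_left (u : C1) : bil 0 u = 0 := by simp [bil]
theorem bil_sub_right (u v v' : C1) : bil u (v - v') = bil u v - bil u v' := by
  simp [bil, tmul_sub]
theorem D_h (a b : ℤ) : D (sg (2 * a + 1, 2 * b)) = vtx (a + 1, b) - vtx (a, b) := by
  rw [D, LinearMap.add_apply, bx_single, bx_single, d1_odd, d1_even, bil_zero_right, add_zero,
    bil_sub_left, LinearMap.id_apply, bil_single, bil_single]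
  rfl
theorem D_v (a b : ℤ) : D (sg (2 * a, 2 * b + 1)) = vtx (a, b + 1) - vtx (a, b) := by
  rw [D, LinearMap.add_apply, bx_single, bx_single, d1_odd, d1_even, bil_zero_left, zero_add,
    s1_even, bil_sub_right, bil_single, bil_single]
  rfl
theorem aug_vtx (v) : aug (vtx v) = 1 := by
  rw [aug, lin_single_one, if_pos (by simp [dg, vc])]

theorem ext_dg {M : Type*} [AddCommGroup M] [Module ℚ M] {f g : C2 →ₗ[ℚ] M}
    (h0 : ∀ x, dg x = 0 → f (sg x) = g (sg x)) (h1 : ∀ x, dg x = 1 → f (sg x) = g (sg x))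
    (h2 : ∀ x, dg x = 2 → f (sg x) = g (sg x)) : f = g := by
  apply ext1
  intro x
  rcases dg_cases x with h | h | h
  · exact h0 x h
  · exact h1 x h
  · exact h2 x h

theorem aug_D (z : C2) : aug (D z) = 0 := by
  have : aug ∘ₗ D = 0 := by
    apply ext_dg <;> rintro ⟨i, j⟩ hx
    · exact aug_DG (n := dg (i, j) - 1) (by omega) (D_DG (sg_DG _))
    · rcases Int.even_or_odd' i with ⟨a, rfl | rfl⟩ <;>
        rcases Int.even_or_odd' j with ⟨b, rfl | rfl⟩
      · simp only [dg] at hx; omega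
      · simp [D_v, aug_vtx]
      · simp [D_h, aug_vtx]
      · simp only [dg] at hx; omega
    · exact aug_DG (n := dg (i, j) - 1) (by omega) (D_DG (sg_DG _))
  exact LinearMap.congr_fun this z

theorem Kb_DG {n : ℤ} {b} {u : C2} (hu : u ∈ spt (DG n)) : Kb b u ∈ spt (DG (n + 1)) := K_DG hu

/-! ### the chain map and the homotopy -/
noncomputable def pr (n : ℤ) : C2 →ₗ[ℚ] C2 := lin fun x => if dg x = n then sg x else 0
noncomputable def c0 (φ : ℤ × ℤ → ℤ × ℤ) : C2 →ₗ[ℚ] C2 :=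
  lin fun x => if dg x = 0 then vtx (φ (cor x)) else 0
noncomputable def cc1 (φ : ℤ × ℤ → ℤ × ℤ) : C2 →ₗ[ℚ] C2 :=
  lin fun x => Kb (φ (cor x)) (c0 φ (D (sg x)))
noncomputable def cc2 (φ : ℤ × ℤ → ℤ × ℤ) : C2 →ₗ[ℚ] C2 :=
  lin fun x => Kb (φ (cor x)) (cc1 φ (D (sg x)))
noncomputable def h0 (φ : ℤ × ℤ → ℤ × ℤ) : C2 →ₗ[ℚ] C2 :=
  lin fun x => if dg x = 0 then Kb (cor x) (vtx (φ (cor x))) else 0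
noncomputable def h1 (φ : ℤ × ℤ → ℤ × ℤ) : C2 →ₗ[ℚ] C2 :=
  lin fun x => Kb (cor x) (cc1 φ (sg x) - pr 1 (sg x) - h0 φ (D (sg x)))
noncomputable def cM (φ : ℤ × ℤ → ℤ × ℤ) : C2 →ₗ[ℚ] C2 := c0 φ + cc1 φ + cc2 φ
noncomputable def hM (φ : ℤ × ℤ → ℤ × ℤ) : C2 →ₗ[ℚ] C2 := h0 φ + h1 φ

variable (φ : ℤ × ℤ → ℤ × ℤ)

theorem pr_sg (n x) : pr n (sg x) = if dg x = n then sg x else 0 := lin_single_one _ _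
theorem pr_self {n : ℤ} {u : C2} (hu : u ∈ spt (DG n)) : pr n u = u := by
  have := spt_zero (pr n - LinearMap.id) (P := DG n) (fun x hx => by
    simp only [DG, Set.mem_ofPred_eq] at hx
    rw [LinearMap.sub_apply, pr_sg, if_pos hx]; simp) hu
  rwa [LinearMap.sub_apply, sub_eq_zero] at this
theorem pr_ne {n m : ℤ} (hnm : n ≠ m) {u : C2} (hu : u ∈ spt (DG m)) : pr n u = 0 :=
  spt_zero (pr n) (P := DG m) (fun x hx => by
    simp only [DG, Set.mem_ofPred_eq] at hx
    rw [pr_sg, if_neg (by omega)]) hu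
theorem pr_DG (n : ℤ) (u : C2) : pr n u ∈ spt (DG n) :=
  spt_map (pr n) (P := Set.univ) (fun x _ => by
    rw [pr_sg]; split_ifs with h
    · exact sg_mem h
    · exact Submodule.zero_mem _) (by simp)
theorem pr_D (n : ℤ) (u : C2) : pr n (D u) = D (pr (n + 1) u) := by
  have : pr n ∘ₗ D = D ∘ₗ pr (n + 1) := by
    apply ext1
    intro x
    simp only [LinearMap.comp_apply]
    by_cases h : dg x = n + 1
    · rw [pr_self (n := n) (by have := D_DG (sg_DG x); rw [h] at this; simpa using this), pr_sg, if_pos h]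
    · rw [pr_ne (m := dg x - 1) (by omega) (D_DG (sg_DG x)), pr_sg, if_neg h, map_zero]
  exact LinearMap.congr_fun this u
theorem pr_sum (u : C2) : pr 0 u + pr 1 u + pr 2 u = u := by
  have : pr 0 + pr 1 + pr 2 = LinearMap.id := by
    apply ext1
    intro x
    simp only [LinearMap.add_apply, pr_sg, LinearMap.id_apply]
    rcases dg_cases x with h | h | h <;> simp [h]
  exact LinearMap.congr_fun this u

theorem c0_sg (x) : c0 φ (sg x) = if dg x = 0 then vtx (φ (cor x)) else 0 := lin_single_one _ _
theorem cc1_sg (x) : cc1 φ (sg x) = Kb (φ (cor x)) (c0 φ (D (sg x))) := lin_single_one _ _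
theorem cc2_sg (x) : cc2 φ (sg x) = Kb (φ (cor x)) (cc1 φ (D (sg x))) := lin_single_one _ _
theorem h0_sg (x) : h0 φ (sg x) = if dg x = 0 then Kb (cor x) (vtx (φ (cor x))) else 0 := lin_single_one _ _
theorem h1_sg (x) : h1 φ (sg x) = Kb (cor x) (cc1 φ (sg x) - pr 1 (sg x) - h0 φ (D (sg x))) :=
  lin_single_one _ _

theorem c0_DG (u : C2) : c0 φ u ∈ spt (DG 0) :=
  spt_map (c0 φ) (P := Set.univ) (fun x _ => by
    rw [c0_sg]; split_ifs
    · exact vtx_DG _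
    · exact Submodule.zero_mem _) (by simp)
theorem cc1_DG (u : C2) : cc1 φ u ∈ spt (DG 1) :=
  spt_map (cc1 φ) (P := Set.univ) (fun x _ => by
    rw [cc1_sg]; exact Kb_DG (c0_DG φ _)) (by simp)
theorem cc2_DG (u : C2) : cc2 φ u ∈ spt (DG 2) :=
  spt_map (cc2 φ) (P := Set.univ) (fun x _ => by
    rw [cc2_sg]; exact Kb_DG (cc1_DG φ _)) (by simp)
theorem h0_DG (u : C2) : h0 φ u ∈ spt (DG 1) :=
  spt_map (h0 φ) (P := Set.univ) (fun x _ => by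
    rw [h0_sg]; split_ifs
    · exact Kb_DG (vtx_DG _)
    · exact Submodule.zero_mem _) (by simp)
theorem h1_DG (u : C2) : h1 φ u ∈ spt (DG 2) :=
  spt_map (h1 φ) (P := Set.univ) (fun x _ => by
    rw [h1_sg]; exact Kb_DG (Submodule.sub_mem _ (Submodule.sub_mem _ (cc1_DG φ _) (pr_DG _ _))
      (h0_DG φ _))) (by simp)

theorem c0_ne {n : ℤ} (hn : n ≠ 0) {u : C2} (hu : u ∈ spt (DG n)) : c0 φ u = 0 :=
  spt_zero _ (fun x hx => by
    simp only [DG, Set.mem_ofPred_eq] at hx; rw [c0_sg, if_neg (by omega)]) hu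
theorem cc1_ne {n : ℤ} (hn : n ≠ 1) {u : C2} (hu : u ∈ spt (DG n)) : cc1 φ u = 0 :=
  spt_zero _ (fun x hx => by
    rw [cc1_sg, c0_ne φ (n := n - 1) (by omega) (D_DG (sg_mem hx)), map_zero]) hu
theorem cc2_ne {n : ℤ} (hn : n ≠ 2) {u : C2} (hu : u ∈ spt (DG n)) : cc2 φ u = 0 :=
  spt_zero _ (fun x hx => by
    rw [cc2_sg, cc1_ne φ (n := n - 1) (by omega) (D_DG (sg_mem hx)), map_zero]) hu

theorem aug_c0 (z : C2) : aug (c0 φ z) = aug z := by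
  have : aug ∘ₗ c0 φ = aug := by
    apply ext1
    intro x
    rw [LinearMap.comp_apply, c0_sg]
    split_ifs with h
    · rw [aug_vtx, aug, lin_single_one, if_pos h]
    · rw [map_zero, aug, lin_single_one, if_neg h]
  exact LinearMap.congr_fun this z
theorem D_c0 (z : C2) : D (c0 φ z) = 0 := DG_neg (n := 0 - 1) (by omega) (D_DG (c0_DG φ z))
theorem D_Dz (z : C2) : D (D z) = 0 := LinearMap.congr_fun D_D z

theorem D_cc1 (z : C2) : D (cc1 φ z) = c0 φ (D z) := by
  have : D ∘ₗ cc1 φ = c0 φ ∘ₗ D := by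
    apply ext1
    intro x
    simp only [LinearMap.comp_apply]
    rw [cc1_sg, D_Kb, aug_c0, aug_D, D_c0]; simp
  exact LinearMap.congr_fun this z
theorem D_cc2 (z : C2) : D (cc2 φ z) = cc1 φ (D z) := by
  have : D ∘ₗ cc2 φ = cc1 φ ∘ₗ D := by
    apply ext1
    intro x
    simp only [LinearMap.comp_apply]
    rw [cc2_sg, D_Kb, aug_DG (n := 1) (by omega) (cc1_DG φ _), D_cc1, D_Dz]; simp
  exact LinearMap.congr_fun this z
theorem D_cM (z : C2) : D (cM φ z) = cM φ (D z) := by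
  have h2 : cc2 φ (D z) = 0 := by
    have : cc2 φ ∘ₗ D = 0 := by
      apply ext1
      intro x
      exact cc2_ne φ (n := dg x - 1) (by have := dg_cases x; omega) (D_DG (sg_DG x))
    exact LinearMap.congr_fun this z
  simp only [cM, LinearMap.add_apply, map_add]
  rw [D_c0, D_cc1, D_cc2, h2]; simp

theorem vc_cor {x : ℤ × ℤ} (h : dg x = 0) : vc (cor x) = x := by
  rcases x with ⟨i, j⟩
  simp only [vc, cor, dg, Prod.mk.injEq] at *
  omega

theorem D_h0 (z : C2) : D (h0 φ z) = c0 φ z - pr 0 z := by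
  have : D ∘ₗ h0 φ = c0 φ - pr 0 := by
    apply ext1
    intro x
    simp only [LinearMap.comp_apply, LinearMap.sub_apply]
    rw [h0_sg, c0_sg, pr_sg]
    split_ifs with h
    · rw [D_Kb, aug_vtx, D_vtx, map_zero, one_smul, sub_zero]
      rw [show vtx (cor x) = sg x from congrArg sg (vc_cor h)]
    · simp
  exact LinearMap.congr_fun this z
theorem D_h1 (z : C2) : D (h1 φ z) = cc1 φ z - pr 1 z - h0 φ (D z) := by
  have : D ∘ₗ h1 φ = cc1 φ - pr 1 - h0 φ ∘ₗ D := by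
    apply ext1
    intro x
    simp only [LinearMap.comp_apply, LinearMap.sub_apply]
    rw [h1_sg, D_Kb, aug_DG (n := 1) (by omega) (Submodule.sub_mem _ (Submodule.sub_mem _
      (cc1_DG φ _) (pr_DG _ _)) (h0_DG φ _)), map_sub D, map_sub D, D_cc1, D_h0, pr_D]
    simp
  exact LinearMap.congr_fun this z
theorem h1_D (z : C2) : h1 φ (D z) = cc2 φ z - pr 2 z := by
  set w := cc2 φ z - pr 2 z - h1 φ (D z) with hw
  have hw2 : w ∈ spt (DG 2) :=
    Submodule.sub_mem _ (Submodule.sub_mem _ (cc2_DG φ _) (pr_DG _ _)) (h1_DG φ _)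
  have hDw : D w = 0 := by
    rw [hw, map_sub, map_sub, D_cc2, D_h1, D_Dz, map_zero, pr_D]; simp
  have := D_Kb 0 w
  rw [DG_neg (n := 2 + 1) (by omega) (Kb_DG hw2), hDw, aug_DG (n := 2) (by omega) hw2] at this
  simp only [map_zero, zero_smul, sub_zero] at this
  rw [hw] at this
  exact (sub_eq_zero.1 this.symm).symm
theorem cM_hM (z : C2) : cM φ z - z = D (hM φ z) + hM φ (D z) := by
  simp only [cM, hM, LinearMap.add_apply, map_add]
  rw [D_h0, D_h1, h1_D]
  conv_lhs => rhs; rw [← pr_sum z]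
  abel

end Mob

namespace Mob
open TensorProduct

def Bx (p q : ℤ × ℤ) : Set (ℤ × ℤ) :=
  {x | 2 * p.1 ≤ x.1 ∧ x.1 ≤ 2 * q.1 ∧ 2 * p.2 ≤ x.2 ∧ x.2 ≤ 2 * q.2}
def Vx (p q : ℤ × ℤ) : Set (ℤ × ℤ) := {v | p.1 ≤ v.1 ∧ v.1 ≤ q.1 ∧ p.2 ≤ v.2 ∧ v.2 ≤ q.2}
def Cor (x v : ℤ × ℤ) : Prop := 2 * v.1 - 1 ≤ x.1 ∧ x.1 ≤ 2 * v.1 + 1 ∧ 2 * v.2 - 1 ≤ x.2 ∧ x.2 ≤ 2 * v.2 + 1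

theorem cor_Cor (x) : Cor x (cor x) := by unfold Cor cor; dsimp only; omega
theorem Cor_D {x y v : ℤ × ℤ} (h : D (sg x) y ≠ 0) (hv : Cor y v) : Cor x v := by
  have := D_ne h
  unfold Cor at *
  omega
theorem vtx_mem_Bx {p q v : ℤ × ℤ} (h : v ∈ Vx p q) : vtx v ∈ spt (Bx p q) := by
  apply sg_mem
  simp only [Vx, Bx, vc, Set.mem_ofPred_eq] at *
  omega
theorem Kb_Bx {p q b : ℤ × ℤ} (hb : b ∈ Vx p q) {u : C2} (hu : u ∈ spt (Bx p q)) :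
    Kb b u ∈ spt (Bx p q) :=
  spt_map _ (fun x hx => mem_spt.2 fun y hy => by
    have := K_ne hy
    simp only [Bx, Vx, Set.mem_ofPred_eq] at *
    omega) hu

variable (φ : ℤ × ℤ → ℤ × ℤ)

theorem c0_Bx {p q x : ℤ × ℤ} (h : ∀ v, Cor x v → φ v ∈ Vx p q) : c0 φ (sg x) ∈ spt (Bx p q) := by
  rw [c0_sg]
  split_ifs
  · exact vtx_mem_Bx (h _ (cor_Cor x))
  · exact Submodule.zero_mem _
theorem cc1_Bx {p q x : ℤ × ℤ} (h : ∀ v, Cor x v → φ v ∈ Vx p q) : cc1 φ (sg x) ∈ spt (Bx p q) := by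
  rw [cc1_sg]
  exact Kb_Bx (h _ (cor_Cor x)) (spt_map (c0 φ) (P := {y | D (sg x) y ≠ 0})
    (fun y hy => c0_Bx φ fun v hv => h v (Cor_D hy hv)) (mem_spt.2 fun y hy => hy))
theorem cc2_Bx {p q x : ℤ × ℤ} (h : ∀ v, Cor x v → φ v ∈ Vx p q) : cc2 φ (sg x) ∈ spt (Bx p q) := by
  rw [cc2_sg]
  exact Kb_Bx (h _ (cor_Cor x)) (spt_map (cc1 φ) (P := {y | D (sg x) y ≠ 0})
    (fun y hy => cc1_Bx φ fun v hv => h v (Cor_D hy hv)) (mem_spt.2 fun y hy => hy))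
theorem cM_Bx {p q x : ℤ × ℤ} (h : ∀ v, Cor x v → φ v ∈ Vx p q) : cM φ (sg x) ∈ spt (Bx p q) :=
  Submodule.add_mem _ (Submodule.add_mem _ (c0_Bx φ h) (cc1_Bx φ h)) (cc2_Bx φ h)

theorem sg_Bx {p q x : ℤ × ℤ} (h : ∀ v, Cor x v → v ∈ Vx p q) : sg x ∈ spt (Bx p q) := by
  apply sg_mem
  have h1 := h (x.1 / 2, x.2 / 2) (by unfold Cor; dsimp only; omega)
  have h2 := h ((x.1 + 1) / 2, (x.2 + 1) / 2) (by unfold Cor; dsimp only; omega)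
  simp only [Vx, Bx, Set.mem_ofPred_eq] at *
  omega
theorem h0_Bx {p q x : ℤ × ℤ} (h : ∀ v, Cor x v → v ∈ Vx p q ∧ φ v ∈ Vx p q) :
    h0 φ (sg x) ∈ spt (Bx p q) := by
  rw [h0_sg]
  split_ifs
  · exact Kb_Bx (h _ (cor_Cor x)).1 (vtx_mem_Bx (h _ (cor_Cor x)).2)
  · exact Submodule.zero_mem _
theorem h1_Bx {p q x : ℤ × ℤ} (h : ∀ v, Cor x v → v ∈ Vx p q ∧ φ v ∈ Vx p q) :
    h1 φ (sg x) ∈ spt (Bx p q) := by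
  rw [h1_sg]
  refine Kb_Bx (h _ (cor_Cor x)).1 (Submodule.sub_mem _ (Submodule.sub_mem _
    (cc1_Bx φ fun v hv => (h v hv).2) ?_) ?_)
  · rw [pr_sg]; split_ifs
    · exact sg_Bx fun v hv => (h v hv).1
    · exact Submodule.zero_mem _
  · exact spt_map (h0 φ) (P := {y | D (sg x) y ≠ 0})
      (fun y hy => h0_Bx φ fun v hv => h v (Cor_D hy hv)) (mem_spt.2 fun y hy => hy)
theorem hM_Bx {p q x : ℤ × ℤ} (h : ∀ v, Cor x v → v ∈ Vx p q ∧ φ v ∈ Vx p q) :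
    hM φ (sg x) ∈ spt (Bx p q) :=
  Submodule.add_mem _ (h0_Bx φ h) (h1_Bx φ h)

/-- `c` preserves degree -/
theorem cM_DG (x : ℤ × ℤ) : cM φ (sg x) ∈ spt (DG (dg x)) := by
  have hx := sg_DG x
  simp only [cM, LinearMap.add_apply]
  rcases dg_cases x with h | h | h <;> rw [h] at hx ⊢
  · rw [cc1_ne φ (by omega) hx, cc2_ne φ (by omega) hx, add_zero, add_zero]; exact c0_DG φ _
  · rw [c0_ne φ (by omega) hx, cc2_ne φ (by omega) hx, add_zero, zero_add]; exact cc1_DG φ _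
  · rw [c0_ne φ (by omega) hx, cc1_ne φ (by omega) hx, zero_add, zero_add]; exact cc2_DG φ _

theorem eps_DG {n : ℤ} {u : C2} (hu : u ∈ spt (DG n)) :
    eps u = (if n % 2 = 0 then (1 : ℚ) else -1) • u := by
  have := spt_zero (eps - (if n % 2 = 0 then (1 : ℚ) else -1) • LinearMap.id) (P := DG n)
    (fun x hx => by
      rcases x with ⟨i, j⟩
      simp only [DG, Set.mem_ofPred_eq, dg] at hx
      rw [LinearMap.sub_apply, eps_single, LinearMap.smul_apply, LinearMap.id_apply, sub_eq_zero]
      congr 1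
      have : (i + j) % 2 = 0 ↔ n % 2 = 0 := by omega
      simp only [this]) hu
  rwa [LinearMap.sub_apply, sub_eq_zero] at this
theorem cM_eps (z : C2) : cM φ (eps z) = eps (cM φ z) := by
  have : cM φ ∘ₗ eps = eps ∘ₗ cM φ := by
    apply ext1
    intro x
    simp only [LinearMap.comp_apply]
    rw [eps_DG (sg_DG x), eps_DG (cM_DG φ x), map_smul]
  exact LinearMap.congr_fun this z

/-! ### coefficients of the boundary -/
def sh (q : ℤ) (x : ℤ × ℤ) : ℤ × ℤ := (x.1 + 2 * q, x.2)
def shv (q : ℤ) (x : ℤ × ℤ) : ℤ × ℤ := (x.1 + q, x.2)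
noncomputable def t1 (q : ℤ) : C1 →ₗ[ℚ] C1 := lin fun i => Finsupp.single (i + 2 * q) 1
noncomputable def tau (q : ℤ) : C2 →ₗ[ℚ] C2 := lin fun x => sg (sh q x)

theorem tau_sg (q x) : tau q (sg x) = sg (sh q x) := lin_single_one _ _
theorem t1_single (q i) : t1 q (Finsupp.single i 1) = Finsupp.single (i + 2 * q) 1 := lin_single_one _ _
theorem tau_bx (q) : tau q = bx (t1 q) LinearMap.id := by
  apply ext1
  rintro ⟨i, j⟩
  rw [tau_sg, bx_single, t1_single, LinearMap.id_apply, bil_single, sh]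
theorem t1_path (q b a : ℤ) : t1 q (path b a) = path (b + q) (a + q) := by
  induction a using path_ind b with
  | h0 => simp [path_self]
  | h1 a =>
    rw [path_succ, map_add, t1_single, add_right_comm a 1 q, path_succ,
      show 2 * a + 1 + 2 * q = 2 * (a + q) + 1 by ring, add_left_inj]
theorem t1_even (q a : ℤ) : t1 q (Finsupp.single (2 * a) 1) = Finsupp.single (2 * (a + q)) 1 := by
  rw [t1_single]; congr 1; ring
theorem t1_odd (q a : ℤ) : t1 q (Finsupp.single (2 * a + 1) 1) = Finsupp.single (2 * (a + q) + 1) 1 := by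
  rw [t1_single]; congr 1; ring
theorem d1_t1 (q) : d1 ∘ₗ t1 q = t1 q ∘ₗ d1 := by
  apply ext_eo <;> intro a
  · simp [t1_even, d1_even]
  · simp only [LinearMap.comp_apply, t1_odd, d1_odd, map_sub, t1_even, add_right_comm a 1 q]
theorem s1_t1 (q) : s1 ∘ₗ t1 q = t1 q ∘ₗ s1 := by
  apply ext_eo <;> intro a
  · simp [t1_even, s1_even]
  · simp [t1_odd, s1_odd]
theorem k1_t1 {l l2 : ℤ → ℤ} {q : ℤ} (h : ∀ a, l2 (a + q) = l a + q) : k1 l2 ∘ₗ t1 q = t1 q ∘ₗ k1 l := by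
  apply ext_eo <;> intro a
  · simp [t1_even, k1_even, t1_path, h]
  · simp [t1_odd, k1_odd]
theorem e1_t1 {l l2 : ℤ → ℤ} {q : ℤ} (h : ∀ a, l2 (a + q) = l a + q) : e1 l2 ∘ₗ t1 q = t1 q ∘ₗ e1 l := by
  apply ext_eo <;> intro a
  · simp [t1_even, e1_even, h]
  · have := h (a + 1)
    rw [add_right_comm] at this
    simp [t1_odd, e1_odd, t1_path, h, this]
theorem D_tau (q) (z : C2) : D (tau q z) = tau q (D z) := by
  have : D ∘ₗ tau q = tau q ∘ₗ D := by
    rw [tau_bx, D]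
    simp only [LinearMap.comp_add, LinearMap.add_comp, bx_comp, LinearMap.id_comp, LinearMap.comp_id,
      d1_t1, s1_t1]
  exact LinearMap.congr_fun this z
theorem K_tau {l l2 l' : ℤ → ℤ} {q : ℤ} (h : ∀ a, l2 (a + q) = l a + q) (z : C2) :
    K l2 l' (tau q z) = tau q (K l l' z) := by
  have hse : (s1 ∘ₗ e1 l2) ∘ₗ t1 q = t1 q ∘ₗ (s1 ∘ₗ e1 l) := by
    rw [LinearMap.comp_assoc, e1_t1 h, ← LinearMap.comp_assoc, s1_t1, LinearMap.comp_assoc]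
  have : K l2 l' ∘ₗ tau q = tau q ∘ₗ K l l' := by
    rw [tau_bx, K, K, LinearMap.comp_add, LinearMap.add_comp, bx_comp, bx_comp, bx_comp, bx_comp,
      k1_t1 h, hse, LinearMap.comp_id, LinearMap.comp_id, LinearMap.id_comp]
  exact LinearMap.congr_fun this z
theorem Kb_tau (q : ℤ) (b) (z : C2) : Kb (shv q b) (tau q z) = tau q (Kb b z) :=
  K_tau (fun _ => rfl) z

theorem dg_sh (q x) : dg (sh q x) = dg x := by unfold dg sh; dsimp only; omega
theorem cor_sh (q x) : cor (sh q x) = shv q (cor x) := by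
  unfold cor sh shv; ext <;> dsimp only; omega
theorem tau_vtx (q v) : tau q (vtx v) = vtx (shv q v) := by
  rw [vtx, tau_sg]; unfold sh vc shv; congr 2; dsimp only; ring
theorem pr_tau (q n) (z : C2) : pr n (tau q z) = tau q (pr n z) := by
  have : pr n ∘ₗ tau q = tau q ∘ₗ pr n := by
    apply ext1; intro x
    simp only [LinearMap.comp_apply]
    rw [tau_sg, pr_sg, pr_sg, dg_sh]; split_ifs
    · rw [tau_sg]
    · simp
  exact LinearMap.congr_fun this z

theorem c0_tau {q} (hφ : ∀ v, φ (shv q v) = shv q (φ v)) (z : C2) : c0 φ (tau q z) = tau q (c0 φ z) := by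
  have : c0 φ ∘ₗ tau q = tau q ∘ₗ c0 φ := by
    apply ext1; intro x
    simp only [LinearMap.comp_apply]
    rw [tau_sg, c0_sg, c0_sg, dg_sh, cor_sh, hφ]; split_ifs
    · rw [tau_vtx]
    · simp
  exact LinearMap.congr_fun this z
theorem cc1_tau {q} (hφ : ∀ v, φ (shv q v) = shv q (φ v)) (z : C2) : cc1 φ (tau q z) = tau q (cc1 φ z) := by
  have : cc1 φ ∘ₗ tau q = tau q ∘ₗ cc1 φ := by
    apply ext1; intro x
    simp only [LinearMap.comp_apply]
    rw [tau_sg, cc1_sg, cc1_sg, cor_sh, hφ, ← tau_sg, D_tau, c0_tau φ hφ, Kb_tau]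
  exact LinearMap.congr_fun this z
theorem cc2_tau {q} (hφ : ∀ v, φ (shv q v) = shv q (φ v)) (z : C2) : cc2 φ (tau q z) = tau q (cc2 φ z) := by
  have : cc2 φ ∘ₗ tau q = tau q ∘ₗ cc2 φ := by
    apply ext1; intro x
    simp only [LinearMap.comp_apply]
    rw [tau_sg, cc2_sg, cc2_sg, cor_sh, hφ, ← tau_sg, D_tau, cc1_tau φ hφ, Kb_tau]
  exact LinearMap.congr_fun this z
theorem cM_tau {q} (hφ : ∀ v, φ (shv q v) = shv q (φ v)) (z : C2) : cM φ (tau q z) = tau q (cM φ z) := by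
  simp only [cM, LinearMap.add_apply, map_add, c0_tau φ hφ, cc1_tau φ hφ, cc2_tau φ hφ]
theorem h0_tau {q} (hφ : ∀ v, φ (shv q v) = shv q (φ v)) (z : C2) : h0 φ (tau q z) = tau q (h0 φ z) := by
  have : h0 φ ∘ₗ tau q = tau q ∘ₗ h0 φ := by
    apply ext1; intro x
    simp only [LinearMap.comp_apply]
    rw [tau_sg, h0_sg, h0_sg, dg_sh, cor_sh, hφ]; split_ifs
    · rw [← tau_vtx, Kb_tau]
    · simp
  exact LinearMap.congr_fun this z
theorem h1_tau {q} (hφ : ∀ v, φ (shv q v) = shv q (φ v)) (z : C2) : h1 φ (tau q z) = tau q (h1 φ z) := by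
  have : h1 φ ∘ₗ tau q = tau q ∘ₗ h1 φ := by
    apply ext1; intro x
    simp only [LinearMap.comp_apply]
    rw [tau_sg, h1_sg, h1_sg, cor_sh, ← tau_sg, D_tau, cc1_tau φ hφ, h0_tau φ hφ, pr_tau, ← map_sub,
      ← map_sub, Kb_tau]
  exact LinearMap.congr_fun this z
theorem hM_tau {q} (hφ : ∀ v, φ (shv q v) = shv q (φ v)) (z : C2) : hM φ (tau q z) = tau q (hM φ z) := by
  simp only [hM, LinearMap.add_apply, map_add, h0_tau φ hφ, h1_tau φ hφ]

end Mob

namespace Mob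
open TensorProduct

def red (q : ℤ) (x : ℤ × ℤ) : ℤ × ℤ := (x.1 % (2 * q), x.2)
/-- fundamental domain -/
def fd (q : ℤ) (P : Set (ℤ × ℤ)) : Set (ℤ × ℤ) := {x | x ∈ P ∧ 0 ≤ x.1 ∧ x.1 < 2 * q}
abbrev W (q : ℤ) (P : Set (ℤ × ℤ)) := (fd q P) →₀ ℚ
noncomputable def io (q : ℤ) (P : Set (ℤ × ℤ)) : W q P →ₗ[ℚ] C2 := lin fun s => sg s.1
open Classical in
noncomputable def Pj (q : ℤ) (P : Set (ℤ × ℤ)) : C2 →ₗ[ℚ] W q P :=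
  lin fun x => if h : red q x ∈ fd q P then Finsupp.single ⟨red q x, h⟩ 1 else 0
noncomputable def mk (q : ℤ) (P : Set (ℤ × ℤ)) (A : C2 →ₗ[ℚ] C2) : Module.End ℚ (W q P) :=
  Pj q P ∘ₗ A ∘ₗ io q P
/-- coefficient functional modulo period -/
noncomputable def cf (q : ℤ) (x : ℤ × ℤ) : C2 →ₗ[ℚ] ℚ :=
  lin fun y => if red q y = red q x then 1 else 0
def Per (q : ℤ) (P : Set (ℤ × ℤ)) : Prop := ∀ n x, sh (n * q) x ∈ P ↔ x ∈ P
def Eqv (q : ℤ) (A : C2 →ₗ[ℚ] C2) : Prop := ∀ n z, A (tau (n * q) z) = tau (n * q) (A z)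

variable {q : ℤ} {P : Set (ℤ × ℤ)}

theorem red_sh (n x) : red q (sh (n * q) x) = red q x := by
  unfold red sh
  dsimp only
  rw [show x.1 + 2 * (n * q) = x.1 + (2 * q) * n by ring, Int.add_mul_emod_self_left]
theorem red_eq (x) : sh ((x.1 / (2 * q)) * q) (red q x) = x := by
  unfold red sh
  have := Int.emod_add_mul_ediv x.1 (2 * q)
  ext
  · dsimp only
    linarith
  · rfl
theorem red_dvd {x y} : red q x = red q y ↔ (2 * q) ∣ (x.1 - y.1) ∧ x.2 = y.2 := by
  unfold red
  rw [Prod.mk.injEq, Int.emod_eq_emod_iff_emod_sub_eq_zero, Int.dvd_iff_emod_eq_zero]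
theorem red_eq_iff {x y} : red q x = red q y ↔ ∃ n, y = sh (n * q) x := by
  rw [red_dvd]
  constructor
  · rintro ⟨⟨n, hn⟩, h⟩
    refine ⟨-n, ?_⟩
    unfold sh
    ext
    · dsimp only
      linarith
    · exact h.symm
  · rintro ⟨n, rfl⟩
    exact ⟨⟨-n, by unfold sh; dsimp only; ring⟩, rfl⟩
theorem sh_add (a b x) : sh a (sh b x) = sh (a + b) x := by
  unfold sh; ext <;> dsimp only; ring
theorem sh_zero (x) : sh 0 x = x := by unfold sh; simp
theorem red_mem (hq : 0 < q) (hP : Per q P) {x} : red q x ∈ fd q P ↔ x ∈ P := by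
  have h := hP (x.1 / (2 * q)) (red q x)
  rw [red_eq] at h
  rw [h]
  exact ⟨fun h => h.1, fun h => ⟨h, Int.emod_nonneg _ (by omega), Int.emod_lt_of_pos _ (by omega)⟩⟩
theorem red_fd {s} (hs : s ∈ fd q P) : red q s = s := by
  obtain ⟨_, h1, h2⟩ := hs
  unfold red
  rw [Int.emod_eq_of_lt h1 h2]

theorem io_single (s) : io q P (Finsupp.single s 1) = sg s.1 := lin_single_one _ _
theorem cf_sg (x y) : cf q x (sg y) = if red q y = red q x then 1 else 0 := lin_single_one _ _
theorem Pj_sg_mem (hq : 0 < q) (hP : Per q P) {x} (hx : x ∈ P) :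
    Pj q P (sg x) = Finsupp.single ⟨red q x, (red_mem hq hP).2 hx⟩ 1 := by
  rw [Pj, sg, lin_single_one, dif_pos]
theorem Pj_sg_nmem (hq : 0 < q) (hP : Per q P) {x} (hx : x ∉ P) : Pj q P (sg x) = 0 := by
  rw [Pj, sg, lin_single_one, dif_neg]
  rwa [red_mem hq hP]
theorem Pj_apply (u : C2) (s : fd q P) : Pj q P u s = cf q s.1 u := by
  have : (Finsupp.lapply s) ∘ₗ Pj q P = cf q s.1 := by
    apply ext1
    intro x
    rw [LinearMap.comp_apply, Pj, lin_single_one, cf, lin_single_one, red_fd s.2]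
    simp only [Finsupp.lapply_apply]
    split_ifs with h1 h2 h2
    · simp [Finsupp.single_apply, h2]
    · rw [Finsupp.single_apply, if_neg]
      intro h
      exact h2 (congrArg Subtype.val h)
    · exact absurd (h2 ▸ s.2) h1
    · rfl
  exact LinearMap.congr_fun this u
theorem Pj_tau (n) (u : C2) : Pj q P (tau (n * q) u) = Pj q P u := by
  have : Pj q P ∘ₗ tau (n * q) = Pj q P := by
    apply ext1
    intro x
    rw [LinearMap.comp_apply]
    erw [tau_sg]
    rw [Pj, sg, lin_single_one, lin_single_one]
    by_cases hr : red q x ∈ fd q P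
    · rw [dif_pos hr, dif_pos (by rwa [red_sh])]
      simp only [red_sh]
    · rw [dif_neg hr, dif_neg (by rwa [red_sh])]
  exact LinearMap.congr_fun this u
theorem io_Pj_sg (hq : 0 < q) (hP : Per q P) {x} (hx : x ∈ P) :
    ∃ n, io q P (Pj q P (sg x)) = tau (n * q) (sg x) := by
  rw [Pj_sg_mem hq hP hx, io_single]
  refine ⟨-(x.1 / (2 * q)), ?_⟩
  rw [tau_sg]
  congr 1
  have := red_eq (q := q) x
  change red q x = _
  rw [← sh_zero (red q x), ← neg_add_cancel (x.1 / (2 * q) * q), ← sh_add, this]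
  congr 1
  ring
theorem mk_Pj_sg (hq : 0 < q) (hP : Per q P) {A} (hA : Eqv q A) {x} (hx : x ∈ P) :
    mk q P A (Pj q P (sg x)) = Pj q P (A (sg x)) := by
  obtain ⟨n, hn⟩ := io_Pj_sg hq hP hx
  rw [mk, LinearMap.comp_apply, LinearMap.comp_apply, hn, hA, Pj_tau]
theorem mk_Pj (hq : 0 < q) (hP : Per q P) {A} (hA : Eqv q A) {u : C2}
    (hu : ∀ e, u e ≠ 0 → e ∈ P ∨ Pj q P (A (sg e)) = 0) :
    mk q P A (Pj q P u) = Pj q P (A u) := by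
  have h : (mk q P A ∘ₗ Pj q P - Pj q P ∘ₗ A) u = 0 := by
    refine spt_zero (P := {e | u e ≠ 0}) _ (fun x hx => ?_) (mem_spt.2 fun x hx => hx)
    rw [LinearMap.sub_apply, LinearMap.comp_apply, LinearMap.comp_apply]
    by_cases hxP : x ∈ P
    · rw [mk_Pj_sg hq hP hA hxP, sub_self]
    · rw [Pj_sg_nmem hq hP hxP, map_zero, (hu x hx).resolve_left hxP, sub_self]
  exact sub_eq_zero.1 h
theorem Pj_io (hq : 0 < q) (hP : Per q P) (w) : Pj q P (io q P w) = w := by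
  have : Pj q P ∘ₗ io q P = LinearMap.id := by
    apply ext1
    intro s
    rw [LinearMap.comp_apply, io_single, Pj_sg_mem hq hP s.2.1]
    simp only [red_fd s.2]; rfl
  exact LinearMap.congr_fun this w
theorem mk_single (A : C2 →ₗ[ℚ] C2) (s) : mk q P A (Finsupp.single s 1) = Pj q P (A (sg s.1)) := by
  rw [mk, LinearMap.comp_apply, LinearMap.comp_apply, io_single]
theorem mk_mul (hq : 0 < q) (hP : Per q P) {A B} (hA : Eqv q A)
    (hB : ∀ x ∈ P, ∀ e, B (sg x) e ≠ 0 → e ∈ P ∨ Pj q P (A (sg e)) = 0) :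
    mk q P A * mk q P B = mk q P (A ∘ₗ B) := by
  apply ext1
  intro s
  rw [Module.End.mul_apply, mk_single, mk_single, mk_Pj hq hP hA (hB s.1 s.2.1)]
  rfl
theorem mk_add (A B) : mk q P (A + B) = mk q P A + mk q P B := by
  simp only [mk, LinearMap.add_comp, LinearMap.comp_add]
theorem mk_sub (A B) : mk q P (A - B) = mk q P A - mk q P B := by
  simp only [mk, LinearMap.sub_comp, LinearMap.comp_sub]
theorem mk_neg (A) : mk q P (-A) = - mk q P A := by
  simp only [mk, LinearMap.neg_comp, LinearMap.comp_neg]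
theorem mk_zero : mk q P 0 = 0 := by
  simp only [mk, LinearMap.zero_comp, LinearMap.comp_zero]
theorem mk_one (hq : 0 < q) (hP : Per q P) : mk q P LinearMap.id = 1 := by
  ext1 w
  exact LinearMap.ext fun a => by
    rw [mk, LinearMap.comp_apply, LinearMap.comp_apply, LinearMap.comp_apply]
    simp [Pj_io hq hP]
theorem Pj_zero_of (hq : 0 < q) (hP : Per q P) {u : C2} (hu : ∀ e, u e ≠ 0 → e ∉ P) : Pj q P u = 0 :=
  spt_zero (P := Pᶜ) _ (fun _ hx => Pj_sg_nmem hq hP hx) (mem_spt.2 hu)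

theorem cf_ne {x : ℤ × ℤ} {u : C2} (h : cf q x u ≠ 0) : ∃ n, u (sh (n * q) x) ≠ 0 := by
  by_contra hc
  push Not at hc
  apply h
  refine spt_zero (P := {y | red q y ≠ red q x}) _ (fun y hy => ?_) (mem_spt.2 fun y hy hyx => ?_)
  · rw [cf_sg, if_neg hy]
  · obtain ⟨n, rfl⟩ := red_eq_iff.1 hyx.symm
    exact hy (hc n)
theorem cf_sh (n x) : cf q (sh (n * q) x) = cf q x := by
  unfold cf; rw [red_sh]
theorem cf_io {x : ℤ × ℤ} (hq : 0 < q) (hP : Per q P) (hx : x ∉ P) (w) : cf q x (io q P w) = 0 := by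
  by_contra h
  obtain ⟨n, hn⟩ := cf_ne h
  apply hx
  rw [← hP n]
  have : io q P w ∈ spt P := by
    clear hn h
    induction w using Finsupp.induction_linear with
    | zero => rw [map_zero]; exact Submodule.zero_mem _
    | add f g hf hg => rw [map_add]; exact Submodule.add_mem _ hf hg
    | single a b =>
      rw [io, lin_single]; exact Submodule.smul_mem _ _ (sg_mem a.2.1)
  exact mem_spt.1 this _ hn
theorem io_apply (w : W q P) (s : fd q P) : cf q s.1 (io q P w) = w s := by
  have : cf q s.1 ∘ₗ io q P = Finsupp.lapply s := by
    apply ext1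
    intro t
    rw [LinearMap.comp_apply, io_single, cf_sg, red_fd s.2, red_fd t.2]
    simp [Finsupp.single_apply, Subtype.ext_iff]
  exact LinearMap.congr_fun this w

theorem D_sq (a b : ℤ) : D (sg (2 * a + 1, 2 * b + 1)) =
    sg (2 * a + 2, 2 * b + 1) - sg (2 * a, 2 * b + 1) - (sg (2 * a + 1, 2 * b + 2) - sg (2 * a + 1, 2 * b)) := by
  unfold sg
  rw [D, LinearMap.add_apply, bx_single, bx_single, d1_odd, s1_odd, d1_odd, LinearMap.id_apply, bil_sub_left,
    bil_single, bil_single]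
  rw [show ∀ u v : C1, bil (-u) v = - bil u v from fun u v => by simp [bil, TensorProduct.neg_tmul], bil_sub_right, bil_single, bil_single]
  rw [show 2 * (a + 1) = 2 * a + 2 by ring, show 2 * (b + 1) = 2 * b + 2 by ring]
  abel
theorem cf_par {x y : ℤ × ℤ} (h : ¬ (x.1 % 2 = y.1 % 2 ∧ x.2 = y.2)) : cf q x (sg y) = 0 := by
  rw [cf_sg, if_neg]
  rw [red_dvd]
  rintro ⟨h1, h2⟩
  have : (2 : ℤ) ∣ y.1 - x.1 := dvd_trans (Dvd.intro _ rfl) h1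
  exact h ⟨by omega, h2.symm⟩
theorem cf_move (x y : ℤ × ℤ) (a b : ℤ) : cf q (x.1 + a, x.2 + b) (sg (y.1 + a, y.2 + b)) = cf q x (sg y) := by
  simp only [cf_sg, red_dvd, add_sub_add_right_eq_sub, add_left_inj]
theorem cf_D_v (x : ℤ × ℤ) (h1 : x.1 % 2 = 0) (h2 : x.2 % 2 = 1) (z : C2) :
    cf q x (D z) = cf q (x.1 - 1, x.2) z - cf q (x.1 + 1, x.2) z := by
  have : cf q x ∘ₗ D = cf q (x.1 - 1, x.2) - cf q (x.1 + 1, x.2) := by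
    apply ext1
    rintro ⟨i, j⟩
    rw [LinearMap.comp_apply, LinearMap.sub_apply]
    change cf q x (D (sg (i, j))) = cf q _ (sg (i, j)) - cf q _ (sg (i, j))
    obtain ⟨a, rfl | rfl⟩ : ∃ a, i = 2 * a ∨ i = 2 * a + 1 := ⟨i / 2, by omega⟩ <;>
    obtain ⟨b, rfl | rfl⟩ : ∃ b, j = 2 * b ∨ j = 2 * b + 1 := ⟨j / 2, by omega⟩
    · rw [show sg (2 * a, 2 * b) = vtx (a, b) from rfl, D_vtx, map_zero, vtx, vc,
        cf_par (by dsimp only; omega), cf_par (by dsimp only; omega), sub_zero]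
    · rw [D_v, map_sub, vtx, vtx, vc, vc, cf_par (by dsimp only; omega), cf_par (by dsimp only; omega),
        cf_par (by dsimp only; omega), cf_par (by dsimp only; omega)]
    · rw [D_h, map_sub, vtx, vtx, vc, vc, cf_par (by dsimp only; omega), cf_par (by dsimp only; omega),
        cf_par (by dsimp only; omega), cf_par (by dsimp only; omega)]
    · rw [D_sq, map_sub, map_sub, map_sub, cf_par (y := (2 * a + 1, 2 * b + 2)) (by dsimp only; omega),
        cf_par (y := (2 * a + 1, 2 * b)) (by dsimp only; omega)]
      rw [← cf_move x (2 * a + 2, 2 * b + 1) (-1) 0, ← cf_move x (2 * a, 2 * b + 1) 1 0]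
      dsimp only
      rw [show (2 * a + 2 + -1) = 2 * a + 1 by ring, add_zero, add_zero, sub_zero, sub_zero]
      rfl
  exact LinearMap.congr_fun this z
theorem cf_D_h (x : ℤ × ℤ) (h1 : x.1 % 2 = 1) (h2 : x.2 % 2 = 0) (z : C2) :
    cf q x (D z) = cf q (x.1, x.2 + 1) z - cf q (x.1, x.2 - 1) z := by
  have : cf q x ∘ₗ D = cf q (x.1, x.2 + 1) - cf q (x.1, x.2 - 1) := by
    apply ext1
    rintro ⟨i, j⟩
    rw [LinearMap.comp_apply, LinearMap.sub_apply]
    change cf q x (D (sg (i, j))) = cf q _ (sg (i, j)) - cf q _ (sg (i, j))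
    obtain ⟨a, rfl | rfl⟩ : ∃ a, i = 2 * a ∨ i = 2 * a + 1 := ⟨i / 2, by omega⟩ <;>
    obtain ⟨b, rfl | rfl⟩ : ∃ b, j = 2 * b ∨ j = 2 * b + 1 := ⟨j / 2, by omega⟩
    · rw [show sg (2 * a, 2 * b) = vtx (a, b) from rfl, D_vtx, map_zero, vtx, vc,
        cf_par (by dsimp only; omega), cf_par (by dsimp only; omega), sub_zero]
    · rw [D_v, map_sub, vtx, vtx, vc, vc, cf_par (by dsimp only; omega), cf_par (by dsimp only; omega),
        cf_par (by dsimp only; omega), cf_par (by dsimp only; omega)]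
    · rw [D_h, map_sub, vtx, vtx, vc, vc, cf_par (by dsimp only; omega), cf_par (by dsimp only; omega),
        cf_par (by dsimp only; omega), cf_par (by dsimp only; omega)]
    · rw [D_sq, map_sub, map_sub, map_sub, cf_par (y := (2 * a + 2, 2 * b + 1)) (by dsimp only; omega),
        cf_par (y := (2 * a, 2 * b + 1)) (by dsimp only; omega)]
      rw [← cf_move x (2 * a + 1, 2 * b + 2) 0 (-1), ← cf_move x (2 * a + 1, 2 * b) 0 1]
      dsimp only
      rw [show (2 * b + 2 + -1) = 2 * b + 1 by ring, add_zero, add_zero, sub_zero, zero_sub, neg_sub]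
      rfl
  exact LinearMap.congr_fun this z
end Mob

namespace Mob
open TensorProduct

def Walk (c : Module.End ℚ C2) : ℕ → ℤ × ℤ → ℤ × ℤ → Prop
  | 0, x, y => x = y
  | n + 1, x, y => ∃ z, Walk c n x z ∧ c (sg z) y ≠ 0

theorem walk_trans {c : Module.End ℚ C2} {a b : ℕ} {x y z} (h1 : Walk c a x y) (h2 : Walk c b y z) :
    Walk c (a + b) x z := by
  induction b generalizing z with
  | zero => cases h2; exact h1
  | succ n ih =>
    obtain ⟨w, hw, h⟩ := h2
    exact ⟨w, ih hw, h⟩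
theorem tau_apply (p : ℤ) (u : C2) (y) : tau p u (sh p y) = u y := by
  have : Finsupp.lapply (sh p y) ∘ₗ tau p = (Finsupp.lapply y : C2 →ₗ[ℚ] ℚ) := by
    apply ext1
    intro x
    rw [LinearMap.comp_apply]
    erw [tau_sg]
    simp only [sg, Finsupp.lapply_apply, Finsupp.single_apply]
    congr 1
    unfold sh
    rw [Prod.ext_iff, Prod.ext_iff]
    simp
  exact LinearMap.congr_fun this u
theorem lin_ne {A : C2 →ₗ[ℚ] C2} {u : C2} {y} (h : A u y ≠ 0) : ∃ z, u z ≠ 0 ∧ A (sg z) y ≠ 0 := by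
  by_contra hc
  push Not at hc
  apply h
  have := spt_zero (P := {z | u z ≠ 0}) ((Finsupp.lapply y : C2 →ₗ[ℚ] ℚ) ∘ₗ A) (fun x hx => hc x hx)
    (u := u) (mem_spt.2 fun x hx => hx)
  exact this
theorem pow_ne {c : Module.End ℚ C2} {n : ℕ} {x y} (h : (c ^ n) (sg x) y ≠ 0) : Walk c n x y := by
  induction n generalizing y with
  | zero => 
    rw [pow_zero] at h
    by_contra hc
    apply h
    change sg x y = 0
    rw [sg, Finsupp.single_apply]; exact if_neg hc
  | succ n ih =>
    rw [pow_succ', Module.End.mul_apply] at h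
    obtain ⟨z, hz, h⟩ := lin_ne h
    exact ⟨z, ih hz, h⟩

variable {q : ℤ} {c : Module.End ℚ C2}
theorem walk_sh (hc : Eqv q c) (p : ℤ) {n : ℕ} {x y} (h : Walk c n x y) :
    Walk c n (sh (p * q) x) (sh (p * q) y) := by
  induction n generalizing y with
  | zero => cases h; rfl
  | succ n ih =>
    obtain ⟨z, hz, h⟩ := h
    refine ⟨_, ih hz, ?_⟩
    rwa [← tau_sg, hc, tau_apply]

theorem eqv_mul {A B : Module.End ℚ C2} (hA : Eqv q A) (hB : Eqv q B) : Eqv q (A * B) := fun n z => by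
  rw [Module.End.mul_apply, hB, hA, Module.End.mul_apply]
theorem eqv_add {A B : Module.End ℚ C2} (hA : Eqv q A) (hB : Eqv q B) : Eqv q (A + B) := fun n z => by
  rw [LinearMap.add_apply, hB, hA, LinearMap.add_apply, map_add]
theorem eqv_D : Eqv q D := fun n z => D_tau _ z

noncomputable def sgn (x : ℤ × ℤ) : ℚ := if (x.1 + x.2) % 2 = 0 then 1 else -1
theorem eps_sg (x) : eps (sg x) = sgn x • sg x := by
  obtain ⟨i, j⟩ := x
  rw [sg, eps_single, sgn]
theorem eqv_eps : Eqv q eps := fun n z => by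
  have : eps ∘ₗ tau (n * q) = tau (n * q) ∘ₗ eps := by
    apply ext1
    intro x
    rw [LinearMap.comp_apply, LinearMap.comp_apply]
    change eps (tau _ (sg x)) = tau _ (eps (sg x))
    rw [tau_sg, eps_sg, eps_sg, map_smul, tau_sg]
    congr 1
    unfold sgn sh
    dsimp only
    congr 2
    omega
  exact LinearMap.congr_fun this z
theorem cf_eps (x u) : cf q x (eps u) = sgn x * cf q x u := by
  have : cf q x ∘ₗ eps = sgn x • cf q x := by
    apply ext1
    intro y
    rw [LinearMap.comp_apply, LinearMap.smul_apply]
    change cf q x (eps (sg y)) = _ • cf q x (sg y)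
    rw [eps_sg, map_smul, cf_sg]
    split_ifs with h
    · congr 1
      obtain ⟨n, rfl⟩ := red_eq_iff.1 h
      unfold sgn sh
      dsimp only
      congr 2
      omega
    · simp
  exact LinearMap.congr_fun this u

def Prs (B : Set (ℤ × ℤ)) (A : C2 →ₗ[ℚ] C2) : Prop := ∀ x ∈ B, A (sg x) ∈ spt B
theorem prs_mul {B} {A A' : Module.End ℚ C2} (hA : Prs B A) (hA' : Prs B A') : Prs B (A * A') := fun x hx =>
  spt_map A hA (hA' x hx)
theorem prs_add {B} {A A' : Module.End ℚ C2} (hA : Prs B A) (hA' : Prs B A') : Prs B (A + A') := fun x hx =>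
  Submodule.add_mem _ (hA x hx) (hA' x hx)
theorem prs_eps (B) : Prs B eps := fun x hx => by
  rw [eps_sg]; exact Submodule.smul_mem _ _ (sg_mem hx)
theorem mk_mul_prs (hq : 0 < q) {P} (hP : Per q P) {A B} (hA : Eqv q A) (hB : Prs P B) :
    mk q P A * mk q P B = mk q P (A ∘ₗ B) :=
  mk_mul hq hP hA fun x hx e he => Or.inl (mem_spt.1 (hB x hx) e he)

theorem trace_mk {P} [Fintype (fd q P)] (A : Module.End ℚ (W q P)) :
    LinearMap.trace ℚ (W q P) A = ∑ s : fd q P, A (Finsupp.single s 1) s := by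
  classical
  rw [LinearMap.trace_eq_matrix_trace ℚ (Finsupp.basisSingleOne)]
  simp [Matrix.trace, LinearMap.toMatrix_apply]

theorem exists_H {η : Module.End ℚ C2} {B} (hc : Eqv q c) (hη : Eqv q η) (hcB : Prs B c) (hηB : Prs B η)
    (hD : D * c = c * D) (h : c - 1 = D * η + η * D) (n : ℕ) :
    ∃ H : Module.End ℚ C2, Eqv q H ∧ Prs B H ∧ c ^ n - 1 = D * H + H * D := by
  induction n with
  | zero => exact ⟨0, fun _ _ => by simp, fun _ _ => by simp, by simp⟩
  | succ n ih =>
    obtain ⟨H, h1, h2, h3⟩ := ih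
    refine ⟨c * H + η, eqv_add (eqv_mul hc h1) hη, prs_add (prs_mul hcB h2) hηB, ?_⟩
    have : c ^ (n + 1) - 1 = c * (c ^ n - 1) + (c - 1) := by rw [pow_succ', mul_sub, mul_one]; abel
    rw [this, h3, h]
    have h4 : c * (D * H) = D * (c * H) := by rw [← mul_assoc, ← hD, mul_assoc]
    rw [mul_add, mul_add, add_mul, h4, mul_assoc]
    abel

theorem trace_zero (hq : 0 < q) {B : Set (ℤ × ℤ)} (hB : Per q B)
    [Fintype (fd q B)]
    {η : Module.End ℚ C2} (hc : Eqv q c) (hη : Eqv q η)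
    (hcB : Prs B c) (hηB : Prs B η) (hDB : Prs B D) (hD : D * c = c * D) (h : c - 1 = D * η + η * D)
    (hs : ∑ s : fd q B, sgn s.1 = 0) (n : ℕ) : ∑ s : fd q B, sgn s.1 * cf q s.1 ((c ^ n) (sg s.1)) = 0 := by
  obtain ⟨H, h1, h2, h3⟩ := exists_H hc hη hcB hηB hD h n
  have e1 : ∀ A : Module.End ℚ C2, LinearMap.trace ℚ (W q B) (mk q B A) = ∑ s : fd q B, cf q s.1 (A (sg s.1)) := by
    intro A
    rw [trace_mk]
    exact Finset.sum_congr rfl fun s _ => by rw [mk_single, Pj_apply]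
  have e2 := e1 (eps * (D * H + H * D))
  have e3 : LinearMap.trace ℚ (W q B) (mk q B (eps * (D * H + H * D))) = 0 := by
    have a1 : eps * (D * H + H * D) = (eps * D * H : Module.End ℚ C2) + (eps * H) * D := by noncomm_ring
    have a2 : mk q B ((eps * H) * D) = mk q B (eps * H) * mk q B D :=
      (mk_mul_prs hq hB (eqv_mul eqv_eps h1) hDB).symm
    have a3 : mk q B D * mk q B (eps * H) = mk q B (D * (eps * H)) :=
      (mk_mul_prs hq hB eqv_D (prs_mul (prs_eps B) h2))
    have a4 : D * (eps * H) = - (eps * D * H : Module.End ℚ C2) := by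
      apply LinearMap.ext
      intro z
      have := LinearMap.congr_fun eps_D (H z)
      change D (eps (H z)) = - (eps (D (H z)))
      change eps (D (H z)) = - D (eps (H z)) at this
      rw [this, neg_neg]
    rw [a1, mk_add, map_add, a2, LinearMap.trace_mul_comm, a3, a4, mk_neg, map_neg, add_neg_cancel]
  rw [e3, ← h3] at e2
  have e4 : ∀ s : fd q B, cf q s.1 ((eps * (c ^ n - 1)) (sg s.1)) = sgn s.1 * cf q s.1 ((c ^ n) (sg s.1)) - sgn s.1 := by
    intro s
    rw [Module.End.mul_apply, cf_eps, LinearMap.sub_apply, map_sub, Module.End.one_apply, cf_sg, if_pos rfl]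
    ring
  simp only [e4, Finset.sum_sub_distrib, hs, sub_zero] at e2
  exact e2.symm

/-- local version of path lemma -/
theorem path_lemma (hq : 0 < q) {V B : Set (ℤ × ℤ)} (hV : Per q V)
    (hc : Eqv q c) (hcB : Prs B c) {n : ℕ}
    (W5 : ∀ e ∈ B, ∀ p, Walk c n e (sh (p * q) e) → e ∈ V) {s : fd q V} (hsB : s.1 ∈ B)
    (j : ℕ) : ∀ a e, a + j = n → Walk c a s.1 e → 
      ((mk q V c) ^ j) (Pj q V (sg e)) s = cf q s.1 ((c ^ j) (sg e)) := by
  have walkB : ∀ a e, Walk c a s.1 e → e ∈ B := by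
    intro a
    induction a with
    | zero => intro e he; cases he; exact hsB
    | succ a ih =>
      rintro e ⟨z, hz, h⟩
      exact mem_spt.1 (hcB z (ih z hz)) e h
  induction j with
  | zero => intro a e _ _; rw [pow_zero, pow_zero, Module.End.one_apply, Module.End.one_apply, Pj_apply]
  | succ j ih =>
    intro a e hn he
    by_cases heV : e ∈ V
    · rw [pow_succ, pow_succ, Module.End.mul_apply, Module.End.mul_apply, mk_Pj_sg hq hV hc heV]
      have : ∀ u : C2, (∀ z, u z ≠ 0 → c (sg e) z ≠ 0) → (((mk q V c) ^ j) (Pj q V u)) s = cf q s.1 ((c ^ j) u) := by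
        intro u hu
        have := spt_zero (P := {z | c (sg e) z ≠ 0}) (u := u)
          ((Finsupp.lapply s : W q V →ₗ[ℚ] ℚ) ∘ₗ ((mk q V c) ^ j) ∘ₗ Pj q V - cf q s.1 ∘ₗ (c ^ j)) (fun z hz => by
            have := ih (a + 1) z (by omega) ⟨e, he, hz⟩
            rw [LinearMap.sub_apply]
            exact sub_eq_zero.2 this) (mem_spt.2 hu)
        exact sub_eq_zero.1 this
      exact this _ fun z hz => hz
    · rw [Pj_sg_nmem hq hV heV, map_zero]
      by_contra hne
      obtain ⟨p, hp⟩ := cf_ne (Ne.symm hne)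
      have w1 := walk_trans (pow_ne hp) (walk_sh hc p he)
      rw [show j + 1 + a = n by omega] at w1
      exact heV (W5 e (walkB _ _ he) p w1)

theorem trace_V (hq : 0 < q) {V B : Set (ℤ × ℤ)} (hV : Per q V) (hB : Per q B) (hVB : V ⊆ B)
    [Fintype (fd q B)] [Fintype (fd q V)]
    {η : Module.End ℚ C2} (hc : Eqv q c) (hη : Eqv q η)
    (hcB : Prs B c) (hηB : Prs B η) (hDB : Prs B D) (hD : D * c = c * D) (h : c - 1 = D * η + η * D)
    (hs : ∑ s : fd q B, sgn s.1 = 0) (n : ℕ) 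
    (W5 : ∀ e ∈ B, ∀ p, Walk c n e (sh (p * q) e) → e ∈ V) :
    LinearMap.trace ℚ (W q V) (mk q V eps * (mk q V c) ^ n) = 0 := by
  rw [trace_mk, ← trace_zero hq hB hc hη hcB hηB hDB hD h hs n]
  have e1 : ∀ s : fd q V, (mk q V eps * (mk q V c) ^ n) (Finsupp.single s 1) s =
      sgn s.1 * cf q s.1 ((c ^ n) (sg s.1)) := by
    intro s
    rw [Module.End.mul_apply, mk, LinearMap.comp_apply, LinearMap.comp_apply, Pj_apply, cf_eps, io_apply]
    rw [← path_lemma hq hV hc hcB W5 (hVB s.2.1) n 0 s.1 (by omega) rfl, Pj_sg_mem hq hV s.2.1]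
    simp only [red_fd s.2]
  simp only [e1]
  have e2 : ∀ (P : Set (ℤ × ℤ)) [Fintype (fd q P)] (f : ℤ × ℤ → ℚ), ∑ s : fd q P, f s.1 = ∑ x ∈ (fd q P).toFinset, f x := by
    intro P _ f
    rw [Finset.sum_subtype (fd q P).toFinset (p := fun x => x ∈ fd q P) (fun x => by simp)]
  rw [e2 V (fun x => sgn x * cf q x ((c ^ n) (sg x))), e2 B (fun x => sgn x * cf q x ((c ^ n) (sg x)))]
  apply Finset.sum_subset
  · intro x
    simp only [Set.mem_toFinset]
    exact fun hx => ⟨hVB hx.1, hx.2⟩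
  · intro x hx hx'
    simp only [Set.mem_toFinset] at hx hx'
    have : cf q x ((c ^ n) (sg x)) = 0 := by
      by_contra hne
      obtain ⟨p, hp⟩ := cf_ne hne
      exact hx' ⟨W5 x hx.1 p (pow_ne hp), hx.2⟩
    rw [this, mul_zero]
end Mob

namespace Mob
open TensorProduct

def InSq (k : ℤ) (S x : ℤ × ℤ) : Prop :=
  2 * (k * S.1) ≤ x.1 ∧ x.1 ≤ 2 * (k * S.1) + 2 * k ∧ 2 * (k * S.2) ≤ x.2 ∧ x.2 ≤ 2 * (k * S.2) + 2 * k
def Bd (k h : ℤ) : Set (ℤ × ℤ) := {x | -(2 * (k * h)) ≤ x.2 ∧ x.2 ≤ 2 * (k * h)}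
def Ns (k h : ℤ) (N : Set (ℤ × ℤ)) : Set (ℤ × ℤ) := {x | x ∈ Bd k h ∧ ∃ S ∈ N, InSq k S x}
def Lc (k : ℤ) (L : Set (ℤ × ℤ)) : Set (ℤ × ℤ) := {x | ∃ S ∈ L, InSq k S x}
def Vc (k h : ℤ) (N L : Set (ℤ × ℤ)) : Set (ℤ × ℤ) := Ns k h N \ Lc k L

theorem InSq_sh {k Q n : ℤ} {S x : ℤ × ℤ} : InSq k (S.1 + n * Q, S.2) (sh (n * (Q * k)) x) ↔ InSq k S x := by
  unfold InSq sh
  dsimp only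
  rw [show k * (S.1 + n * Q) = k * S.1 + n * (Q * k) by ring]
  omega
theorem per_sq {k Q : ℤ} {N : Set (ℤ × ℤ)} (hN : ∀ n (S : ℤ × ℤ), (S.1 + n * Q, S.2) ∈ N ↔ S ∈ N) (n x) :
    (∃ S ∈ N, InSq k S (sh (n * (Q * k)) x)) ↔ ∃ S ∈ N, InSq k S x := by
  constructor
  · rintro ⟨S, hS, h⟩
    refine ⟨(S.1 + (-n) * Q, S.2), (hN _ _).2 hS, ?_⟩
    rw [← InSq_sh (Q := Q) (n := n)]
    convert h using 1
    ext <;> dsimp only; ring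
  · rintro ⟨S, hS, h⟩
    exact ⟨_, (hN n S).2 hS, InSq_sh.2 h⟩
theorem InSq_D {k S x e} (h : InSq k S x) (he : D (sg x) e ≠ 0) : InSq k S e := by
  have := D_ne he
  unfold InSq at *
  generalize k * S.1 = a at *
  generalize k * S.2 = b at *
  omega
theorem Bd_D {k h x e} (hx : x ∈ Bd k h) (he : D (sg x) e ≠ 0) : e ∈ Bd k h := by
  have := D_ne he
  simp only [Bd, Set.mem_ofPred_eq] at *
  generalize k * h = a at *
  omega
theorem fin_fd {q k h : ℤ} {P : Set (ℤ × ℤ)} (hP : P ⊆ Bd k h) : (fd q P).Finite := by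
  apply ((Set.finite_Icc (0:ℤ) (2 * q)).prod (Set.finite_Icc (-(2 * (k * h))) (2 * (k * h)))).subset
  rintro x ⟨h1, h2, h3⟩
  exact ⟨⟨h2, h3.le⟩, hP h1⟩
theorem sum_sgn {q k h : ℤ} [Fintype (fd q (Bd k h))] : ∑ s : fd q (Bd k h), sgn s.1 = 0 := by
  refine Finset.sum_involution (fun s _ => ⟨(if s.1.1 % 2 = 0 then s.1.1 + 1 else s.1.1 - 1, s.1.2), ?_⟩) ?_ ?_ ?_ ?_
  · obtain ⟨⟨i, j⟩, h1, h2, h3⟩ := s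
    refine ⟨h1, ?_⟩
    dsimp only at *
    split_ifs <;> omega
  · rintro ⟨⟨i, j⟩, h1, h2, h3⟩ _
    simp only [sgn]
    split_ifs <;> first | omega | norm_num
  · rintro ⟨⟨i, j⟩, h1, h2, h3⟩ _ _ h
    have h := (Prod.mk.inj (congrArg Subtype.val h)).1
    dsimp only at *
    split_ifs at h <;> omega
  · exact fun _ _ => Finset.mem_univ _
  · rintro ⟨⟨i, j⟩, h1, h2, h3⟩ _
    apply Subtype.ext
    dsimp only
    refine Prod.ext ?_ rfl
    dsimp only
    split_ifs <;> omega

/-! coarse homotopy -/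
def lx (k a : ℤ) : ℤ := k * (a / k)
def cl (h1 b : ℤ) : ℤ := max (-h1) (min b h1)
def ly (k h1 b : ℤ) : ℤ := k * cl h1 (b / k)

theorem div_box {k a A : ℤ} (hk : 0 < k) (h1 : k * A ≤ a) (h2 : a ≤ k * A + k) : A ≤ a / k ∧ a / k ≤ A + 1 := by
  constructor
  · rw [Int.le_ediv_iff_mul_le hk]; linarith
  · have : a / k < A + 1 + 1 := by rw [Int.ediv_lt_iff_lt_mul hk]; nlinarith
    omega
theorem lx_box {k a A : ℤ} (hk : 0 < k) (h1 : k * A ≤ a) (h2 : a ≤ k * A + k) :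
    k * A ≤ lx k a ∧ lx k a ≤ k * A + k := by
  obtain ⟨h3, h4⟩ := div_box hk h1 h2
  unfold lx
  constructor <;> nlinarith
theorem ly_box {k a A h0 : ℤ} (hk : 0 < k) (ha : -h0 ≤ A) (hb : A < h0) (h1 : k * A ≤ a) (h2 : a ≤ k * A + k) :
    k * A ≤ ly k h0 a ∧ ly k h0 a ≤ k * A + k := by
  obtain ⟨h3, h4⟩ := div_box hk h1 h2
  have h5 : A ≤ cl h0 (a / k) ∧ cl h0 (a / k) ≤ A + 1 := by unfold cl; omega
  unfold ly
  constructor <;> nlinarith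
theorem ly_top {k a h1 : ℤ} (hk : 0 < k) (h0 : 0 < h1) (h : k * h1 ≤ a) : ly k h1 a = k * h1 := by
  have : h1 ≤ a / k := by rw [Int.le_ediv_iff_mul_le hk]; linarith
  unfold ly cl
  congr 1
  omega
theorem ly_bot {k a h1 : ℤ} (hk : 0 < k) (h0 : 0 < h1) (h : a ≤ -(k * h1)) : ly k h1 a = -(k * h1) := by
  have : a / k ≤ -h1 := by
    have : a / k < -h1 + 1 := by rw [Int.ediv_lt_iff_lt_mul hk]; nlinarith
    omega
  unfold ly cl
  rw [← mul_neg]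
  congr 1
  omega
theorem sq_exists {k : ℤ} (hk : 0 < k) (x : ℤ × ℤ) : InSq k (x.1 / (2 * k), x.2 / (2 * k)) x := by
  unfold InSq
  dsimp only
  have h1 := Int.emod_add_mul_ediv x.1 (2 * k)
  have h2 := Int.emod_add_mul_ediv x.2 (2 * k)
  have h3 := Int.emod_nonneg x.1 (show 2 * k ≠ 0 by omega)
  have h4 := Int.emod_nonneg x.2 (show 2 * k ≠ 0 by omega)
  have h5 := Int.emod_lt_of_pos x.1 (show 0 < 2 * k by omega)
  have h6 := Int.emod_lt_of_pos x.2 (show 0 < 2 * k by omega)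
  rw [mul_assoc] at h1 h2
  omega
/-- region near the ends -/
def Hi (k h1 : ℤ) : Set (ℤ × ℤ) := {x | 2 * (k * h1) ≤ x.2 ∨ x.2 ≤ -(2 * (k * h1))}
theorem hi_N {k h h1 : ℤ} {N : Set (ℤ × ℤ)} (hk : 0 < k) (hO : ∀ S : ℤ × ℤ, h1 ≤ S.2 ∨ S.2 < -h1 → S ∈ N)
    {x} (hx : x ∈ Bd k h) (hhi : x ∈ Hi k h1) : x ∈ Ns k h N := by
  refine ⟨hx, ?_⟩
  rcases hhi with h | h
  · refine ⟨_, hO _ (Or.inl ?_), sq_exists hk x⟩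
    dsimp only
    rw [Int.le_ediv_iff_mul_le (by omega)]; nlinarith
  · have hs := sq_exists hk (x.1, x.2 - 1)
    refine ⟨(x.1 / (2 * k), (x.2 - 1) / (2 * k)), hO _ (Or.inr ?_), ?_⟩
    · dsimp only
      rw [Int.ediv_lt_iff_lt_mul (by omega)]; nlinarith
    · unfold InSq at *
      dsimp only at *
      have h2 := Int.emod_add_mul_ediv (x.2 - 1) (2 * k)
      have h6 := Int.emod_lt_of_pos (x.2 - 1) (show 0 < 2 * k by omega)
      rw [mul_assoc] at h2
      omega
theorem K_sq {k h1 : ℤ} (hk : 0 < k) {S x e} (hS : InSq k S x) (h1' : -h1 ≤ S.2) (h2 : S.2 < h1)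
    (he : K (lx k) (ly k h1) (sg x) e ≠ 0) : InSq k S e := by
  have a := K_ne he
  unfold InSq at *
  have b1 := lx_box hk (a := x.1 / 2) (A := S.1) (by omega) (by omega)
  have b2 : x.1 % 2 = 1 → k * S.1 ≤ lx k (x.1 / 2 + 1) ∧ lx k (x.1 / 2 + 1) ≤ k * S.1 + k :=
    fun h => lx_box hk (a := x.1 / 2 + 1) (A := S.1) (by omega) (by omega)
  have b3 := ly_box hk h1' h2 (a := x.2 / 2) (by omega) (by omega)
  generalize k * S.1 = a1 at *
  generalize k * S.2 = a2 at *
  omega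
theorem K_hi {k h1 h : ℤ} (hk : 0 < k) (h0 : 0 < h1) (hh : h1 < h) {x e} (hx : x ∈ Hi k h1) (hx2 : x ∈ Bd k h)
    (he : K (lx k) (ly k h1) (sg x) e ≠ 0) : e ∈ Bd k h ∧ e ∈ Hi k h1 := by
  have a := K_ne he
  have a1 : k * h1 < k * h := by nlinarith
  have a2 : 0 < k * h1 := by positivity
  simp only [Hi, Bd, Set.mem_ofPred_eq] at *
  rcases hx with hx | hx
  · have := ly_top hk h0 (a := x.2 / 2) (by omega)
    omega
  · have b : x.2 % 2 = 0 → ly k h1 (x.2 / 2) = -(k * h1) := fun _ => ly_bot hk h0 (a := x.2 / 2) (by omega)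
    omega
theorem lx_add {k Q : ℤ} (hk : 0 < k) (n a) : lx k (a + n * (Q * k)) = lx k a + n * (Q * k) := by
  unfold lx
  rw [show a + n * (Q * k) = a + (n * Q) * k by ring, Int.add_mul_ediv_right _ _ hk.ne']
  ring
theorem eqv_K {k Q h1 : ℤ} (hk : 0 < k) : Eqv (Q * k) (K (lx k) (ly k h1)) := fun n z =>
  K_tau (fun a => lx_add hk n a) z

noncomputable def U (k n : ℤ) : C1 := if n % 2 = 0 then Finsupp.single (2 * (k * (n / 2))) 1 else path (k * (n / 2)) (k * (n / 2) + k)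
theorem e1_U {k lo hi : ℤ} (l : ℤ → ℤ) (h1 : ∀ a, l (a + 1) = l a ∨ l (a + 1) = l a + 1)
    (h2 : ∀ a, lo ≤ l a ∧ l a ≤ hi) (i : ℤ) : e1 (fun a => k * l a) (Finsupp.single i 1) = 0 ∨
    ∃ n, 2 * lo ≤ n ∧ n ≤ 2 * hi ∧ e1 (fun a => k * l a) (Finsupp.single i 1) = U k n := by
  obtain ⟨a, rfl | rfl⟩ : ∃ a, i = 2 * a ∨ i = 2 * a + 1 := ⟨i / 2, by omega⟩
  · right
    refine ⟨2 * l a, by linarith [h2 a], by linarith [h2 a], ?_⟩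
    rw [e1_even, U, if_pos (by omega), Int.mul_ediv_cancel_left _ (by norm_num)]
  · rw [e1_odd]
    rcases h1 a with h | h
    · left; rw [h, path_self]
    · right
      refine ⟨2 * l a + 1, by linarith [h2 a], by linarith [h2 (a + 1)], ?_⟩
      rw [U, if_neg (by omega), h, show (2 * l a + 1) / 2 = l a by omega, mul_add, mul_one]
theorem U_add (k n p : ℤ) : U k (n + 2 * p) = t1 (p * k) (U k n) := by
  unfold U
  rw [show (n + 2 * p) / 2 = n / 2 + p by omega, show (n + 2 * p) % 2 = n % 2 by omega]
  split_ifs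
  · rw [t1_single]; ring_nf
  · rw [t1_path]; ring_nf
theorem rank_E {Q k h1 : ℤ} (hQ : 0 < Q) (hk : 0 < k) (h0 : 0 < h1) (P : Set (ℤ × ℤ)) [FiniteDimensional ℚ (W (Q * k) P)] :
    Module.finrank ℚ (LinearMap.range (mk (Q * k) P (E (lx k) (ly k h1)))) ≤ (2 * Q * (4 * h1 + 1)).toNat := by
  classical
  let T : Finset (W (Q * k) P) := ((Finset.Ico 0 (2 * Q)) ×ˢ (Finset.Icc (-(2 * h1)) (2 * h1))).image
    fun p => Pj (Q * k) P (bil (U k p.1) (U k p.2))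
  have hT : T.card ≤ (2 * Q * (4 * h1 + 1)).toNat := by
    refine Finset.card_image_le.trans ?_
    rw [Finset.card_product, Int.card_Ico, Int.card_Icc, ← Int.toNat_mul (by omega) (by omega)]
    apply le_of_eq
    congr 1
    ring
  refine le_trans ?_ ((finrank_span_finset_le_card (R := ℚ) T).trans hT)
  apply Submodule.finrank_mono
  rintro _ ⟨w, rfl⟩
  induction w using Finsupp.induction_linear with
  | zero => rw [map_zero]; exact Submodule.zero_mem _
  | add f g hf hg => rw [map_add]; exact Submodule.add_mem _ hf hg
  | single s b =>
    rw [show Finsupp.single s b = b • Finsupp.single s (1 : ℚ) by simp, map_smul]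
    apply Submodule.smul_mem
    rw [mk_single]
    obtain ⟨⟨i, j⟩, hs⟩ := s
    rw [E, sg, bx_single]
    have a1 : ∀ a : ℤ, (a + 1) / k = a / k ∨ (a + 1) / k = a / k + 1 := by
      intro a
      have := div_box hk (a := a) (A := a / k) (by rw [mul_comm]; exact Int.ediv_mul_le a hk.ne')
        (by have := Int.lt_mul_ediv_self_add (x := a) hk; omega)
      have := div_box hk (a := a + 1) (A := a / k) (by have := Int.ediv_mul_le a hk.ne'; rw [mul_comm]; omega)
        (by have := Int.lt_mul_ediv_self_add (x := a) hk; omega)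
      omega
    have b2 := e1_U (k := k) (lo := -h1) (hi := h1) (fun b => cl h1 (b / k))
      (fun a => by have := a1 a; dsimp only [cl]; omega) (fun a => by dsimp only [cl]; omega) j
    have b1 : e1 (lx k) (Finsupp.single i 1) = 0 ∨ ∃ n, e1 (lx k) (Finsupp.single i 1) = U k n := by
      obtain ⟨a, rfl | rfl⟩ : ∃ a, i = 2 * a ∨ i = 2 * a + 1 := ⟨i / 2, by omega⟩
      · right
        refine ⟨2 * (a / k), ?_⟩
        rw [e1_even, U, if_pos (by omega), Int.mul_ediv_cancel_left _ (by norm_num)]; rfl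
      · rw [e1_odd]
        unfold lx
        rcases a1 a with h | h
        · left; rw [h, path_self]
        · right
          refine ⟨2 * (a / k) + 1, ?_⟩
          rw [U, if_neg (by omega), h, show (2 * (a / k) + 1) / 2 = a / k by omega, mul_add, mul_one]
    change Pj (Q * k) P (bil (e1 (lx k) _) (e1 (fun b => k * cl h1 (b / k)) _)) ∈ _
    rcases b1 with b1 | ⟨n, b1⟩
    · rw [b1, bil_zero_left, map_zero]; exact Submodule.zero_mem _
    rcases b2 with b2 | ⟨n', b3, b4, b2⟩
    · rw [b2, bil_zero_right, map_zero]; exact Submodule.zero_mem _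
    rw [b1, b2]
    apply Submodule.subset_span
    rw [Finset.mem_coe, Finset.mem_image]
    refine ⟨(n % (2 * Q), n'), ?_, ?_⟩
    · rw [Finset.mem_product, Finset.mem_Ico, Finset.mem_Icc]
      exact ⟨⟨Int.emod_nonneg _ (by omega), Int.emod_lt_of_pos _ (by omega)⟩, by omega, b4⟩
    · dsimp only
      have e := Int.emod_add_mul_ediv n (2 * Q)
      have : U k n = t1 ((n / (2 * Q)) * (Q * k)) (U k (n % (2 * Q))) := by
        conv_lhs => rw [← e, mul_assoc, U_add]
        ring_nf
      rw [this]
      have : bil (t1 ((n / (2 * Q)) * (Q * k)) (U k (n % (2 * Q)))) (U k n') =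
          tau ((n / (2 * Q)) * (Q * k)) (bil (U k (n % (2 * Q))) (U k n')) := by
        rw [tau_bx, bx_bil]; rfl
      rw [this, Pj_tau]
end Mob

namespace Mob
open TensorProduct

def WalkV (c : Module.End ℚ C2) (V : Set (ℤ × ℤ)) : ℕ → ℤ × ℤ → ℤ × ℤ → Prop
  | 0, x, y => x = y ∧ x ∈ V
  | n + 1, x, y => ∃ z, WalkV c V n x z ∧ c (sg z) y ≠ 0 ∧ y ∈ V
theorem walkV_sh {c : Module.End ℚ C2} {q : ℤ} {V} (hV : Per q V) (hc : Eqv q c) (p : ℤ) {n : ℕ} {x y} (h : WalkV c V n x y) :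
    WalkV c V n (sh (p * q) x) (sh (p * q) y) := by
  induction n generalizing y with
  | zero => obtain ⟨rfl, h⟩ := h; exact ⟨rfl, (hV _ _).2 h⟩
  | succ n ih =>
    obtain ⟨z, hz, h, hy⟩ := h
    refine ⟨_, ih hz, ?_, (hV _ _).2 hy⟩
    rwa [← tau_sg, hc, tau_apply]
theorem io_map {q : ℤ} {P} (w : W q P) : io q P w = Finsupp.mapDomain Subtype.val w := by
  have : io q P = Finsupp.lmapDomain ℚ ℚ Subtype.val := by
    apply ext1
    intro s
    rw [io_single, Finsupp.lmapDomain_apply, Finsupp.mapDomain_single]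
  rw [this]; rfl
theorem io_ne {q : ℤ} {P} {w : W q P} {z} (h : io q P w z ≠ 0) : ∃ s : fd q P, s.1 = z ∧ w s ≠ 0 := by
  by_contra hc
  push Not at hc
  apply h
  rw [io_map]
  by_cases hz : z ∈ fd q P
  · have := Finsupp.mapDomain_apply (f := (Subtype.val : fd q P → ℤ × ℤ)) Subtype.val_injective w ⟨z, hz⟩
    rw [this]; exact hc _ rfl
  · apply Finsupp.mapDomain_of_notMem_range
    simpa using hz
theorem mkpow_ne {c : Module.End ℚ C2} {q : ℤ} {V} (hV : Per q V) (hc : Eqv q c) {n : ℕ} {t s : fd q V}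
    (h : ((mk q V c) ^ n) (Finsupp.single t 1) s ≠ 0) : ∃ p, WalkV c V n t.1 (sh (p * q) s.1) := by
  induction n generalizing s with
  | zero =>
    rw [pow_zero, Module.End.one_apply, Finsupp.single_apply] at h
    have : t = s := by by_contra hts; exact h (if_neg hts)
    subst this
    refine ⟨0, ?_, t.2.1⟩
    rw [zero_mul, sh_zero]
  | succ n ih =>
    rw [pow_succ', Module.End.mul_apply, mk, LinearMap.comp_apply, LinearMap.comp_apply, Pj_apply] at h
    obtain ⟨p, hp⟩ := cf_ne h
    obtain ⟨z, hz, hp⟩ := lin_ne hp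
    obtain ⟨z', hz', hz2⟩ := io_ne hz
    subst hz'
    obtain ⟨p', hp'⟩ := ih (s := z') hz2
    refine ⟨p' + p, _, hp', ?_, (hV _ _).2 s.2.1⟩
    rw [← tau_sg, hc, add_mul, ← sh_add, tau_apply]
    exact hp
theorem end_ne {α : Type*} {A : Module.End ℚ (α →₀ ℚ)} {w : α →₀ ℚ} {t} (h : A w t ≠ 0) :
    ∃ s, w s ≠ 0 ∧ A (Finsupp.single s 1) t ≠ 0 := by
  by_contra hc
  push Not at hc
  apply h
  rw [← Finsupp.sum_single w, Finsupp.sum, map_sum, Finsupp.finsetSum_apply]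
  apply Finset.sum_eq_zero
  intro s hs
  rw [show Finsupp.single s (w s) = w s • Finsupp.single s (1:ℚ) by simp, map_smul, Finsupp.smul_apply,
    hc s (Finsupp.mem_support_iff.1 hs), smul_zero]

theorem phi_box (φ : ℤ × ℤ → ℤ × ℤ) (x : ℤ × ℤ) : ∃ M, ∀ v, Cor x v → -M ≤ v.1 ∧ v.1 ≤ M ∧ -M ≤ (φ v).1 ∧ (φ v).1 ≤ M := by
  let F := (Finset.Icc (x.1 - 1) (x.1 + 1) ∪ Finset.Icc (x.1 / 2 - 1) (x.1 / 2 + 1)) ×ˢ Finset.Icc (x.2 / 2 - 1) (x.2 / 2 + 1)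
  refine ⟨∑ v ∈ F, (|v.1| + |(φ v).1|), fun v hv => ?_⟩
  have h : v ∈ F := by
    simp only [F, Finset.mem_product, Finset.mem_union, Finset.mem_Icc]
    unfold Cor at hv
    omega
  have := Finset.single_le_sum (f := fun v : ℤ × ℤ => |v.1| + |(φ v).1|) (fun v _ => by positivity) h
  have h1 := neg_abs_le v.1
  have h2 := le_abs_self v.1
  have h3 := neg_abs_le (φ v).1
  have h4 := le_abs_self (φ v).1
  have h5 := abs_nonneg v.1
  have h6 := abs_nonneg (φ v).1
  refine ⟨?_, ?_, ?_, ?_⟩ <;> linarith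

theorem high_zero {V : Set (ℤ × ℤ)} {q k h h1 : ℤ} (hq : 0 < q) (hV : Per q V) (hVB : V ⊆ Bd k h)
    (hVH : ∀ x ∈ Bd k h, (2 * (k * h1) < x.2 ∨ x.2 < -(2 * (k * h1))) → x ∈ V)
    (h0 : 0 < k * h1)
    (w : W q V) (hw : mk q V D w = 0) {i j : ℤ} (hi : i % 2 = 1) (hj : j % 2 = 1)
    (hx : 2 * (k * h1) < j ∨ j < -(2 * (k * h1))) : cf q (i, j) (io q V w) = 0 := by
  have key : ∀ j, j % 2 = 0 → (2 * (k * h1) < j ∨ j < -(2 * (k * h1))) →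
      cf q (i, j + 1) (io q V w) = cf q (i, j - 1) (io q V w) := by
    intro j hj hx
    by_cases hb : (i, j) ∈ Bd k h
    · have h1 := hVH _ hb hx
      have h2 : cf q (i, j) (D (io q V w)) = 0 := by
        have := (red_mem hq hV).2 h1
        have h3 := DFunLike.congr_fun hw ⟨_, this⟩
        rw [mk, LinearMap.comp_apply, LinearMap.comp_apply, Pj_apply] at h3
        unfold cf at h3 ⊢
        rw [red_fd this] at h3
        exact h3
      rw [cf_D_h _ hi hj] at h2
      exact sub_eq_zero.1 h2
    · have hb' : ∀ x ∈ Bd k h, ¬ (x.2 = j + 1) ∧ ¬ (x.2 = j - 1) := by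
        intro x hx
        simp only [Bd, Set.mem_ofPred_eq] at hx hb
        omega
      rw [cf_io hq hV (fun h => (hb' _ (hVB h)).1 rfl), cf_io hq hV (fun h => (hb' _ (hVB h)).2 rfl)]
  rcases hx with hx | hx
  · have : ∀ n : ℕ, cf q (i, j + 2 * n) (io q V w) = cf q (i, j) (io q V w) := by
      intro n
      induction n with
      | zero => simp
      | succ n ih =>
        rw [← ih]
        have := key (j + 2 * n + 1) (by omega) (by omega)
        rw [show j + 2 * n + 1 + 1 = j + 2 * ((n + 1 : ℕ) : ℤ) by push_cast; ring, show j + 2 * n + 1 - 1 = j + 2 * (n : ℤ) by ring] at this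
        exact this
    rw [← this (2 * (k * h)).toNat]
    apply cf_io hq hV
    intro hc
    have := hVB hc
    simp only [Bd, Set.mem_ofPred_eq] at this
    omega
  · have : ∀ n : ℕ, cf q (i, j - 2 * n) (io q V w) = cf q (i, j) (io q V w) := by
      intro n
      induction n with
      | zero => simp
      | succ n ih =>
        rw [← ih]
        have := key (j - 2 * n - 1) (by omega) (by omega)
        rw [show j - 2 * n - 1 - 1 = j - 2 * ((n + 1 : ℕ) : ℤ) by push_cast; ring, show j - 2 * n - 1 + 1 = j - 2 * (n : ℤ) by ring] at this
        exact this.symm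
    rw [← this (2 * (k * h)).toNat]
    apply cf_io hq hV
    intro hc
    have := hVB hc
    simp only [Bd, Set.mem_ofPred_eq] at this
    omega
end Mob

namespace Mob
open TensorProduct

def CornV (S v : ℤ × ℤ) : Prop := S.1 ≤ v.1 ∧ v.1 ≤ S.1 + 1 ∧ S.2 ≤ v.2 ∧ v.2 ≤ S.2 + 1

theorem corn_box {k h : ℤ} (hk : 0 < k) {S : ℤ × ℤ} (hS : -h ≤ S.2 ∧ S.2 < h) {N} (hN : S ∈ N) {x}
    (hx : x ∈ Bx (k * S.1, k * S.2) (k * S.1 + k, k * S.2 + k)) : x ∈ Ns k h N := by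
  simp only [Bx, Set.mem_ofPred_eq] at hx
  refine ⟨?_, S, hN, ?_⟩
  · have h1 : -(k * h) ≤ k * S.2 := by nlinarith
    have h2 : k * S.2 + k ≤ k * h := by nlinarith
    simp only [Bd, Set.mem_ofPred_eq]
    omega
  · unfold InSq; omega

theorem cf_core {q t i : ℤ} (hq : 0 < q) (hi : i % 2 = 1) :
    cf q (i, t) (bil (path 0 q) (Finsupp.single t 1)) = 1 := by
  have e : bil (path 0 q) (Finsupp.single t 1) = ∑ a ∈ Finset.Ico 0 q, sg (2 * a + 1, t) := by
    rw [path, Finset.Ico_eq_empty_of_le hq.le, Finset.sum_empty, sub_zero, bil, TensorProduct.sum_tmul, map_sum]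
    exact Finset.sum_congr rfl fun a _ => bil_single _ _
  have e0 := Int.emod_nonneg i (show 2 * q ≠ 0 by omega)
  have e1 := Int.emod_lt_of_pos i (show 0 < 2 * q by omega)
  have e2 : (i % (2 * q)) % 2 = 1 := by
    rw [Int.emod_emod_of_dvd _ (Dvd.intro _ rfl), hi]
  rw [e, map_sum, Finset.sum_eq_single ((i % (2 * q)) / 2)]
  · rw [cf_sg, if_pos]
    unfold red
    dsimp only
    rw [show 2 * (i % (2 * q) / 2) + 1 = i % (2 * q) by omega, Int.emod_emod]
  · intro b hb hne
    rw [cf_sg, if_neg]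
    unfold red
    intro hc
    have := congrArg Prod.fst hc
    dsimp only at this
    rw [Finset.mem_Ico] at hb
    rw [Int.emod_eq_of_lt (by omega) (by omega)] at this
    omega
  · intro hb
    exact absurd (Finset.mem_Ico.2 ⟨by omega, by omega⟩) hb

theorem partC (Q k h h1 : ℤ) (m : ℕ) (N L : Set (ℤ × ℤ)) (φ : ℤ × ℤ → ℤ × ℤ)
    (hQ : 0 < Q) (hk : 0 < k) (hh1 : 0 < h1) (hh : h1 < h)
    (hN : ∀ n (S : ℤ × ℤ), (S.1 + n * Q, S.2) ∈ N ↔ S ∈ N)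
    (hL : ∀ n (S : ℤ × ℤ), (S.1 + n * Q, S.2) ∈ L ↔ S ∈ L)
    (hLb : ∀ S ∈ L, -h1 ≤ S.2 ∧ S.2 < h1) (hO : ∀ S : ℤ × ℤ, h1 ≤ S.2 ∨ S.2 < -h1 → S ∈ N)
    (hφ : ∀ n v, φ (shv (n * (Q * k)) v) = shv (n * (Q * k)) (φ v))
    (hφB : ∀ v, -(k * h) ≤ (φ v).2 ∧ (φ v).2 ≤ k * h)
    (W1 : ∀ x ∈ Vc k h N L, cM φ (sg x) ∈ spt (Ns k h N))
    (W2 : ∀ x ∈ Lc k L, ∀ e ∈ Vc k h N L, cM φ (sg x) e = 0)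
    (W4 : ∀ x e y, WalkV (cM φ) (Vc k h N L) m x e → WalkV (cM φ) (Vc k h N L) m e y →
      2 * (k * h1) < e.2 ∨ e.2 < -(2 * (k * h1)))
    (W5 : ∀ n, 1 ≤ n → n ≤ (2 * Q * (4 * h1 + 1)).toNat → ∀ e ∈ Bd k h, ∀ p,
      Walk (cM φ) n e (sh (p * (Q * k)) e) → e ∈ Vc k h N L)
    (W8 : ∀ x : ℤ × ℤ, x.2 = 2 * (k * h) → hM φ (sg x) ∈ spt (Ns k h N))
    (H6 : ∀ Nl : ℤ × ℤ → Prop, (∀ n (v : ℤ × ℤ), Nl (v.1 + n * Q, v.2) ↔ Nl v) →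
      (∀ S ∈ N, -h ≤ S.2 ∧ S.2 < h → ∀ v v', CornV S v → CornV S v' → Nl v → Nl v') →
      (∀ S ∈ L, ∀ v, CornV S v → Nl v) → ∀ v : ℤ × ℤ, (h1 ≤ v.2 ∧ v.2 ≤ h) ∨ (-h ≤ v.2 ∧ v.2 ≤ -h1) → Nl v)
    (H7 : ∀ Z : ℤ × ℤ → ℚ, (∀ n x, Z (sh (n * (Q * k)) x) = Z x) → (∀ x, x ∉ Vc k h N L → Z x = 0) →
      (∀ i j, i % 2 = 0 → j % 2 = 1 → (i, j) ∈ Vc k h N L → Z (i - 1, j) = Z (i + 1, j)) →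
      (∀ i j, i % 2 = 1 → j % 2 = 0 → (i, j) ∈ Vc k h N L →
        Z (i, j + 1) - Z (i, j - 1) = if j = 2 * (k * h) then 1 else 0) → False) : False := by
  set V := Vc k h N L with hVdef
  set q := Q * k with hqdef
  have hq : 0 < q := by positivity
  have hkh : 0 < k * h1 := by positivity
  have hkhh : k * h1 < k * h := by nlinarith
  have hBP : Per q (Bd k h) := fun n x => Iff.rfl
  have hNP : Per q (Ns k h N) := fun n x => by
    unfold Ns
    rw [Set.mem_ofPred_eq, Set.mem_ofPred_eq, per_sq hN, hBP]
  have hLP : Per q (Lc k L) := fun n x => by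
    unfold Lc
    rw [Set.mem_ofPred_eq, Set.mem_ofPred_eq, per_sq hL]
  have hV : Per q V := fun n x => by rw [hVdef, Vc, Set.mem_diff, Set.mem_diff, hNP, hLP]
  have hVB : V ⊆ Bd k h := fun x hx => hx.1.1
  have hNV : ∀ x ∈ Ns k h N, x ∈ V ∨ x ∈ Lc k L := fun x hx => by
    by_cases h : x ∈ Lc k L
    · exact Or.inr h
    · exact Or.inl ⟨hx, h⟩
  have hLhi : ∀ x ∈ Lc k L, ¬ (2 * (k * h1) < x.2 ∨ x.2 < -(2 * (k * h1))) := by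
    rintro x ⟨S, hS, hx⟩
    have hb := hLb S hS
    unfold InSq at hx
    have a1 : -(k * h1) ≤ k * S.2 := by nlinarith
    have a2 : k * S.2 + k ≤ k * h1 := by nlinarith
    omega
  have hVH : ∀ x ∈ Bd k h, (2 * (k * h1) < x.2 ∨ x.2 < -(2 * (k * h1))) → x ∈ V := by
    intro x hx hx'
    refine ⟨hi_N hk hO hx ?_, fun hc => hLhi x hc hx'⟩
    unfold Hi; rw [Set.mem_ofPred_eq]; omega
  haveI : Finite (fd q (Bd k h)) := fin_fd (k := k) (h := h) subset_rfl
  haveI : Finite (fd q V) := fin_fd hVB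
  letI : Fintype (fd q (Bd k h)) := Fintype.ofFinite _
  letI : Fintype (fd q V) := Fintype.ofFinite _
  have cE : Eqv q (cM φ) := fun n z => cM_tau φ (hφ n) z
  have hE : Eqv q (hM φ) := fun n z => hM_tau φ (hφ n) z
  have dN : ∀ x ∈ Ns k h N, ∀ e, D (sg x) e ≠ 0 → e ∈ Ns k h N := by
    rintro x ⟨hx, S, hS, hxS⟩ e he
    exact ⟨Bd_D hx he, S, hS, InSq_D hxS he⟩
  have dL : ∀ x ∈ Lc k L, ∀ e, D (sg x) e ≠ 0 → e ∈ Lc k L := by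
    rintro x ⟨S, hS, hxS⟩ e he
    exact ⟨S, hS, InSq_D hxS he⟩
  have LV : ∀ x ∈ Lc k L, x ∉ V := fun x hx hc => hc.2 hx
  have dL0 : ∀ x ∈ Lc k L, Pj q V (D (sg x)) = 0 := fun x hx =>
    Pj_zero_of hq hV fun e he => LV e (dL x hx e he)
  have cL0 : ∀ x ∈ Lc k L, Pj q V (cM φ (sg x)) = 0 := fun x hx =>
    Pj_zero_of hq hV fun e he hc => he (W2 x hx e hc)
  have Dmk : ∀ B : C2 →ₗ[ℚ] C2, (∀ x ∈ V, B (sg x) ∈ spt (Ns k h N)) → mk q V D * mk q V B = mk q V (D ∘ₗ B) :=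
    fun B hB => mk_mul hq hV eqv_D fun x hx e he =>
      (hNV e (mem_spt.1 (hB x hx) e he)).imp_right (dL0 e)
  have DN : ∀ x ∈ V, D (sg x) ∈ spt (Ns k h N) := fun x hx => mem_spt.2 (dN x hx.1)
  have hdd : mk q V D * mk q V D = 0 := by
    rw [Dmk D DN, D_D, mk_zero]
  have hdc : mk q V D * mk q V (cM φ) = mk q V (cM φ) * mk q V D := by
    rw [Dmk _ W1, mk_mul hq hV cE fun x hx e he =>
      (hNV e (mem_spt.1 (DN x hx) e he)).imp_right (cL0 e)]
    congr 1
    exact LinearMap.ext fun z => D_cM φ z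
  have hee : mk q V eps * mk q V eps = 1 := by
    rw [mk_mul_prs hq hV eqv_eps (prs_eps V), eps_eps, mk_one hq hV]
  have epN : ∀ x, x ∉ V → Pj q V (eps (sg x)) = 0 := fun x hx => by
    rw [eps_sg, map_smul, Pj_sg_nmem hq hV hx, smul_zero]
  have hed : mk q V eps * mk q V D = - (mk q V D * mk q V eps) := by
    rw [mk_mul_prs hq hV eqv_D (prs_eps V), mk_mul hq hV eqv_eps fun x hx e he => ?_, eps_D, mk_neg]
    by_cases h : e ∈ V
    · exact Or.inl h
    · exact Or.inr (epN e h)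
  have hec : mk q V eps * mk q V (cM φ) = mk q V (cM φ) * mk q V eps := by
    rw [mk_mul_prs hq hV cE (prs_eps V), mk_mul hq hV eqv_eps fun x hx e he => ?_]
    · congr 1
      exact LinearMap.ext fun z => (cM_eps φ z).symm
    · by_cases h : e ∈ V
      · exact Or.inl h
      · exact Or.inr (epN e h)
  have KN : ∀ x ∈ Ns k h N, ∀ e, K (lx k) (ly k h1) (sg x) e ≠ 0 → e ∈ Ns k h N := by
    rintro x ⟨hx, S, hS, hxS⟩ e he
    by_cases hs : x ∈ Hi k h1
    · exact hi_N hk hO (K_hi hk hh1 hh hs hx he).1 (K_hi hk hh1 hh hs hx he).2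
    · have h2 : -h1 ≤ S.2 ∧ S.2 < h1 := by
        by_contra hc
        apply hs
        unfold InSq at hxS
        simp only [Hi, Set.mem_ofPred_eq]
        rcases lt_or_ge S.2 (-h1) with h3 | h3
        · right
          have : k * S.2 + k ≤ -(k * h1) := by nlinarith
          omega
        · left
          have : k * h1 ≤ k * S.2 := by nlinarith [show h1 ≤ S.2 by omega]
          omega
      have h3 := K_sq hk hxS h2.1 h2.2 he
      refine ⟨?_, S, hS, h3⟩
      unfold InSq at h3
      have a1 : -(k * h) ≤ k * S.2 := by nlinarith
      have a2 : k * S.2 + k ≤ k * h := by nlinarith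
      simp only [Bd, Set.mem_ofPred_eq]
      omega
  have KL : ∀ x ∈ Lc k L, ∀ e, K (lx k) (ly k h1) (sg x) e ≠ 0 → e ∈ Lc k L := by
    rintro x ⟨S, hS, hxS⟩ e he
    exact ⟨S, hS, K_sq hk hxS (hLb S hS).1 (hLb S hS).2 he⟩
  have hk0 : mk q V D * mk q V (K (lx k) (ly k h1)) + mk q V (K (lx k) (ly k h1)) * mk q V D =
      1 - mk q V (E (lx k) (ly k h1)) := by
    rw [Dmk _ fun x hx => mem_spt.2 (KN x hx.1), mk_mul hq hV (eqv_K hk) fun x hx e he =>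
      (hNV e (mem_spt.1 (DN x hx) e he)).imp_right fun hL => Pj_zero_of hq hV fun e' he' => LV e' (KL e hL e' he'),
      ← mk_add, D_K, mk_sub, mk_one hq hV]
  have cB : Prs (Bd k h) (cM φ) := by
    intro x hx
    obtain ⟨M, hM⟩ := phi_box φ x
    have := cM_Bx φ (x := x) (p := (-M, -(k * h))) (q := (M, k * h)) fun v hv =>
      ⟨(hM v hv).2.2.1, (hM v hv).2.2.2, hφB v⟩
    exact mem_spt.2 fun y hy => by
      have := mem_spt.1 this y hy
      simp only [Bx, Bd, Set.mem_ofPred_eq] at *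
      omega
  have hB' : Prs (Bd k h) (hM φ) := by
    intro x hx
    obtain ⟨M, hM⟩ := phi_box φ x
    have := hM_Bx φ (x := x) (p := (-M, -(k * h))) (q := (M, k * h)) fun v hv =>
      ⟨⟨(hM v hv).1, (hM v hv).2.1, by
        unfold Cor at hv
        simp only [Bd, Set.mem_ofPred_eq] at hx
        dsimp only
        omega⟩, (hM v hv).2.2.1, (hM v hv).2.2.2, hφB v⟩
    exact mem_spt.2 fun y hy => by
      have := mem_spt.1 this y hy
      simp only [Bx, Bd, Set.mem_ofPred_eq] at *
      omega
  have htr : ∀ n, 1 ≤ n → n ≤ (2 * Q * (4 * h1 + 1)).toNat →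
      LinearMap.trace ℚ (W q V) (mk q V eps * (mk q V (cM φ)) ^ n) = 0 := by
    intro n hn1 hn2
    refine trace_V (c := cM φ) (η := hM φ) hq hV hBP hVB cE hE cB hB' (fun x hx => mem_spt.2 fun e he => Bd_D hx he)
      (LinearMap.ext fun z => D_cM φ z) (LinearMap.ext fun z => cM_hM φ z) sum_sgn n (W5 n hn1 hn2)
  -- images of D
  have imD : ∀ u : C2, u ∈ spt (Ns k h N) → mk q V D (Pj q V u) = Pj q V (D u) := fun u hu =>
    mk_Pj hq hV eqv_D fun e he => (hNV e (mem_spt.1 hu e he)).imp_right (dL0 e)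
  -- null vertices
  let Nul : ℤ × ℤ → Prop := fun v => Pj q V (vtx v) ∈ LinearMap.range (mk q V D)
  have nulBox : ∀ S ∈ N, -h ≤ S.2 ∧ S.2 < h → ∀ v v', v ∈ Vx (k * S.1, k * S.2) (k * S.1 + k, k * S.2 + k) →
      v' ∈ Vx (k * S.1, k * S.2) (k * S.1 + k, k * S.2 + k) → Nul v → Nul v' := by
    intro S hS hSb v v' hv hv' hn
    have h2 := D_Kb v (vtx v')
    rw [D_vtx, map_zero, sub_zero, aug_vtx, one_smul] at h2
    have h3 : vtx v' = vtx v + D (Kb v (vtx v')) := by rw [h2]; abel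
    change Pj q V (vtx v') ∈ _
    rw [h3, map_add]
    refine Submodule.add_mem _ hn ⟨Pj q V (Kb v (vtx v')), imD _ ?_⟩
    exact mem_spt.2 fun x hx => corn_box hk hSb hS (mem_spt.1 (Kb_Bx hv (vtx_mem_Bx hv')) x hx)
  have cornBox : ∀ S v, CornV S v → (k * v.1, k * v.2) ∈ Vx (k * S.1, k * S.2) (k * S.1 + k, k * S.2 + k) := by
    intro S v hv
    unfold CornV at hv
    refine ⟨?_, ?_, ?_, ?_⟩ <;> dsimp only <;> nlinarith
  have h6 := H6 (fun v => Nul (k * v.1, k * v.2)) (by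
      intro n v
      have : vtx (k * (v.1 + n * Q), k * v.2) = tau (n * q) (vtx (k * v.1, k * v.2)) := by
        rw [tau_vtx, shv]; congr 2; rw [hqdef]; ring
      change Pj q V (vtx (k * (v.1 + n * Q), k * v.2)) ∈ _ ↔ Pj q V (vtx (k * v.1, k * v.2)) ∈ _
      rw [this, Pj_tau])
    (fun S hS hSb v v' hv hv' => nulBox S hS hSb _ _ (cornBox S v hv) (cornBox S v' hv'))
    (by
      intro S hS v hv
      have : Pj q V (vtx (k * v.1, k * v.2)) = 0 := by
        apply Pj_sg_nmem hq hV
        apply LV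
        refine ⟨S, hS, ?_⟩
        have := cornBox S v hv
        simp only [Vx, Set.mem_ofPred_eq] at this
        unfold InSq vc
        dsimp only
        omega
      change Pj q V (vtx (k * v.1, k * v.2)) ∈ _
      rw [this]
      exact Submodule.zero_mem _)
  have nulHi : ∀ v : ℤ × ℤ, (k * h1 ≤ v.2 ∨ v.2 ≤ -(k * h1)) → -(k * h) ≤ v.2 → v.2 ≤ k * h → Nul v := by
    intro v hv hv1 hv2
    have e1 := Int.emod_add_mul_ediv v.1 k
    have e2 := Int.emod_nonneg v.1 hk.ne'
    have e3 := Int.emod_lt_of_pos v.1 hk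
    have main : ∀ b, -h ≤ b → b < h → (h1 ≤ b ∨ b < -h1) → k * b ≤ v.2 → v.2 ≤ k * b + k → Nul v := by
      intro b hb1 hb2 hb3 hb4 hb5
      have : Nul (k * (v.1 / k), k * b) := h6 (v.1 / k, b) (by dsimp only; omega)
      refine nulBox (v.1 / k, b) (hO _ hb3) ⟨hb1, hb2⟩ _ _ ?_ ?_ this
      · refine ⟨?_, ?_, ?_, ?_⟩ <;> dsimp only <;> omega
      · refine ⟨?_, ?_, ?_, ?_⟩ <;> dsimp only <;> omega
    have f1 := Int.emod_add_mul_ediv v.2 k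
    have f2 := Int.emod_nonneg v.2 hk.ne'
    have f3 := Int.emod_lt_of_pos v.2 hk
    have g1 := Int.emod_add_mul_ediv (v.2 - 1) k
    have g2 := Int.emod_nonneg (v.2 - 1) hk.ne'
    have g3 := Int.emod_lt_of_pos (v.2 - 1) hk
    rcases hv with hv | hv
    · by_cases ht : v.2 = k * h
      · exact main (h - 1) (by omega) (by omega) (by omega) (by rw [mul_sub]; omega) (by rw [mul_sub]; omega)
      · have a1 : h1 ≤ v.2 / k := by rw [Int.le_ediv_iff_mul_le hk]; linarith
        have a2 : v.2 / k < h := by rw [Int.ediv_lt_iff_lt_mul hk]; rw [mul_comm]; omega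
        exact main (v.2 / k) (by omega) a2 (by omega) (by omega) (by omega)
    · by_cases ht : v.2 = -(k * h)
      · exact main (-h) (by omega) (by omega) (by omega) (by rw [mul_neg]; omega) (by rw [mul_neg]; omega)
      · have a1 : -h ≤ (v.2 - 1) / k := by rw [Int.le_ediv_iff_mul_le hk, neg_mul, mul_comm]; omega
        have a2 : (v.2 - 1) / k < -h1 := by rw [Int.ediv_lt_iff_lt_mul hk, neg_mul, mul_comm]; omega
        exact main ((v.2 - 1) / k) (by omega) (by omega) (by omega) (by omega) (by omega)
  have hcd : ∀ n, mk q V D * mk q V (cM φ) ^ n = mk q V (cM φ) ^ n * mk q V D := fun n =>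
    (show Commute (mk q V D) (mk q V (cM φ)) from hdc).pow_right n
  have hecn : ∀ n, mk q V eps * mk q V (cM φ) ^ n = mk q V (cM φ) ^ n * mk q V eps := fun n =>
    (show Commute (mk q V eps) (mk q V (cM φ)) from hec).pow_right n
  have hm : ∀ x, mk q V D x = 0 → mk q V eps x = x → (mk q V (cM φ) ^ (m + m)) x ∈ LinearMap.range (mk q V D) := by
    intro x hx1 hx2
    rw [pow_add, Module.End.mul_apply]
    set y := (mk q V (cM φ) ^ m) x with hy
    have hy1 : mk q V D y = 0 := by
      have := LinearMap.congr_fun (hcd m) x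
      rw [Module.End.mul_apply, Module.End.mul_apply, hx1, map_zero] at this
      exact this
    have hy2 : mk q V eps y = y := by
      have := LinearMap.congr_fun (hecn m) x
      rw [Module.End.mul_apply, Module.End.mul_apply, hx2] at this
      exact this
    classical
    let p : fd q V → Prop := fun s => 2 * (k * h1) < s.1.2 ∨ s.1.2 < -(2 * (k * h1))
    have hsplit := Finsupp.filter_pos_add_filter_neg y p
    have hlow : (mk q V (cM φ) ^ m) (Finsupp.filter (fun s => ¬ p s) y) = 0 := by
      ext t
      by_contra hne
      obtain ⟨s, hs, hst⟩ := end_ne hne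
      have hps : ¬ p s := by
        by_contra hc
        exact hs (Finsupp.filter_apply_neg (fun s => ¬ p s) y (not_not.2 hc))
      have hys : y s ≠ 0 := by rwa [Finsupp.filter_apply_pos (fun s => ¬ p s) y hps] at hs
      obtain ⟨r, _, hrs⟩ := end_ne hys
      obtain ⟨a, ha⟩ := mkpow_ne hV cE hrs
      obtain ⟨b, hb⟩ := mkpow_ne hV cE hst
      have h4 := W4 _ _ _ ha (walkV_sh hV cE a hb)
      exact hps h4
    rw [← hsplit, map_add, hlow, add_zero]
    have hhigh : Finsupp.filter p y ∈ LinearMap.range (mk q V D) := by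
      rw [← Finsupp.sum_single (Finsupp.filter p y), Finsupp.sum]
      refine Submodule.sum_mem _ fun s hs => ?_
      have hs := Finsupp.mem_support_iff.1 hs
      have hps : p s := by by_contra hc; exact hs (Finsupp.filter_apply_neg p y hc)
      have hys : y s ≠ 0 := by rwa [Finsupp.filter_apply_pos p y hps] at hs
      have hsg : sgn s.1 = 1 := by
        have := DFunLike.congr_fun hy2 s
        rw [mk, LinearMap.comp_apply, LinearMap.comp_apply, Pj_apply, cf_eps, io_apply] at this
        exact (mul_eq_right₀ hys).1 this
      have hpar : (s.1.1 + s.1.2) % 2 = 0 := by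
        by_contra hc
        rw [sgn, if_neg hc] at hsg
        norm_num at hsg
      have hodd : ¬ (s.1.1 % 2 = 1 ∧ s.1.2 % 2 = 1) := by
        rintro ⟨h3, h4⟩
        apply hys
        rw [← io_apply]
        exact high_zero hq hV hVB hVH hkh y hy1 h3 h4 hps
      have hd : dg s.1 = 0 := by unfold dg; omega
      have hn : Nul (cor s.1) := by
        have hb := hVB s.2.1
        simp only [Bd, Set.mem_ofPred_eq] at hb
        simp only [p] at hps
        apply nulHi <;> simp only [cor] <;> omega
      have : Pj q V (vtx (cor s.1)) = Finsupp.single s 1 := by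
        rw [vtx, vc_cor hd, Pj_sg_mem hq hV s.2.1]
        simp only [red_fd s.2]
      rw [show Finsupp.single s ((Finsupp.filter p y) s) = (Finsupp.filter p y) s • Finsupp.single s (1:ℚ) by simp, ← this]
      exact Submodule.smul_mem _ _ hn
    obtain ⟨u, hu⟩ := hhigh
    rw [← hu]
    refine ⟨(mk q V (cM φ) ^ m) u, ?_⟩
    exact LinearMap.congr_fun (hcd m) u
  -- the core cycle
  let g : C2 := bil (path 0 q) (Finsupp.single (2 * (k * h)) 1)
  have hgs : ∀ x, g x ≠ 0 → x.2 = 2 * (k * h) := by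
    intro x hx
    rw [bil_apply] at hx
    exact single_ne (right_ne_zero_of_mul hx)
  have hgV : ∀ x, g x ≠ 0 → x ∈ V := fun x hx => hVH x (by
      have := hgs x hx; simp only [Bd, Set.mem_ofPred_eq]; omega) (by have := hgs x hx; omega)
  have hDg : D g = tau (1 * q) (vtx (0, k * h)) - vtx (0, k * h) := by
    rw [tau_vtx, D, LinearMap.add_apply, bx_bil, bx_bil, d1_path, d1_even, bil_zero_right, add_zero, LinearMap.id_apply,
      bil_sub_left, bil_single, bil_single]
    simp [shv, vtx, vc, sg]
  have hγ : mk q V D (Pj q V g) = 0 := by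
    rw [mk_Pj hq hV eqv_D fun e he => Or.inl (hgV e he), hDg, map_sub, Pj_tau, sub_self]
  have hcγ : mk q V (cM φ) (Pj q V g) - Pj q V g ∈ LinearMap.range (mk q V D) := by
    rw [mk_Pj hq hV cE fun e he => Or.inl (hgV e he), ← map_sub, cM_hM, map_add, hDg, map_sub (hM φ), hE, map_sub, Pj_tau,
      sub_self, add_zero]
    exact ⟨Pj q V (hM φ g), imD _ (spt_map (P := {x | x.2 = 2 * (k * h)}) _ (fun x hx => W8 x hx) (mem_spt.2 hgs))⟩
  refine theoremA (mk q V D) (mk q V (cM φ)) (mk q V eps) (mk q V (K (lx k) (ly k h1))) (mk q V (E (lx k) (ly k h1)))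
    _ hdd hdc hed hee hec hk0 (rank_E hQ hk hh1 V) htr (m + m) hm (Pj q V g) hγ hcγ ?_
  rintro ⟨z, hz⟩
  have cV : ∀ x ∈ V, cf q x (D (io q V z)) = cf q x g := by
    intro x hx
    have hr := (red_mem hq hV).2 hx
    have h3 := DFunLike.congr_fun hz ⟨_, hr⟩
    rw [mk, LinearMap.comp_apply, LinearMap.comp_apply, Pj_apply, Pj_apply] at h3
    unfold cf at h3 ⊢
    rw [red_fd hr] at h3
    exact h3
  have g0 : ∀ x : ℤ × ℤ, x.2 ≠ 2 * (k * h) → cf q x g = 0 := by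
    intro x hx
    by_contra hc
    obtain ⟨n, hn⟩ := cf_ne hc
    have h4 := hgs _ hn
    exact hx h4
  have g1 : ∀ i, i % 2 = 1 → cf q (i, 2 * (k * h)) g = 1 := fun i hi => cf_core hq hi
  refine H7 (fun x => cf q x (io q V z)) (fun n x => by rw [cf_sh]) (fun x hx => cf_io hq hV hx z) ?_ ?_
  · intro i j hi hj hx
    have := cV _ hx
    rw [cf_D_v _ hi hj, g0 _ (by dsimp only; omega)] at this
    exact sub_eq_zero.1 this
  · intro i j hi hj hx
    have := cV _ hx
    rw [cf_D_h _ hi hj] at this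
    dsimp only at this ⊢
    rw [this]
    split_ifs with hjj
    · rw [hjj]; exact g1 i hi
    · exact g0 _ hjj
end Mob

namespace Mob
open Set

def sq (k : ℤ) (S : ℤ × ℤ) : Set (ℝ × ℝ) :=
  {p | S.1 ≤ k * p.1 ∧ k * p.1 ≤ S.1 + 1 ∧ S.2 ≤ k * p.2 ∧ k * p.2 ≤ S.2 + 1}
def US (k : ℤ) (X : Set (ℤ × ℤ)) : Set (ℝ × ℝ) := {p | ∃ S ∈ X, p ∈ sq k S}
def tr (a : ℝ) (p : ℝ × ℝ) : ℝ × ℝ := (p.1 + a, p.2)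

theorem lf1 (t : ℝ) : ∃ ε > 0, ∀ t', |t' - t| < ε → ∀ n : ℤ, (n : ℝ) ≤ t' → t' ≤ n + 1 → (n : ℝ) ≤ t ∧ t ≤ n + 1 := by
  refine ⟨min (⌊t⌋ + 1 - t) (t - (⌈t⌉ - 1)), lt_min (by linarith [Int.lt_floor_add_one t]) (by linarith [Int.ceil_lt_add_one t]), ?_⟩
  intro t' h n h1 h2
  have h3 := abs_lt.1 h
  have h4 := min_le_left ((⌊t⌋ : ℝ) + 1 - t) (t - (⌈t⌉ - 1))
  have h5 := min_le_right ((⌊t⌋ : ℝ) + 1 - t) (t - (⌈t⌉ - 1))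
  constructor
  · have : (n : ℝ) < ⌊t⌋ + 1 := by linarith
    have : n < ⌊t⌋ + 1 := by exact_mod_cast this
    exact Int.le_floor.1 (by omega)
  · have : (⌈t⌉ : ℝ) - 1 < n + 1 := by linarith
    have : ⌈t⌉ - 1 < n + 1 := by exact_mod_cast this
    have := Int.ceil_le.1 (show ⌈t⌉ ≤ n + 1 by omega)
    push_cast at this
    exact this

theorem lf {k : ℤ} (hk : 0 < k) (p : ℝ × ℝ) : ∃ ε > 0, ∀ p', dist p' p < ε → ∀ S, p' ∈ sq k S → p ∈ sq k S := by
  obtain ⟨e1, he1, h1⟩ := lf1 (k * p.1)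
  obtain ⟨e2, he2, h2⟩ := lf1 (k * p.2)
  have hk' : (0 : ℝ) < k := by exact_mod_cast hk
  refine ⟨min e1 e2 / k, by positivity, fun p' hp S hS => ?_⟩
  rw [lt_div_iff₀ hk', Prod.dist_eq, Real.dist_eq, Real.dist_eq] at hp
  have a1 : |k * p'.1 - k * p.1| < e1 := by
    rw [← mul_sub, abs_mul, abs_of_pos hk']
    calc _ ≤ max |p'.1 - p.1| |p'.2 - p.2| * k := by rw [mul_comm]; gcongr; exact le_max_left _ _
      _ < _ := hp.trans_le (min_le_left _ _)
  have a2 : |k * p'.2 - k * p.2| < e2 := by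
    rw [← mul_sub, abs_mul, abs_of_pos hk']
    calc _ ≤ max |p'.1 - p.1| |p'.2 - p.2| * k := by rw [mul_comm]; gcongr; exact le_max_right _ _
      _ < _ := hp.trans_le (min_le_right _ _)
  obtain ⟨b1, b2, b3, b4⟩ := hS
  exact ⟨(h1 _ a1 _ b1 b2).1, (h1 _ a1 _ b1 b2).2, (h2 _ a2 _ b3 b4).1, (h2 _ a2 _ b3 b4).2⟩

theorem sq_ex (k : ℤ) (p : ℝ × ℝ) : p ∈ sq k (⌊k * p.1⌋, ⌊k * p.2⌋) :=
  ⟨Int.floor_le _, (Int.lt_floor_add_one _).le, Int.floor_le _, (Int.lt_floor_add_one _).le⟩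

theorem US_closed {k : ℤ} (hk : 0 < k) (X) : IsClosed (US k X) := by
  rw [← isOpen_compl_iff, Metric.isOpen_iff]
  intro p hp
  obtain ⟨ε, he, h⟩ := lf hk p
  exact ⟨ε, he, fun p' hp' ⟨S, hS, hx⟩ => hp ⟨S, hS, h p' hp' S hx⟩⟩

theorem US_int {k : ℤ} (hk : 0 < k) {X : Set (ℤ × ℤ)} {p} (h : ∀ S, p ∈ sq k S → S ∈ X) : p ∈ interior (US k X) := by
  obtain ⟨ε, he, h'⟩ := lf hk p
  rw [mem_interior_iff_mem_nhds, Metric.mem_nhds_iff]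
  exact ⟨ε, he, fun p' hp' => ⟨_, h _ (h' p' hp' _ (sq_ex k p')), sq_ex k p'⟩⟩

theorem US_tr {k Q : ℤ} {X : Set (ℤ × ℤ)} (h : ∀ n (S : ℤ × ℤ), (S.1 + n * (k * Q), S.2) ∈ X ↔ S ∈ X) (p) :
    tr Q p ∈ US k X ↔ p ∈ US k X := by
  constructor
  · rintro ⟨S, hS, h1, h2, h3, h4⟩
    refine ⟨(S.1 + (-1) * (k * Q), S.2), (h _ _).2 hS, ?_⟩
    simp only [tr] at h1 h2 h3 h4
    refine ⟨?_, ?_, h3, h4⟩ <;> push_cast <;> linarith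
  · rintro ⟨S, hS, h1, h2, h3, h4⟩
    refine ⟨(S.1 + 1 * (k * Q), S.2), (h _ _).2 hS, ?_⟩
    refine ⟨?_, ?_, h3, h4⟩ <;> simp only [tr] <;> push_cast <;> linarith

/-- no attractor -/
def P3 (Q : ℤ) (F : ℝ × ℝ → ℝ × ℝ) : Prop := ∀ X : Set (ℝ × ℝ), IsClosed X → (∀ p, tr Q p ∈ X ↔ p ∈ X) →
  X.Nonempty → X ≠ univ → ¬ F '' X ⊆ interior X

theorem tr_cont (a : ℝ) : Continuous (tr a) := by unfold tr; fun_prop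

theorem comp {Q : ℤ} {F : ℝ × ℝ → ℝ × ℝ} (hF : Continuous F) (h3 : P3 Q F) {X E : Set (ℝ × ℝ)} (hX : IsClosed X)
    (hT : ∀ p, tr Q p ∈ X ↔ p ∈ X) (hE : E ⊆ X) (hEc : IsPreconnected E) {e} (he : e ∈ E) (hTe : tr Q e ∈ E) (hFe : F e ∈ E)
    (hne : X ≠ univ) (h : F '' (connectedComponentIn X e) ⊆ interior X) : False := by
  set C := connectedComponentIn X e with hC
  have hCX : C ⊆ X := connectedComponentIn_subset X e
  have heC : e ∈ C := mem_connectedComponentIn (hE he)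
  have hEC : E ⊆ C := hEc.subset_connectedComponentIn he hE
  have hsub : ∀ A : Set (ℝ × ℝ), IsPreconnected A → A ⊆ X → (∃ a ∈ A, a ∈ C) → A ⊆ C := by
    rintro A hA hAX ⟨a, ha, haC⟩
    rw [hC, connectedComponentIn_eq haC]
    exact hA.subset_connectedComponentIn ha hAX
  have hT1 : ∀ p, p ∈ C → tr Q p ∈ C := by
    intro p hp
    refine hsub (tr Q '' C) (isPreconnected_connectedComponentIn.image _ (tr_cont _).continuousOn) ?_
      ⟨tr Q e, mem_image_of_mem _ heC, hEC hTe⟩ (mem_image_of_mem _ hp)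
    rintro _ ⟨x, hx, rfl⟩
    exact (hT x).2 (hCX hx)
  have hinv : ∀ p, tr (-Q) (tr Q p) = p := fun p => by simp [tr]
  have hinv' : ∀ p, tr Q (tr (-Q) p) = p := fun p => by simp [tr]
  have hT2 : ∀ p, tr Q p ∈ C → p ∈ C := by
    intro p hp
    have := hsub (tr (-Q) '' C) (isPreconnected_connectedComponentIn.image _ (tr_cont _).continuousOn) (by
      rintro _ ⟨x, hx, rfl⟩
      rw [← hT, hinv']
      exact hCX hx) ⟨tr (-Q) (tr Q e), mem_image_of_mem _ (hEC hTe), by rw [hinv]; exact heC⟩ (mem_image_of_mem _ hp)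
    rwa [hinv] at this
  have hFC : F '' C ⊆ C := hsub _ (isPreconnected_connectedComponentIn.image _ hF.continuousOn)
    (h.trans interior_subset) ⟨F e, mem_image_of_mem _ heC, hEC hFe⟩
  have hCcl : IsClosed C := isClosed_of_closure_subset (hsub _ isPreconnected_connectedComponentIn.closure
    (closure_minimal hCX hX) ⟨e, subset_closure heC, heC⟩)
  refine h3 C hCcl (fun p => ⟨hT2 p, hT1 p⟩) ⟨e, heC⟩ (fun hc => hne (univ_subset_iff.1 (hc ▸ hCX))) ?_
  intro p hp
  have h4 := h hp
  rw [mem_interior_iff_mem_nhds, Metric.mem_nhds_iff] at h4 ⊢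
  obtain ⟨ε, hε, hb⟩ := h4
  exact ⟨ε, hε, hsub _ (convex_ball p ε).isPreconnected hb ⟨p, Metric.mem_ball_self hε, hFC hp⟩⟩

theorem h6core {Q : ℤ} {G : ℝ × ℝ → ℝ × ℝ} (hG : Continuous G) (h3 : P3 Q G) {N L : Set (ℤ × ℤ)} {Nl : ℤ × ℤ → Prop}
    {E : Set (ℝ × ℝ)} {e : ℝ × ℝ}
    (hN : ∀ n (S : ℤ × ℤ), (S.1 + n * Q, S.2) ∈ N ↔ S ∈ N)
    (hP : ∀ n (v : ℤ × ℤ), Nl (v.1 + n * Q, v.2) ↔ Nl v)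
    (h00 : (0, 0) ∉ N)
    (hNN : ∀ S ∈ N, ∀ v v', CornV S v → CornV S v' → Nl v → Nl v')
    (hNL : ∀ S ∈ L, ∀ v, CornV S v → Nl v)
    (c1 : ∀ S ∈ N, S ∉ L → ∀ p ∈ sq 1 S, ∀ S', G p ∈ sq 1 S' → S' ∈ N)
    (hE : ∀ p ∈ E, ∃ S ∈ N, p ∈ sq 1 S ∧ ¬ Nl S) (hEc : IsPreconnected E) (he : e ∈ E) (hTe : tr Q e ∈ E) (hGe : G e ∈ E) : False := by
  have hself : ∀ S, CornV S S := fun S => by unfold CornV; omega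
  have share : ∀ S ∈ N, ∀ S' ∈ N, ∀ p, p ∈ sq 1 S → p ∈ sq 1 S' → Nl S → Nl S' := by
    intro S hS S' hS' p ⟨a1, a2, a3, a4⟩ ⟨b1, b2, b3, b4⟩ hn
    have i1 : S.1 ≤ S'.1 + 1 := by exact_mod_cast a1.trans b2
    have i2 : S'.1 ≤ S.1 + 1 := by exact_mod_cast b1.trans a2
    have i3 : S.2 ≤ S'.2 + 1 := by exact_mod_cast a3.trans b4
    have i4 : S'.2 ≤ S.2 + 1 := by exact_mod_cast b3.trans a4
    refine hNN S' hS' (max S.1 S'.1, max S.2 S'.2) _ ?_ (hself _) (hNN S hS _ _ (hself _) ?_ hn)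
    · unfold CornV; dsimp only; omega
    · unfold CornV; dsimp only; omega
  set X := US 1 {S | S ∈ N ∧ ¬ Nl S} with hX
  set Y := US 1 {S | S ∈ N ∧ Nl S} with hY
  have hXY : ∀ p, p ∈ X → p ∈ Y → False := by
    rintro p ⟨S, ⟨hS, hn⟩, hp⟩ ⟨S', ⟨hS', hn'⟩, hp'⟩
    exact hn (share _ hS' _ hS p hp' hp hn')
  have hcen : ((1/2, 1/2) : ℝ × ℝ) ∉ X := by
    rintro ⟨S, ⟨hS, -⟩, h1, h2, h3, h4⟩
    apply h00
    norm_num at h1 h2 h3 h4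
    have e1 : (S.1 : ℝ) < 1 := by linarith
    have e2 : (-1 : ℝ) < S.1 := by linarith
    have e3 : (S.2 : ℝ) < 1 := by linarith
    have e4 : (-1 : ℝ) < S.2 := by linarith
    have e1 : S.1 < 1 := by exact_mod_cast e1
    have e2 : -1 < S.1 := by exact_mod_cast e2
    have e3 : S.2 < 1 := by exact_mod_cast e3
    have e4 : -1 < S.2 := by exact_mod_cast e4
    have : S = (0, 0) := Prod.ext (by dsimp only; omega) (by dsimp only; omega)
    rwa [this] at hS
  have hall : ∀ p ∈ X, ∀ S', G p ∈ sq 1 S' → S' ∈ N := by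
    rintro p ⟨S, ⟨hS, hn⟩, hp⟩ S' hS'
    exact c1 S hS (fun hc => hn (hNL S hc _ (hself _))) p hp S' hS'
  have hCX : connectedComponentIn X e ⊆ X := connectedComponentIn_subset X e
  have hEX : E ⊆ X := fun p hp => by
    obtain ⟨S, h1, h2, h3⟩ := hE p hp
    exact ⟨S, ⟨h1, h3⟩, h2⟩
  have heC : e ∈ connectedComponentIn X e := mem_connectedComponentIn (hEX he)
  refine comp hG h3 (X := X) (E := E) (e := e) (US_closed one_pos _) (US_tr fun n S => ?_) hEX hEc he hTe hGe
    (fun hc => hcen (hc ▸ mem_univ _)) ?_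
  · simp only [one_mul, mem_ofPred_eq]
    rw [hN, hP]
  · have hpre : IsPreconnected (G '' connectedComponentIn X e) :=
      isPreconnected_connectedComponentIn.image _ hG.continuousOn
    have hcov : G '' connectedComponentIn X e ⊆ X ∪ Y := by
      rintro _ ⟨p, hp, rfl⟩
      have h5 := sq_ex 1 (G p)
      have := hall p (hCX hp) _ h5
      by_cases hn : Nl (⌊((1:ℤ):ℝ) * (G p).1⌋, ⌊((1:ℤ):ℝ) * (G p).2⌋)
      · exact Or.inr ⟨_, ⟨this, hn⟩, h5⟩
      · exact Or.inl ⟨_, ⟨this, hn⟩, h5⟩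
    have hsub : G '' connectedComponentIn X e ⊆ X := by
      rcases (isPreconnected_iff_subset_of_disjoint_closed.1 hpre) X Y (US_closed one_pos _) (US_closed one_pos _) hcov (by
        rw [Set.eq_empty_iff_forall_notMem]
        rintro p ⟨_, h1, h2⟩
        exact hXY p h1 h2) with h | h
      · exact h
      · exact (hXY (G e) (hEX hGe) (h (mem_image_of_mem _ heC))).elim
    rintro _ ⟨p, hp, rfl⟩
    refine US_int one_pos fun S' hS' => ?_
    have h6 := hall p (hCX hp) S' hS'
    exact ⟨h6, fun hn => hXY (G p) (hsub (mem_image_of_mem _ hp)) ⟨S', ⟨h6, hn⟩, hS'⟩⟩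
end Mob

namespace Mob
open Set

theorem inSq_real {k : ℤ} (hk : 0 < k) {S : ℤ × ℤ} {p : ℝ × ℝ} (h1 : (k * S.1 : ℤ) ≤ k * p.1) (h2 : k * p.1 ≤ (k * S.1 + k : ℤ))
    (h3 : (k * S.2 : ℤ) ≤ k * p.2) (h4 : k * p.2 ≤ (k * S.2 + k : ℤ)) : p ∈ sq 1 S := by
  have hk' : (0 : ℝ) < k := by exact_mod_cast hk
  push_cast at *
  refine ⟨?_, ?_, ?_, ?_⟩ <;> push_cast <;> nlinarith

theorem h7core {Q k h h1 : ℤ} (hk : 0 < k) (hh1 : 0 < h1) (hh : h1 < h) {N L : Set (ℤ × ℤ)} {G : ℝ × ℝ ≃ₜ ℝ × ℝ}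
    (h3 : P3 Q G.symm)
    (hLb : ∀ S ∈ L, -h1 ≤ S.2 ∧ S.2 < h1) (hO : ∀ S : ℤ × ℤ, h1 ≤ S.2 ∨ S.2 < -h1 → S ∈ N)
    (c2 : ∀ S ∈ L, ∀ p ∈ sq 1 S, ∀ S' ∈ N, S' ∉ L → G p ∉ sq 1 S')
    (he : ∃ e : ℝ × ℝ, (h : ℝ) ≤ e.2 ∧ (h : ℝ) ≤ (G.symm e).2)
    (Z : ℤ × ℤ → ℚ) (Z1 : ∀ n x, Z (sh (n * (Q * k)) x) = Z x) (Z2 : ∀ x, x ∉ Vc k h N L → Z x = 0)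
    (Z3 : ∀ i j, i % 2 = 0 → j % 2 = 1 → (i, j) ∈ Vc k h N L → Z (i - 1, j) = Z (i + 1, j))
    (Z4 : ∀ i j, i % 2 = 1 → j % 2 = 0 → (i, j) ∈ Vc k h N L →
        Z (i, j + 1) - Z (i, j - 1) = if j = 2 * (k * h) then 1 else 0) : False := by
  have hk' : (0 : ℝ) < k := by exact_mod_cast hk
  have hkh : 0 < k * h1 := by positivity
  have hkhh : k * h1 < k * h := by nlinarith
  set Y := US 1 L with hY
  let Z' : ℤ × ℤ → ℚ := fun S => if k * h ≤ S.2 then -1 else Z (2 * S.1 + 1, 2 * S.2 + 1)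
  have A1 : ∀ p, p ∉ Y → ∀ a b, p ∈ sq k (a, b) → p ∈ sq k (a + 1, b) → Z' (a, b) = Z' (a + 1, b) := by
    intro p hp a b ⟨a1, a2, a3, a4⟩ ⟨b1, b2, b3, b4⟩
    dsimp only at *
    simp only [Z']
    split_ifs with hb
    · rfl
    by_cases hV : (2 * a + 2, 2 * b + 1) ∈ Vc k h N L
    · have := Z3 _ _ (by omega) (by omega) hV
      rwa [show 2 * a + 2 - 1 = 2 * a + 1 by ring, show 2 * a + 2 + 1 = 2 * (a + 1) + 1 by ring] at this
    · have hL : (2 * a + 2, 2 * b + 1) ∉ Lc k L := by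
        rintro ⟨S, hS, hx⟩
        refine hp ⟨S, hS, ?_⟩
        unfold InSq at hx
        dsimp only at hx
        push_cast at b1
        apply inSq_real hk
        · exact le_trans (by exact_mod_cast (show k * S.1 ≤ a + 1 by omega)) b1
        · exact a2.trans (by exact_mod_cast (show a + 1 ≤ k * S.1 + k by omega))
        · exact le_trans (by exact_mod_cast (show k * S.2 ≤ b by omega)) a3
        · exact a4.trans (by exact_mod_cast (show b + 1 ≤ k * S.2 + k by omega))
      rw [Z2, Z2]
      · rintro ⟨⟨hB, S, hS, hx⟩, -⟩
        refine hV ⟨⟨hB, S, hS, ?_⟩, hL⟩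
        unfold InSq at *
        dsimp only at *
        omega
      · rintro ⟨⟨hB, S, hS, hx⟩, -⟩
        refine hV ⟨⟨hB, S, hS, ?_⟩, hL⟩
        unfold InSq at *
        dsimp only at *
        omega
  have A2 : ∀ p, p ∉ Y → ∀ a b, p ∈ sq k (a, b) → p ∈ sq k (a, b + 1) → Z' (a, b) = Z' (a, b + 1) := by
    intro p hp a b ⟨a1, a2, a3, a4⟩ ⟨b1, b2, b3, b4⟩
    dsimp only at *
    simp only [Z']
    by_cases hb : k * h ≤ b
    · rw [if_pos hb, if_pos (by omega)]
    rw [if_neg hb]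
    have hL : (2 * a + 1, 2 * b + 2) ∉ Lc k L := by
      rintro ⟨S, hS, hx⟩
      refine hp ⟨S, hS, ?_⟩
      unfold InSq at hx
      dsimp only at hx
      push_cast at b3
      apply inSq_real hk
      · exact le_trans (by exact_mod_cast (show k * S.1 ≤ a by omega)) a1
      · exact a2.trans (by exact_mod_cast (show a + 1 ≤ k * S.1 + k by omega))
      · exact le_trans (by exact_mod_cast (show k * S.2 ≤ b + 1 by omega)) b3
      · exact a4.trans (by exact_mod_cast (show b + 1 ≤ k * S.2 + k by omega))
    by_cases ht : k * h ≤ b + 1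
    · rw [if_pos ht]
      have hV : (2 * a + 1, 2 * b + 2) ∈ Vc k h N L := by
        refine ⟨hi_N hk hO ?_ ?_, hL⟩
        · simp only [Bd, mem_ofPred_eq]; omega
        · simp only [Hi, mem_ofPred_eq]; omega
      have := Z4 _ _ (by omega) (by omega) hV
      rw [Z2 (2 * a + 1, 2 * b + 2 + 1) (fun hc => by
        have := hc.1.1
        simp only [Bd, mem_ofPred_eq] at this; omega), if_pos (by omega), show 2 * b + 2 - 1 = 2 * b + 1 by ring] at this
      linarith
    rw [if_neg ht]
    by_cases hV : (2 * a + 1, 2 * b + 2) ∈ Vc k h N L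
    · have := Z4 _ _ (by omega) (by omega) hV
      rw [if_neg (by omega), show 2 * b + 2 - 1 = 2 * b + 1 by ring, show 2 * b + 2 + 1 = 2 * (b + 1) + 1 by ring] at this
      linarith
    · rw [Z2, Z2]
      · rintro ⟨⟨hB, S, hS, hx⟩, -⟩
        refine hV ⟨⟨?_, S, hS, ?_⟩, hL⟩
        · simp only [Bd, mem_ofPred_eq] at *; omega
        unfold InSq at *
        dsimp only at *
        omega
      · rintro ⟨⟨hB, S, hS, hx⟩, -⟩
        refine hV ⟨⟨?_, S, hS, ?_⟩, hL⟩
        · simp only [Bd, mem_ofPred_eq] at *; omega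
        unfold InSq at *
        dsimp only at *
        omega
  have A3 : ∀ p, p ∉ Y → ∀ S S', p ∈ sq k S → p ∈ sq k S' → Z' S = Z' S' := by
    rintro p hp ⟨a, b⟩ ⟨c, d⟩ hS hS'
    have hm : p ∈ sq k (c, b) := ⟨hS'.1, hS'.2.1, hS.2.2⟩
    have i1 : a ≤ c + 1 := by exact_mod_cast hS.1.trans hS'.2.1
    have i2 : c ≤ a + 1 := by exact_mod_cast hS'.1.trans hS.2.1
    have i3 : b ≤ d + 1 := by exact_mod_cast hS.2.2.1.trans hS'.2.2.2
    have i4 : d ≤ b + 1 := by exact_mod_cast hS'.2.2.1.trans hS.2.2.2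
    trans Z' (c, b)
    · obtain rfl | rfl | rfl : c = a ∨ c = a + 1 ∨ a = c + 1 := by omega
      · rfl
      · exact A1 p hp _ _ hS hm
      · exact (A1 p hp _ _ hm hS).symm
    · obtain rfl | rfl | rfl : d = b ∨ d = b + 1 ∨ b = d + 1 := by omega
      · rfl
      · exact A2 p hp _ _ hm hS'
      · exact (A2 p hp _ _ hS' hm).symm
  set X := US k {S | Z' S ≠ 0} with hX
  have hXint : ∀ p ∈ X, p ∉ Y → p ∈ interior X := by
    rintro p ⟨S, hS, hp⟩ hpY
    refine US_int hk fun S' hS' => ?_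
    rw [mem_ofPred_eq, A3 p hpY S' S hS' hp]
    exact hS
  have hXY : ∀ p ∈ X, G.symm p ∉ Y := by
    rintro p ⟨S, hS, hp⟩ ⟨S0, hS0, hp0⟩
    have key : ∃ S' ∈ N, S' ∉ L ∧ p ∈ sq 1 S' := by
      by_cases hb : k * h ≤ S.2
      · refine ⟨(⌊((1:ℤ):ℝ) * p.1⌋, ⌊((1:ℤ):ℝ) * p.2⌋), ?_, ?_, sq_ex 1 p⟩
        all_goals
          have h5 : h1 ≤ ⌊((1:ℤ):ℝ) * p.2⌋ := by
            rw [Int.le_floor]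
            have h6 := hp.2.2.1
            have h7 : ((k * h1 : ℤ) : ℝ) ≤ S.2 := by exact_mod_cast (show k * h1 ≤ S.2 by omega)
            push_cast at *
            nlinarith
        · exact hO _ (Or.inl h5)
        · intro hc
          have := hLb _ hc
          dsimp only at this
          omega
      · simp only [mem_ofPred_eq, Z', if_neg hb] at hS
        have hV : (2 * S.1 + 1, 2 * S.2 + 1) ∈ Vc k h N L := by
          by_contra hc
          exact hS (Z2 _ hc)
        obtain ⟨⟨-, S', hS', hx⟩, hl⟩ := hV
        refine ⟨S', hS', fun hc => hl ⟨S', hc, hx⟩, ?_⟩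
        unfold InSq at hx
        dsimp only at hx
        obtain ⟨a1, a2, a3, a4⟩ := hp
        apply inSq_real hk
        · exact le_trans (by exact_mod_cast (show k * S'.1 ≤ S.1 by omega)) a1
        · exact a2.trans (by exact_mod_cast (show S.1 + 1 ≤ k * S'.1 + k by omega))
        · exact le_trans (by exact_mod_cast (show k * S'.2 ≤ S.2 by omega)) a3
        · exact a4.trans (by exact_mod_cast (show S.2 + 1 ≤ k * S'.2 + k by omega))
    obtain ⟨S', h4, h5, h6⟩ := key
    refine c2 S0 hS0 _ hp0 S' h4 h5 ?_
    rwa [G.apply_symm_apply]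
  obtain ⟨e, he1, he2⟩ := he
  let E : Set (ℝ × ℝ) := {p | (h : ℝ) ≤ p.2}
  have hEX : E ⊆ X := by
    intro p hp
    refine ⟨_, ?_, sq_ex k p⟩
    have : k * h ≤ ⌊(k:ℝ) * p.2⌋ := by
      rw [Int.le_floor]
      push_cast
      have : (h : ℝ) ≤ p.2 := hp
      gcongr
    simp only [mem_ofPred_eq, Z', if_pos this]
    norm_num
  have hEc : IsPreconnected E := by
    have : Convex ℝ E := (convex_Ici (𝕜 := ℝ) (h : ℝ)).is_linear_preimage (f := fun p : ℝ × ℝ => p.2) ⟨fun _ _ => rfl, fun _ _ => rfl⟩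
    exact this.isPreconnected
  have hlow : ((0, -h - 1) : ℝ × ℝ) ∉ X := by
    rintro ⟨S, hS, -, -, hp, hp'⟩
    have h8 : (S.2 : ℝ) ≤ (k * (-h - 1) : ℤ) := by push_cast; exact hp
    have h8 : S.2 ≤ k * (-h - 1) := by exact_mod_cast h8
    have h9 : S.2 ≤ - (k * h) - k := by linarith
    apply hS
    simp only [Z']
    rw [if_neg (by omega)]
    apply Z2
    intro hc
    have := hc.1.1
    simp only [Bd, mem_ofPred_eq] at this
    omega
  have hCX : connectedComponentIn X e ⊆ X := connectedComponentIn_subset X e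
  have heC : e ∈ connectedComponentIn X e := mem_connectedComponentIn (hEX he1)
  refine comp (F := G.symm) G.symm.continuous h3 (X := X) (E := E) (e := e) (US_closed hk _) (US_tr fun n S => ?_) hEX hEc he1 he1 he2
    (fun hc => hlow (hc ▸ mem_univ _)) ?_
  · have := Z1 n (2 * S.1 + 1, 2 * S.2 + 1)
    unfold sh at this
    dsimp only at this
    simp only [mem_ofPred_eq, Z']
    rw [show 2 * (S.1 + n * (k * Q)) + 1 = 2 * S.1 + 1 + 2 * (n * (Q * k)) by ring, this]
  · have hpre : IsPreconnected (G.symm '' connectedComponentIn X e) :=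
      isPreconnected_connectedComponentIn.image _ G.symm.continuous.continuousOn
    refine hpre.subset_left_of_subset_union isOpen_interior (US_closed hk _).isOpen_compl (v := Xᶜ) ?_ ?_ ?_
    · exact disjoint_compl_right.mono_left interior_subset
    · rintro _ ⟨p, hp, rfl⟩
      by_cases hc : G.symm p ∈ X
      · exact Or.inl (hXint _ hc (hXY p (hCX hp)))
      · exact Or.inr hc
    · exact ⟨G.symm e, mem_image_of_mem _ heC, hXint _ (hEX he2) (hXY e (hEX he1))⟩
end Mob

namespace Mob
open Set

def Equi (Q : ℝ) (G : ℝ × ℝ → ℝ × ℝ) : Prop := ∀ p, G (tr Q p) = tr Q (G p)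

theorem tr_tr (a b p) : tr a (tr b p) = tr (b + a) p := by simp [tr, add_assoc]
theorem tr_zero (p) : tr 0 p = p := by simp [tr]
theorem tr_dist (a p p') : dist (tr a p) (tr a p') = dist p p' := by
  simp [tr, Prod.dist_eq]

theorem Equi.int {Q : ℝ} {G} (h : Equi Q G) (n : ℤ) (p) : G (tr (n * Q) p) = tr (n * Q) (G p) := by
  induction n using Int.induction_on generalizing p with
  | zero => simp [tr_zero]
  | succ i ih =>
    have : ∀ p, tr ((i + 1 : ℤ) * Q) p = tr Q (tr ((i : ℤ) * Q) p) := fun p => by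
      rw [tr_tr]; congr 1; push_cast; ring
    rw [this, h, ih, this]
  | pred i ih =>
    have : ∀ p, tr ((-i : ℤ) * Q) p = tr Q (tr ((-i - 1 : ℤ) * Q) p) := fun p => by
      rw [tr_tr]; congr 1; push_cast; ring
    have h2 := ih p
    rw [this, this, h] at h2
    have inj : Function.Injective (tr Q) := fun a b hab => by
      have := congrArg (tr (-Q)) hab
      rw [tr_tr, tr_tr] at this
      simpa [tr_zero] using this
    exact inj h2

theorem Equi.iter {Q : ℝ} {G} (h : Equi Q G) (n : ℕ) : Equi Q (G^[n]) := fun p => by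
  induction n with
  | zero => rfl
  | succ n ih => rw [Function.iterate_succ_apply', ih, h, Function.iterate_succ_apply']

theorem nrm {Q : ℝ} (hQ : 0 < Q) (p : ℝ × ℝ) : ∃ n : ℤ, 0 ≤ (tr (n * Q) p).1 ∧ (tr (n * Q) p).1 ≤ Q := by
  refine ⟨-⌊p.1 / Q⌋, ?_, ?_⟩
  · have := Int.floor_le (p.1 / Q)
    rw [le_div_iff₀ hQ] at this
    simp only [tr]; push_cast; linarith
  · have := (Int.lt_floor_add_one (p.1 / Q)).le
    rw [div_le_iff₀ hQ] at this
    simp only [tr]; push_cast; linarith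

def Bnd (Q H : ℝ) : Set (ℝ × ℝ) := Icc 0 Q ×ˢ Icc (-H) H
theorem Bnd_cpt (Q H : ℝ) : IsCompact (Bnd Q H) := isCompact_Icc.prod isCompact_Icc
theorem mem_Bnd {Q H : ℝ} {p : ℝ × ℝ} (h0 : 0 ≤ p.1) (h1 : p.1 ≤ Q) (h2 : |p.2| ≤ H) : p ∈ Bnd Q H :=
  ⟨⟨h0, h1⟩, abs_le.1 h2⟩

theorem uc {Q : ℝ} (hQ : 0 < Q) {G : ℝ × ℝ → ℝ × ℝ} (hG : Continuous G) (hT : Equi Q G) (H : ℝ) {ε : ℝ} (he : 0 < ε) :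
    ∃ δ > 0, ∀ p p', |p.2| ≤ H → dist p p' < δ → dist (G p) (G p') < ε := by
  have := (Bnd_cpt Q H).uniformContinuousAt_of_continuousAt G (fun a _ => hG.continuousAt) (Metric.dist_mem_uniformity he)
  rw [Metric.mem_uniformity_dist] at this
  obtain ⟨δ, hd, h⟩ := this
  refine ⟨δ, hd, fun p p' hp hpp => ?_⟩
  obtain ⟨n, h1, h2⟩ := nrm hQ p
  have := @h (tr (n * Q) p) (tr (n * Q) p') (by rwa [tr_dist]) (mem_Bnd h1 h2 hp)
  simpa [hT.int, tr_dist] using this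

theorem bdd {Q : ℝ} (hQ : 0 < Q) {G : ℝ × ℝ → ℝ × ℝ} (hG : Continuous G) (hT : Equi Q G) (H : ℝ) :
    ∃ H', ∀ p, |p.2| ≤ H → |(G p).2| ≤ H' := by
  obtain ⟨C, hC⟩ := (Bnd_cpt Q H).exists_bound_of_continuousOn (f := fun p => (G p).2) (by fun_prop)
  refine ⟨C, fun p hp => ?_⟩
  obtain ⟨n, h1, h2⟩ := nrm hQ p
  have := hC _ (mem_Bnd h1 h2 hp)
  rwa [hT.int] at this

/-- pseudo orbits -/
def PO (G : ℝ × ℝ → ℝ × ℝ) (ε : ℝ) : ℕ → ℝ × ℝ → ℝ × ℝ → Prop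
  | 0, z, w => z = w
  | n + 1, z, w => ∃ u, PO G ε n z u ∧ dist (G u) w ≤ ε

theorem PO_mono {G ε ε'} (h : ε ≤ ε') {n z w} (hp : PO G ε n z w) : PO G ε' n z w := by
  induction n generalizing w with
  | zero => exact hp
  | succ n ih => obtain ⟨u, h1, h2⟩ := hp; exact ⟨u, ih h1, h2.trans h⟩

theorem po_lim {Q : ℝ} (hQ : 0 < Q) {G : ℝ × ℝ → ℝ × ℝ} (hG : Continuous G) (hT : Equi Q G) (H : ℝ) (n : ℕ) {η : ℝ} (he : 0 < η) :
    ∃ ε > 0, ∀ z w, |z.2| ≤ H → PO G ε n z w → dist (G^[n] z) w < η := by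
  induction n generalizing η with
  | zero => exact ⟨1, one_pos, fun z w _ h => by cases h; simpa using he⟩
  | succ n ih =>
    obtain ⟨H', hH'⟩ := bdd hQ (hG.iterate n) (hT.iter n) H
    obtain ⟨δ, hd, hu⟩ := uc hQ hG hT H' (half_pos he)
    obtain ⟨ε, h1, h2⟩ := ih hd
    refine ⟨min ε (η / 4), by positivity, fun z w hz ⟨u, hu1, hu2⟩ => ?_⟩
    have h3 := h2 z u hz (PO_mono (min_le_left _ _) hu1)
    have h4 := hu _ _ (hH' z hz) h3
    rw [Function.iterate_succ_apply']
    have := dist_triangle (G (G^[n] z)) (G u) w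
    have := hu2.trans (min_le_right _ _)
    linarith

theorem no_closed {Q : ℝ} (hQ : 0 < Q) {G : ℝ × ℝ → ℝ × ℝ} (hG : Continuous G) (hT : Equi Q G) (H : ℝ) (n : ℕ)
    (hP : ∀ (p : ℤ) z, G^[n] z ≠ tr (p * Q) z) :
    ∃ ε > 0, ∀ z, |z.2| ≤ H → ∀ p : ℤ, ¬ PO G ε n z (tr (p * Q) z) := by
  let D : Set (ℝ × ℝ) := {w | w.2 = 0 ∧ w.1 / Q ∈ range ((↑) : ℤ → ℝ)}
  have hD : IsClosed D := (isClosed_singleton.preimage continuous_snd).inter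
    (Int.isClosedEmbedding_coe_real.isClosed_range.preimage (continuous_fst.div_const Q))
  have hc : IsCompact ((fun z => G^[n] z - z) '' Bnd Q H) :=
    (Bnd_cpt Q H).image ((hG.iterate n).sub continuous_id)
  obtain ⟨η, he, hsub⟩ := hc.exists_thickening_subset_open hD.isOpen_compl (by
    rintro _ ⟨z, hz, rfl⟩ ⟨h1, p, hp⟩
    apply hP p z
    simp only [Prod.snd_sub, Prod.fst_sub] at h1 hp
    rw [eq_div_iff hQ.ne'] at hp
    ext <;> simp only [tr] <;> linarith)
  obtain ⟨ε, h1, h2⟩ := po_lim hQ hG hT H n he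
  refine ⟨ε, h1, fun z hz p hpo => ?_⟩
  have h3 := h2 z _ hz hpo
  obtain ⟨j, h4, h5⟩ := nrm hQ z
  refine hsub (a := (p * Q, 0)) ?_ ⟨rfl, p, by field_simp⟩
  rw [Metric.mem_thickening_iff]
  refine ⟨_, ⟨tr (j * Q) z, mem_Bnd h4 h5 hz, rfl⟩, ?_⟩
  dsimp only
  rw [(hT.iter n).int]
  rw [dist_comm] at h3
  convert h3 using 1
  simp only [tr, Prod.dist_eq, Real.dist_eq, Prod.snd_sub, Prod.fst_sub]
  congr 2 <;> ring
end Mob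

namespace Mob
open Set

noncomputable def ct (k : ℤ) (x : ℤ × ℤ) : ℝ × ℝ := ((x.1 : ℝ) / (2 * k), (x.2 : ℝ) / (2 * k))

theorem cM_row {φ : ℤ × ℤ → ℤ × ℤ} {x y : ℤ × ℤ} (hy : cM φ (sg x) y ≠ 0) {a b : ℤ} (h : ∀ v, Cor x v → a ≤ (φ v).2 ∧ (φ v).2 ≤ b) :
    2 * a ≤ y.2 ∧ y.2 ≤ 2 * b := by
  obtain ⟨M, hM⟩ := phi_box φ x
  have := mem_spt.1 (cM_Bx φ (x := x) (p := (-M, a)) (q := (M, b)) fun v hv =>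
    ⟨(hM v hv).2.2.1, (hM v hv).2.2.2, h v hv⟩) y hy
  exact this.2.2

theorem hM_row {φ : ℤ × ℤ → ℤ × ℤ} {x y : ℤ × ℤ} (hy : hM φ (sg x) y ≠ 0) {a b : ℤ}
    (h : ∀ v, Cor x v → (a ≤ v.2 ∧ v.2 ≤ b) ∧ a ≤ (φ v).2 ∧ (φ v).2 ≤ b) :
    2 * a ≤ y.2 ∧ y.2 ≤ 2 * b := by
  obtain ⟨M, hM⟩ := phi_box φ x
  have := mem_spt.1 (hM_Bx φ (x := x) (p := (-M, a)) (q := (M, b)) fun v hv =>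
    ⟨⟨(hM v hv).1, (hM v hv).2.1, (h v hv).1⟩, (hM v hv).2.2.1, (hM v hv).2.2.2, (h v hv).2⟩) y hy
  exact this.2.2

theorem near1 {k x : ℤ} (hk : 0 < k) {t a : ℝ} (hw1 : 2 * ⌊k * (t - a)⌋ ≤ x) (hw2 : x ≤ 2 * ⌈k * (t + a)⌉) :
    |t - (x : ℝ) / (2 * k)| ≤ a + 1 / k := by
  have hk' : (0 : ℝ) < k := by exact_mod_cast hk
  have e1 : (2 : ℝ) * ⌊k * (t - a)⌋ ≤ x := by exact_mod_cast hw1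
  have e2 : (x : ℝ) ≤ 2 * ⌈k * (t + a)⌉ := by exact_mod_cast hw2
  have e3 := Int.lt_floor_add_one (k * (t - a))
  have e4 := Int.ceil_lt_add_one (k * (t + a))
  have e5 : (x : ℝ) / (2 * k) * k = x / 2 := by field_simp
  have e6 : (1 : ℝ) / k * k = 1 := by field_simp
  rw [abs_le]
  constructor
  · have : (x / (2 * k) - t) * k ≤ (a + 1 / k) * k := by
      rw [sub_mul, e5, add_mul, e6]; linarith
    have := le_of_mul_le_mul_right this hk'
    linarith
  · have : (t - x / (2 * k)) * k ≤ (a + 1 / k) * k := by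
      rw [sub_mul, e5, add_mul, e6]; linarith
    exact le_of_mul_le_mul_right this hk'

theorem phi_ex {Q : ℤ} (hQ : 0 < Q) {G : ℝ × ℝ → ℝ × ℝ} (hG : Continuous G) (hT : Equi Q G) (M : ℕ) (ρ : ℕ → ℤ)
    (hρ0 : ∀ i, 0 < ρ i) (hρ : ∀ i, ρ i + 1 ≤ ρ (i + 1))
    (r1 : ∀ i (p : ℝ × ℝ), |p.2| ≤ ρ i + 1 → |(G p).2| ≤ ρ (i + 1) - 1)
    (r2 : ∀ i (p : ℝ × ℝ), (ρ (i + 1) : ℝ) - 1 ≤ p.2 → (ρ i : ℝ) + 1 ≤ (G p).2)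
    (r3 : ∀ i (p : ℝ × ℝ), p.2 ≤ -((ρ (i + 1) : ℝ) - 1) → (G p).2 ≤ -((ρ i : ℝ) + 1)) {ε : ℝ} (he : 0 < ε) :
    ∃ (k : ℤ) (φ : ℤ × ℤ → ℤ × ℤ), 0 < k ∧ (∀ n v, φ (shv (n * (Q * k)) v) = shv (n * (Q * k)) (φ v)) ∧
      (∀ v, -(k * ρ (M + 1)) ≤ (φ v).2 ∧ (φ v).2 ≤ k * ρ (M + 1)) ∧
      (∀ x y : ℤ × ℤ, |x.2| ≤ 2 * (k * ρ M) → cM φ (sg x) y ≠ 0 → dist (G (ct k x)) (ct k y) ≤ ε) ∧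
      (∀ i ≤ M, ∀ x y : ℤ × ℤ, |x.2| ≤ 2 * (k * ρ i) → cM φ (sg x) y ≠ 0 → |y.2| ≤ 2 * (k * ρ (i + 1))) ∧
      (∀ i ≤ M, ∀ x y : ℤ × ℤ, 2 * (k * ρ (i + 1)) ≤ x.2 → cM φ (sg x) y ≠ 0 → 2 * (k * ρ i) < y.2) ∧
      (∀ i ≤ M, ∀ x y : ℤ × ℤ, x.2 ≤ -(2 * (k * ρ (i + 1))) → cM φ (sg x) y ≠ 0 → y.2 < -(2 * (k * ρ i))) ∧
      (∀ x y : ℤ × ℤ, x.2 = 2 * (k * ρ (M + 1)) → hM φ (sg x) y ≠ 0 → 2 * (k * ρ M) ≤ y.2 ∧ y.2 ≤ 2 * (k * ρ (M + 1))) := by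
  obtain ⟨δ, hd, hu⟩ := uc (Q := Q) (by exact_mod_cast hQ) hG hT (ρ M) (show 0 < ε / 4 by positivity)
  obtain ⟨kn, hkn⟩ := exists_nat_gt (1 / δ + 4 / ε + 1)
  have hkn0 : 0 < 1 / δ := by positivity
  have hkn1 : 0 < 4 / ε := by positivity
  obtain ⟨k, hkk⟩ : ∃ k : ℤ, (k : ℝ) = kn := ⟨kn, by simp⟩
  rw [← hkk] at hkn
  have hk' : (0 : ℝ) < k := by linarith
  have hk1 : (1 : ℝ) < k := by linarith
  have hk : 0 < k := by exact_mod_cast hk'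
  have hkd : 1 / (k : ℝ) < δ := by
    rw [div_lt_comm₀ hk' hd]; linarith
  have hke : 1 / (k : ℝ) < ε / 4 := by
    rw [div_lt_comm₀ hk' (by positivity)]; rw [one_div_div]; linarith
  let gv : ℤ × ℤ → ℝ × ℝ := fun v => G ((v.1 : ℝ) / k, (v.2 : ℝ) / k)
  let φ : ℤ × ℤ → ℤ × ℤ := fun v => (⌊k * (gv v).1⌋, max (-(k * ρ (M + 1))) (min (k * ρ (M + 1)) ⌊k * (gv v).2⌋))
  have mono : ∀ i ≤ M, ρ i ≤ ρ M := fun i hi => monotone_nat_of_le_succ (fun i => by have := hρ i; omega) hi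
  have hpos : ∀ i, 0 < k * ρ i := fun i => mul_pos hk (hρ0 i)
  have hup : ∀ i ≤ M, k * ρ i + k ≤ k * ρ (M + 1) := fun i hi => by nlinarith [mono i hi, hρ M]
  have F1 : ∀ i ≤ M, ∀ v : ℤ × ℤ, |v.2| ≤ k * ρ i + 1 → |⌊k * (gv v).2⌋| ≤ k * (ρ (i + 1) - 1) := by
    intro i hi v hv
    have h1 : |(v.2 : ℝ) / k| ≤ ρ i + 1 := by
      rw [abs_div, abs_of_pos hk', div_le_iff₀ hk']
      have : (|v.2| : ℝ) ≤ k * ρ i + 1 := by exact_mod_cast hv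
      nlinarith
    have h2 := abs_le.1 (r1 i ((v.1 : ℝ) / k, (v.2 : ℝ) / k) h1)
    rw [abs_le]
    constructor
    · rw [Int.le_floor]; push_cast; simp only [gv]; nlinarith
    · have h3 := Int.floor_le (k * (gv v).2)
      have : (⌊k * (gv v).2⌋ : ℝ) ≤ (k * (ρ (i + 1) - 1) : ℤ) := by
        refine h3.trans ?_
        push_cast; simp only [gv]; nlinarith
      exact_mod_cast this
  have F1' : ∀ i ≤ M, ∀ v : ℤ × ℤ, |v.2| ≤ k * ρ i + 1 → (φ v).2 = ⌊k * (gv v).2⌋ := by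
    intro i hi v hv
    have h1 := abs_le.1 (F1 M le_rfl v (hv.trans (by nlinarith [mono i hi])))
    simp only [φ]
    rw [mul_sub] at h1
    omega
  have F2 : ∀ i ≤ M, ∀ v : ℤ × ℤ, k * ρ (i + 1) - 1 ≤ v.2 → k * ρ i + k ≤ (φ v).2 := by
    intro i hi v hv
    have h1 : (ρ (i + 1) : ℝ) - 1 ≤ (v.2 : ℝ) / k := by
      rw [le_div_iff₀ hk']
      have : (k : ℝ) * ρ (i + 1) - 1 ≤ v.2 := by exact_mod_cast hv
      nlinarith
    have h2 := r2 i ((v.1 : ℝ) / k, (v.2 : ℝ) / k) h1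
    have h3 : k * ρ i + k ≤ ⌊k * (gv v).2⌋ := by
      rw [Int.le_floor]; push_cast; simp only [gv]; nlinarith
    have := hup i hi
    simp only [φ]
    omega
  have F3 : ∀ i ≤ M, ∀ v : ℤ × ℤ, v.2 ≤ -(k * ρ (i + 1) - 1) → (φ v).2 ≤ -(k * ρ i + k) := by
    intro i hi v hv
    have h1 : (v.2 : ℝ) / k ≤ -((ρ (i + 1) : ℝ) - 1) := by
      rw [div_le_iff₀ hk']
      have : (v.2 : ℝ) ≤ -((k : ℝ) * ρ (i + 1) - 1) := by exact_mod_cast hv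
      nlinarith
    have h2 := r3 i ((v.1 : ℝ) / k, (v.2 : ℝ) / k) h1
    have h3 : ⌊k * (gv v).2⌋ ≤ -(k * ρ i + k) := by
      have h3 := Int.floor_le (k * (gv v).2)
      have : (⌊k * (gv v).2⌋ : ℝ) ≤ (-(k * ρ i + k) : ℤ) := by
        refine h3.trans ?_
        push_cast; simp only [gv]; nlinarith
      exact_mod_cast this
    have := hup i hi
    simp only [φ]
    omega
  have FB : ∀ v, -(k * ρ (M + 1)) ≤ (φ v).2 ∧ (φ v).2 ≤ k * ρ (M + 1) := by
    intro v
    have := hpos (M + 1)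
    simp only [φ]
    omega
  refine ⟨k, φ, hk, ?_, FB, ?_, ?_, ?_, ?_, ?_⟩
  · intro n v
    have : gv (shv (n * (Q * k)) v) = tr (n * Q) (gv v) := by
      simp only [gv]
      rw [← hT.int]
      congr 1
      simp only [shv, tr]
      push_cast
      congr 1
      field_simp
    simp only [φ]
    rw [this]
    simp only [shv, tr]
    congr 1
    rw [← Int.floor_add_intCast]
    congr 1
    push_cast
    ring
  · intro x y hx hy
    set P := G (ct k x) with hP
    have hc : |(ct k x).2| ≤ ρ M := by
      simp only [ct]
      rw [abs_div, abs_of_pos (by positivity : (0:ℝ) < 2 * k), div_le_iff₀ (by positivity)]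
      have : (|x.2| : ℝ) ≤ 2 * (k * ρ M) := by exact_mod_cast hx
      linarith
    have hcor : ∀ v, Cor x v → |P.1 - (gv v).1| ≤ ε / 4 ∧ |P.2 - (gv v).2| ≤ ε / 4 := by
      intro v hv
      have h1 : dist (ct k x) ((v.1 : ℝ) / k, (v.2 : ℝ) / k) < δ := by
        refine lt_of_le_of_lt ?_ hkd
        obtain ⟨a1, a2, a3, a4⟩ := hv
        have a1 : (2 : ℝ) * v.1 - 1 ≤ x.1 := by exact_mod_cast a1
        have a2 : (x.1 : ℝ) ≤ 2 * v.1 + 1 := by exact_mod_cast a2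
        have a3 : (2 : ℝ) * v.2 - 1 ≤ x.2 := by exact_mod_cast a3
        have a4 : (x.2 : ℝ) ≤ 2 * v.2 + 1 := by exact_mod_cast a4
        simp only [ct, Prod.dist_eq, Real.dist_eq]
        rw [show (x.1 : ℝ) / (2 * k) - v.1 / k = (x.1 - 2 * v.1) / 2 / k by field_simp,
          show (x.2 : ℝ) / (2 * k) - v.2 / k = (x.2 - 2 * v.2) / 2 / k by field_simp, abs_div, abs_div _ (k : ℝ), abs_of_pos hk']
        refine max_le ?_ ?_ <;> gcongr <;> rw [abs_le] <;> constructor <;> linarith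
      have h2 := hu _ _ hc h1
      rw [Prod.dist_eq, Real.dist_eq, Real.dist_eq] at h2
      exact ⟨(le_max_left _ _).trans h2.le, (le_max_right _ _).trans h2.le⟩
    have hbox := mem_spt.1 (cM_Bx φ (x := x) (p := (⌊k * (P.1 - ε / 4)⌋, ⌊k * (P.2 - ε / 4)⌋))
      (q := (⌈k * (P.1 + ε / 4)⌉, ⌈k * (P.2 + ε / 4)⌉)) fun v hv => by
        obtain ⟨b1, b2⟩ := hcor v hv
        rw [abs_le] at b1 b2
        have e2 : (φ v).2 = ⌊k * (gv v).2⌋ := F1' M le_rfl v (by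
          obtain ⟨a1, a2, a3, a4⟩ := hv
          rw [abs_le] at hx ⊢
          omega)
        refine ⟨?_, ?_, ?_, ?_⟩
        · exact Int.floor_le_floor (by gcongr; linarith)
        · exact (Int.floor_le_ceil _).trans (Int.ceil_le_ceil (by gcongr; linarith))
        · rw [e2]; exact Int.floor_le_floor (by gcongr; linarith)
        · rw [e2]; exact (Int.floor_le_ceil _).trans (Int.ceil_le_ceil (by gcongr; linarith))) y hy
    obtain ⟨b1, b2, b3, b4⟩ := hbox
    have n1 := near1 hk b1 b2
    have n2 := near1 hk b3 b4
    simp only [Prod.dist_eq, Real.dist_eq, ct]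
    exact max_le (by linarith) (by linarith)
  · intro i hi x y hx hy
    have := cM_row hy (a := -(k * ρ (i + 1))) (b := k * ρ (i + 1)) fun v hv => by
      obtain ⟨a1, a2, a3, a4⟩ := hv
      have hv : |v.2| ≤ k * ρ i + 1 := by
        rw [abs_le] at hx ⊢
        omega
      rw [F1' i hi v hv]
      have := abs_le.1 (F1 i hi v hv)
      rw [mul_sub] at this
      omega
    rw [abs_le]
    omega
  · intro i hi x y hx hy
    have := cM_row hy (a := k * ρ i + k) (b := k * ρ (M + 1)) fun v hv => by
      obtain ⟨a1, a2, a3, a4⟩ := hv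
      exact ⟨F2 i hi v (by omega), (FB v).2⟩
    omega
  · intro i hi x y hx hy
    have := cM_row hy (a := -(k * ρ (M + 1))) (b := -(k * ρ i + k)) fun v hv => by
      obtain ⟨a1, a2, a3, a4⟩ := hv
      exact ⟨(FB v).1, F3 i hi v (by omega)⟩
    omega
  · intro x y hx hy
    have := hM_row hy (a := k * ρ M) (b := k * ρ (M + 1)) fun v hv => by
      obtain ⟨a1, a2, a3, a4⟩ := hv
      have h2 := F2 M le_rfl v (by omega)
      have h3 := hup M le_rfl
      refine ⟨by omega, by omega, (FB v).2⟩
    omega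
end Mob

namespace Mob
open Set

def Arr (G : ℝ × ℝ → ℝ × ℝ) (δ : ℝ) (S S' : ℤ × ℤ) : Prop := ∃ p ∈ sq 1 S, ∃ p' ∈ sq 1 S', dist (G p) p' ≤ δ
/-- coarse walks in `V` -/
def CW (G : ℝ × ℝ → ℝ × ℝ) (δ : ℝ) (V : Set (ℤ × ℤ)) : ℕ → ℤ × ℤ → ℤ × ℤ → Prop
  | 0, x, y => x = y ∧ x ∈ V
  | n + 1, x, y => ∃ z, CW G δ V n x z ∧ Arr G δ z y ∧ y ∈ V

theorem ct_sq {k : ℤ} (hk : 0 < k) {S x : ℤ × ℤ} (h : InSq k S x) : ct k x ∈ sq 1 S := by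
  have hk' : (0 : ℝ) < k := by exact_mod_cast hk
  have e : ∀ t : ℝ, (k : ℝ) * (t / (2 * k)) = t / 2 := fun t => by field_simp
  obtain ⟨h1, h2, h3, h4⟩ := h
  have h1 : (2 : ℝ) * (k * S.1) ≤ x.1 := by exact_mod_cast h1
  have h2 : (x.1 : ℝ) ≤ 2 * (k * S.1) + 2 * k := by exact_mod_cast h2
  have h3 : (2 : ℝ) * (k * S.2) ≤ x.2 := by exact_mod_cast h3
  have h4 : (x.2 : ℝ) ≤ 2 * (k * S.2) + 2 * k := by exact_mod_cast h4
  apply inSq_real hk <;> simp only [ct, e] <;> push_cast <;> linarith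

theorem h6 {Q h h1 : ℤ} (hh1 : 0 < h1) (hh : h1 < h) {G : ℝ × ℝ → ℝ × ℝ} (hG : Continuous G) (h3 : P3 Q G)
    (ends : ∀ R : ℝ, ∃ R', ∀ p : ℝ × ℝ, (R' ≤ p.2 → R ≤ (G p).2) ∧ (p.2 ≤ -R' → (G p).2 ≤ -R))
    {N L : Set (ℤ × ℤ)} {Nl : ℤ × ℤ → Prop}
    (hN : ∀ n (S : ℤ × ℤ), (S.1 + n * Q, S.2) ∈ N ↔ S ∈ N)
    (hLb : ∀ S ∈ L, -h1 ≤ S.2 ∧ S.2 < h1) (hO : ∀ S : ℤ × ℤ, h1 ≤ S.2 ∨ S.2 < -h1 → S ∈ N)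
    (hP : ∀ n (v : ℤ × ℤ), Nl (v.1 + n * Q, v.2) ↔ Nl v)
    (h00 : (0, 0) ∉ N)
    (hNN : ∀ S ∈ N, -h ≤ S.2 ∧ S.2 < h → ∀ v v', CornV S v → CornV S v' → Nl v → Nl v')
    (hNL : ∀ S ∈ L, ∀ v, CornV S v → Nl v)
    (c1 : ∀ S ∈ N, S ∉ L → ∀ p ∈ sq 1 S, ∀ S', G p ∈ sq 1 S' → S' ∈ N) :
    ∀ v : ℤ × ℤ, (h1 ≤ v.2 ∧ v.2 ≤ h) ∨ (-h ≤ v.2 ∧ v.2 ≤ -h1) → Nl v := by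
  let Nl' : ℤ × ℤ → Prop := fun v => Nl (v.1, max (-h) (min h v.2))
  have hNN' : ∀ S ∈ N, ∀ v v', CornV S v → CornV S v' → Nl' v → Nl' v' := by
    rintro S hS v v' ⟨a1, a2, a3, a4⟩ ⟨b1, b2, b3, b4⟩ hn
    simp only [Nl'] at *
    rcases lt_or_ge S.2 (-h) with hs | hs
    · refine hNN (S.1, -h) (hO _ ?_) ?_ _ _ ?_ ?_ hn <;> (try unfold CornV) <;> dsimp only <;> omega
    rcases le_or_gt h S.2 with hs' | hs'
    · refine hNN (S.1, h - 1) (hO _ ?_) ?_ _ _ ?_ ?_ hn <;> (try unfold CornV) <;> dsimp only <;> omega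
    · refine hNN S hS ⟨hs, hs'⟩ _ _ ?_ ?_ hn <;> (try unfold CornV) <;> dsimp only <;> omega
  have hNL' : ∀ S ∈ L, ∀ v, CornV S v → Nl' v := by
    rintro S hS v ⟨a1, a2, a3, a4⟩
    have := hLb S hS
    refine hNL S hS _ ?_
    unfold CornV; dsimp only; omega
  have hrow : ∀ b, (h1 ≤ b ∨ b ≤ -h1) → ∀ a a', Nl' (a, b) → Nl' (a', b) := by
    intro b hb
    have st : ∀ a, Nl' (a, b) ↔ Nl' (a + 1, b) := by
      intro a
      rcases hb with hb | hb
      · constructor <;> refine hNN' (a, b) (hO _ ?_) _ _ ?_ ?_ <;> (try unfold CornV) <;> dsimp only <;> omega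
      · constructor <;> refine hNN' (a, b - 1) (hO _ ?_) _ _ ?_ ?_ <;> (try unfold CornV) <;> dsimp only <;> omega
    intro a a' ha
    exact path_ind a (P := fun a' => Nl' (a', b)) ha st a'
  have key : ∀ E : Set (ℝ × ℝ), (∀ p ∈ E, ∃ S ∈ N, p ∈ sq 1 S ∧ ¬ Nl' S) → Convex ℝ E → (∃ e ∈ E, tr Q e ∈ E ∧ G e ∈ E) → False := by
    rintro E hE hEc ⟨e, he, he1, he2⟩
    refine h6core hG h3 hN (Nl := Nl') (fun n v => hP n (v.1, max (-h) (min h v.2))) h00 hNN' hNL' c1 hE hEc.isPreconnected he he1 he2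
  obtain ⟨R', hR'⟩ := ends h1
  rintro v (hv | hv)
  · by_contra hn
    have hn' : ¬ Nl' v := by
      simp only [Nl']
      rwa [show max (-h) (min h v.2) = v.2 by omega]
    have hcol : ∀ b, h1 ≤ b → (Nl' (0, b) ↔ Nl' (0, h1)) := by
      intro b hb
      induction b, hb using Int.le_induction with
      | base => rfl
      | succ b hb ih =>
        rw [← ih]
        constructor <;> refine hNN' (0, b) (hO _ ?_) _ _ ?_ ?_ <;> (try unfold CornV) <;> dsimp only <;> omega
    refine key {p | (h1 : ℝ) ≤ p.2} ?_ ((convex_Ici (𝕜 := ℝ) (h1 : ℝ)).is_linear_preimage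
      (f := fun p : ℝ × ℝ => p.2) ⟨fun _ _ => rfl, fun _ _ => rfl⟩) ⟨(0, max R' h1), le_max_right R' (h1 : ℝ), le_max_right R' (h1 : ℝ),
        (hR' _).1 (le_max_left _ _)⟩
    intro p hp
    have h5 : h1 ≤ ⌊((1:ℤ):ℝ) * p.2⌋ := by
      rw [Int.le_floor]; push_cast; rw [one_mul]; exact hp
    refine ⟨_, hO _ (Or.inl h5), sq_ex 1 p, fun hc => hn' ?_⟩
    refine hrow _ (Or.inl hv.1) 0 _ ((hcol _ hv.1).2 ((hcol _ h5).1 (hrow _ (Or.inl h5) _ 0 hc)))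
  · by_contra hn
    have hn' : ¬ Nl' v := by
      simp only [Nl']
      rwa [show max (-h) (min h v.2) = v.2 by omega]
    have hcol : ∀ b, b ≤ -h1 → (Nl' (0, b) ↔ Nl' (0, -h1)) := by
      intro b hb
      induction b, hb using Int.le_induction_down with
      | base => rfl
      | pred b hb ih =>
        rw [← ih]
        constructor <;> refine hNN' (0, b - 1) (hO _ ?_) _ _ ?_ ?_ <;> (try unfold CornV) <;> dsimp only <;> omega
    refine key {p | p.2 ≤ (-h1 : ℝ)} ?_ ((convex_Iic (𝕜 := ℝ) (-h1 : ℝ)).is_linear_preimage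
      (f := fun p : ℝ × ℝ => p.2) ⟨fun _ _ => rfl, fun _ _ => rfl⟩) ⟨(0, min (-R') (-h1)), min_le_right (-R') (-h1 : ℝ), min_le_right (-R') (-h1 : ℝ),
        (hR' _).2 (min_le_left _ _)⟩
    intro p hp
    have h5 : ⌈p.2⌉ ≤ -h1 := by
      rw [Int.ceil_le]; push_cast; exact hp
    have h6 : p ∈ sq 1 (⌊((1:ℤ):ℝ) * p.1⌋, ⌈p.2⌉ - 1) := by
      refine ⟨(sq_ex 1 p).1, (sq_ex 1 p).2.1, ?_, ?_⟩
      · push_cast; rw [one_mul]; linarith [Int.ceil_lt_add_one p.2]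
      · push_cast; rw [one_mul]; linarith [Int.le_ceil p.2]
    refine ⟨_, hO _ (Or.inr ?_), h6, fun hc => hn' ?_⟩
    · dsimp only; omega
    exact hrow _ (Or.inr hv.2) 0 _ ((hcol _ hv.2).2 ((hcol _ (by omega)).1 (hrow _ (Or.inr (by omega)) _ 0 hc)))

theorem no_closed_all {Q : ℝ} (hQ : 0 < Q) {G : ℝ × ℝ → ℝ × ℝ} (hG : Continuous G) (hT : Equi Q G) (H : ℝ)
    (hP : ∀ n, 1 ≤ n → ∀ (p : ℤ) z, G^[n] z ≠ tr (p * Q) z) (R : ℕ) :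
    ∃ ε > 0, ∀ n, 1 ≤ n → n ≤ R → ∀ z, |z.2| ≤ H → ∀ p : ℤ, ¬ PO G ε n z (tr (p * Q) z) := by
  induction R with
  | zero => exact ⟨1, one_pos, fun n h1 h2 => by omega⟩
  | succ R ih =>
    obtain ⟨e1, he1, h1⟩ := ih
    obtain ⟨e2, he2, h2⟩ := no_closed hQ hG hT H (R + 1) (hP _ (by omega))
    refine ⟨min e1 e2, by positivity, fun n hn hn' z hz p hpo => ?_⟩
    rcases Nat.lt_or_ge n (R + 1) with h | h
    · exact h1 n hn (by omega) z hz p (PO_mono (min_le_left _ _) hpo)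
    · obtain rfl : n = R + 1 := by omega
      exact h2 z hz p (PO_mono (min_le_right _ _) hpo)

theorem rho_ex {Q : ℝ} (hQ : 0 < Q) {G : ℝ × ℝ → ℝ × ℝ} (hG : Continuous G) (hT : Equi Q G)
    (ends : ∀ R : ℝ, ∃ R', ∀ p : ℝ × ℝ, (R' ≤ p.2 → R ≤ (G p).2) ∧ (p.2 ≤ -R' → (G p).2 ≤ -R)) (r0 : ℤ) :
    ∃ ρ : ℕ → ℤ, ρ 0 = r0 ∧ (∀ i, ρ i + 1 ≤ ρ (i + 1)) ∧
    (∀ i (p : ℝ × ℝ), |p.2| ≤ ρ i + 1 → |(G p).2| ≤ ρ (i + 1) - 1) ∧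
    (∀ i (p : ℝ × ℝ), (ρ (i + 1) : ℝ) - 1 ≤ p.2 → (ρ i : ℝ) + 1 ≤ (G p).2) ∧
    (∀ i (p : ℝ × ℝ), p.2 ≤ -((ρ (i + 1) : ℝ) - 1) → (G p).2 ≤ -((ρ i : ℝ) + 1)) := by
  have : ∀ r : ℤ, ∃ r' : ℤ, r + 1 ≤ r' ∧ (∀ (p : ℝ × ℝ), |p.2| ≤ r + 1 → |(G p).2| ≤ r' - 1) ∧
    (∀ (p : ℝ × ℝ), (r' : ℝ) - 1 ≤ p.2 → (r : ℝ) + 1 ≤ (G p).2) ∧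
    (∀ (p : ℝ × ℝ), p.2 ≤ -((r' : ℝ) - 1) → (G p).2 ≤ -((r : ℝ) + 1)) := by
    intro r
    obtain ⟨a, ha⟩ := bdd hQ hG hT (r + 1)
    obtain ⟨b, hb⟩ := ends (r + 1)
    have e1 := Int.le_ceil a
    have e2 := Int.le_ceil b
    have e3 : ((⌈a⌉ : ℤ) : ℝ) ≤ (max ⌈a⌉ (max ⌈b⌉ r) : ℤ) := by exact_mod_cast le_max_left _ _
    have e4 : ((⌈b⌉ : ℤ) : ℝ) ≤ (max ⌈a⌉ (max ⌈b⌉ r) : ℤ) := by exact_mod_cast (by omega)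
    refine ⟨max ⌈a⌉ (max ⌈b⌉ r) + 1, by omega, fun p hp => (ha p hp).trans ?_, fun p hp => (hb p).1 ?_, fun p hp => (hb p).2 ?_⟩
    all_goals rw [Int.cast_add, Int.cast_one] at *; linarith
  choose f hf using this
  refine ⟨fun i => f^[i] r0, rfl, ?_, ?_, ?_, ?_⟩ <;> intro i <;> simp only [Function.iterate_succ_apply']
  · exact (hf _).1
  · exact (hf _).2.1
  · exact (hf _).2.2.1
  · exact (hf _).2.2.2
end Mob

namespace Mob
open Set

theorem partD (G : ℝ × ℝ ≃ₜ ℝ × ℝ) (Q h1 : ℤ) (m : ℕ) {δ0 : ℝ} (hd : 0 < δ0) (N V : Set (ℤ × ℤ)) (hQ : 0 < Q) (hh1 : 0 < h1)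
    (hT : Equi Q G) (ends : ∀ R : ℝ, ∃ R', ∀ p : ℝ × ℝ, (R' ≤ p.2 → R ≤ (G p).2) ∧ (p.2 ≤ -R' → (G p).2 ≤ -R))
    (P1 : ∀ n, 1 ≤ n → ∀ (p : ℤ) z, G^[n] z ≠ tr (p * Q) z) (P3a : P3 Q G) (P3b : P3 Q G.symm)
    (hVN : V ⊆ N) (hN : ∀ n (S : ℤ × ℤ), (S.1 + n * Q, S.2) ∈ N ↔ S ∈ N) (hV : ∀ n (S : ℤ × ℤ), (S.1 + n * Q, S.2) ∈ V ↔ S ∈ V)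
    (hO : ∀ S : ℤ × ℤ, h1 ≤ S.2 ∨ S.2 < -h1 → S ∈ V) (h00 : (0, 0) ∉ N)
    (c1 : ∀ S ∈ V, ∀ S', Arr G δ0 S S' → S' ∈ N) (c2 : ∀ S ∈ N, S ∉ V → ∀ S', Arr G δ0 S S' → S' ∉ V)
    (c3 : ∀ A B C, CW G δ0 V m A B → CW G δ0 V m B C → h1 + 1 ≤ B.2 ∨ B.2 ≤ -h1 - 2) : False := by
  have hQ' : (0 : ℝ) < Q := by exact_mod_cast hQ
  obtain ⟨ρ, hρ0, hρ, r1, r2, r3⟩ := rho_ex hQ' G.continuous hT ends (h1 + 2)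
  have mono : Monotone ρ := monotone_nat_of_le_succ (fun i => by have := hρ i; omega)
  have hρp : ∀ i, h1 + 2 ≤ ρ i := fun i => hρ0 ▸ mono (Nat.zero_le i)
  set R := (2 * Q * (4 * h1 + 1)).toNat
  set M' := m + R with hM'
  obtain ⟨ε', he', hnc⟩ := no_closed_all hQ' G.continuous hT (ρ 0) P1 R
  obtain ⟨k, φ, hk, f1, f2, S1, S3, S2p, S2n, S8⟩ := phi_ex hQ G.continuous hT (M' + 1) ρ (fun i => by have := hρp i; omega) hρ r1 r2 r3
    (lt_min hd he')
  have km : ∀ {i j}, i ≤ j → k * ρ i ≤ k * ρ j := fun hij => mul_le_mul_of_nonneg_left (mono hij) hk.le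
  have k0 : ∀ i, k * h1 < k * ρ i := fun i => mul_lt_mul_of_pos_left (by have := hρp i; omega) hk
  have kh : 0 < k * h1 := by positivity
  set h := ρ (M' + 1 + 1) with hh
  set L := N \ V with hL
  have hLb : ∀ S ∈ L, -h1 ≤ S.2 ∧ S.2 < h1 := fun S hS => by
    by_contra hc; exact hS.2 (hO S (by omega))
  have hON := fun S hS => hVN (hO S hS)
  have vc : ∀ x ∈ Vc k h N L, ∃ S ∈ V, InSq k S x := by
    rintro x ⟨⟨_, S, hS, hx⟩, hl⟩
    refine ⟨S, ?_, hx⟩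
    by_contra hc; exact hl ⟨S, ⟨hS, hc⟩, hx⟩
  have arr : ∀ x y S S', |x.2| ≤ 2 * (k * ρ (M' + 1)) → cM φ (sg x) y ≠ 0 → InSq k S x → InSq k S' y → Arr G δ0 S S' :=
    fun x y S S' h1 h2 h3 h4 => ⟨_, ct_sq hk h3, _, ct_sq hk h4, (S1 x y h1 h2).trans (min_le_left _ _)⟩
  have low : ∀ S ∈ L, ∀ x, InSq k S x → |x.2| ≤ 2 * (k * h1) := by
    rintro S hS x ⟨_, _, a, b⟩
    have := hLb S hS
    rw [abs_le]
    constructor <;> nlinarith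
  have hiB : ∀ y ∈ Bd k h, 2 * (k * h1) < |y.2| → y ∈ Ns k h N := fun y hy h5 => by
    refine hi_N hk hON hy ?_
    rcases lt_abs.1 h5 with h | h
    · exact Or.inl h.le
    · exact Or.inr (by omega)
  have bck : ∀ n j x y B, WalkV (cM φ) (Vc k h N L) n x y → |y.2| ≤ 2 * (k * ρ j) → j + n ≤ M' + 1 → InSq k B y → B ∈ V →
      ∃ A, CW G δ0 V n A B := by
    intro n
    induction n with
    | zero => exact fun j x y B _ _ _ _ hB => ⟨B, rfl, hB⟩
    | succ n ih =>
      rintro j x y B ⟨z, hz, hzy, -⟩ hy hj hB hBV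
      have hzj : |z.2| ≤ 2 * (k * ρ (j + 1)) := by
        by_contra hc
        rw [abs_le] at hy
        rcases lt_abs.1 (not_le.1 hc) with h | h
        · have := S2p j (by omega) z y h.le hzy; omega
        · have := S2n j (by omega) z y (by omega) hzy; omega
      have hzV : z ∈ Vc k h N L := by
        cases n with
        | zero => exact hz.1 ▸ hz.2
        | succ n => exact hz.choose_spec.2.2
      obtain ⟨S, hS, hSz⟩ := vc z hzV
      obtain ⟨A, hA⟩ := ih (j + 1) x z S hz hzj (by omega) hSz hS
      refine ⟨A, S, hA, arr z y S B (hzj.trans ?_) hzy hSz hB, hBV⟩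
      have := km (show j + 1 ≤ M' + 1 by omega); omega
  have fwd : ∀ n e y B, WalkV (cM φ) (Vc k h N L) n e y → |e.2| ≤ 2 * (k * ρ 0) → n ≤ M' + 1 → InSq k B e → B ∈ V →
      ∃ C, InSq k C y ∧ CW G δ0 V n B C ∧ |y.2| ≤ 2 * (k * ρ n) := by
    intro n
    induction n with
    | zero => rintro e y B ⟨rfl, _⟩ h1 h2 h3 h4; exact ⟨B, h3, ⟨rfl, h4⟩, h1⟩
    | succ n ih =>
      rintro e y B ⟨z, hz, hzy, hyV⟩ he hn hB hBV
      obtain ⟨S, hS, hBS, hzn⟩ := ih e z B hz he (by omega) hB hBV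
      obtain ⟨C, hC, hCy⟩ := vc y hyV
      refine ⟨C, hCy, ⟨S, hBS, arr z y S C (hzn.trans ?_) hzy hS hCy, hC⟩, S3 n (by omega) z y hzn hzy⟩
      have := km (show n ≤ M' + 1 by omega); omega
  have wpo : ∀ n e y, Walk (cM φ) n e y → |e.2| ≤ 2 * (k * ρ 0) → n ≤ M' + 1 → PO G ε' n (ct k e) (ct k y) ∧ |y.2| ≤ 2 * (k * ρ n) := by
    intro n
    induction n with
    | zero => rintro e y rfl he _; exact ⟨rfl, he⟩
    | succ n ih =>
      rintro e y ⟨z, hz, hzy⟩ he hn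
      obtain ⟨h1, h2⟩ := ih e z hz he (by omega)
      refine ⟨⟨_, h1, (S1 z y (h2.trans ?_) hzy).trans (min_le_right _ _)⟩, S3 n (by omega) z y h2 hzy⟩
      have := km (show n ≤ M' + 1 by omega); omega
  have k0' : ∀ i, 2 * (k * h1) ≤ 2 * (k * ρ i) := fun i => by have := k0 i; omega
  refine partC Q k h h1 m N L φ hQ hk hh1 (by have := hρp (M' + 1 + 1); omega) hN ?_ hLb hON f1 f2 ?_ ?_ ?_ ?_ ?_ ?_ ?_
  · intro n S; rw [hL, mem_diff, mem_diff, hN, hV]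
  · intro x hx
    rw [mem_spt]
    intro y hy
    have hyB : y ∈ Bd k h := by
      have := cM_row hy fun v _ => f2 v
      exact ⟨by omega, this.2⟩
    rcases le_or_gt |x.2| (2 * (k * ρ (M' + 1))) with hc | hc
    · obtain ⟨S, hS, hSx⟩ := vc x hx
      exact ⟨hyB, _, c1 S hS _ (arr x y S _ hc hy hSx (sq_exists hk y)), sq_exists hk y⟩
    · refine hiB y hyB ?_
      have := k0 M'
      rcases lt_abs.1 hc with h | h
      · have := S2p M' (by omega) x y h.le hy; rw [lt_abs]; omega
      · have := S2n M' (by omega) x y (by omega) hy; rw [lt_abs]; omega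
  · rintro x ⟨S, hS, hSx⟩ e he
    by_contra hc
    obtain ⟨S', hS', hSe⟩ := vc e he
    exact c2 S hS.1 hS.2 S' (arr x e S S' ((low S hS x hSx).trans (k0' _)) hc hSx hSe) hS'
  · intro x e y hx hy
    by_contra hc
    have he : |e.2| ≤ 2 * (k * h1) := by rw [abs_le]; omega
    have heV : e ∈ Vc k h N L := by
      cases m with
      | zero => exact hx.1 ▸ hx.2
      | succ n => exact hx.choose_spec.2.2
    obtain ⟨B, hB, hBe⟩ := vc e heV
    obtain ⟨A, hA⟩ := bck m 0 x e B hx (he.trans (k0' _)) (by omega) hBe hB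
    obtain ⟨C, -, hC, -⟩ := fwd m e y B hy (he.trans (k0' _)) (by omega) hBe hB
    rw [abs_le] at he
    obtain ⟨_, _, a, b⟩ := hBe
    rcases c3 A B C hA hC with h | h <;> nlinarith
  · intro n hn hnR e he p hw
    rcases le_or_gt |e.2| (2 * (k * h1)) with hc | hc
    · exfalso
      have hw := (wpo n e _ hw (hc.trans (k0' _)) (by omega)).1
      have hk' : (0 : ℝ) < k := by exact_mod_cast hk
      have e1 : ct k (sh (p * (Q * k)) e) = tr (p * Q) (ct k e) := by
        simp only [ct, sh, tr]; push_cast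
        ext
        · dsimp only; field_simp
        · rfl
      rw [e1] at hw
      refine hnc n hn hnR _ ?_ p hw
      simp only [ct]
      have hc' : (|(e.2 : ℝ)|) ≤ 2 * (k * ρ 0) := by exact_mod_cast hc.trans (k0' 0)
      rw [abs_div, abs_of_pos (show (0 : ℝ) < 2 * k by positivity), div_le_iff₀ (by positivity)]
      linarith
    · refine ⟨hiB e he hc, ?_⟩
      rintro ⟨S, hS, hx⟩
      have := low S hS e hx
      omega
  · intro x hx
    rw [mem_spt]
    intro y hy
    have := S8 x y hx hy
    have h5 := k0 (M' + 1)
    refine hiB y ⟨?_, this.2⟩ ?_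
    · have := k0 (M' + 1 + 1); omega
    · rw [lt_abs]; omega
  · intro Nl n1 n2 n3
    refine h6 hh1 (by have := hρp (M' + 1 + 1); omega) G.continuous P3a ends hN hLb hON n1 h00 n2 n3 ?_
    intro S hS hSL p hp S' hS'
    refine c1 S ?_ S' ⟨p, hp, _, hS', by simpa using hd.le⟩
    by_contra hc; exact hSL ⟨hS, hc⟩
  · intro Z z1 z2 z3 z4
    obtain ⟨R', hR'⟩ := ends h
    refine h7core hk hh1 (by have := hρp (M' + 1 + 1); omega) P3b hLb hON ?_ ⟨G (0, max R' h), (hR' _).1 (le_max_left _ _), ?_⟩ Z z1 z2 z3 z4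
    · intro S hS p hp S' hS' hSL' hc
      refine c2 S hS.1 hS.2 S' ⟨p, hp, _, hc, by simpa using hd.le⟩ ?_
      by_contra hc; exact hSL' ⟨hS', hc⟩
    · rw [G.symm_apply_apply]; exact le_max_right _ _
end Mob

namespace Mob
open Set

/-- approximate step relation (symmetric under inversion of `g`) -/
def AS (g : ℝ × ℝ → ℝ × ℝ) (ε : ℝ) (z w : ℝ × ℝ) : Prop := ∃ u, dist u z ≤ ε ∧ dist (g u) w ≤ ε
/-- approximate orbit of length `n` from `z` staying in `|y| ≥ 2` -/
def WP (g : ℝ × ℝ → ℝ × ℝ) (ε : ℝ) : ℕ → ℝ × ℝ → Prop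
  | 0, z => 2 ≤ |z.2|
  | n + 1, z => 2 ≤ |z.2| ∧ ∃ w, AS g ε z w ∧ WP g ε n w
/-- coarse orbit of length `n` from `S` staying in `J` -/
def WC (r : ℤ × ℤ → ℤ × ℤ → Prop) (J : Set (ℤ × ℤ)) : ℕ → ℤ × ℤ → Prop
  | 0, S => S ∈ J
  | n + 1, S => S ∈ J ∧ ∃ S', r S S' ∧ WC r J n S'

theorem WP_mono {g ε ε'} (h : ε ≤ ε') {n z} (hp : WP g ε n z) : WP g ε' n z := by
  induction n generalizing z with
  | zero => exact hp
  | succ n ih =>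
    obtain ⟨h1, w, ⟨u, hu, hu'⟩, h2⟩ := hp
    exact ⟨h1, w, ⟨u, hu.trans h, hu'.trans h⟩, ih h2⟩

theorem snd_dist (a b : ℝ × ℝ) : |a.2 - b.2| ≤ dist a b := by
  rw [← Real.dist_eq]; exact le_max_right _ _

theorem WP_orb {Q : ℝ} (hQ : 0 < Q) {g : ℝ × ℝ → ℝ × ℝ} (hG : Continuous g) (hT : Equi Q g) (H : ℝ) (n : ℕ) :
    ∃ ε > 0, ∀ z z', |z.2| ≤ H → dist z z' ≤ ε → WP g ε n z' → ∀ i ≤ n, 1 ≤ |(g^[i] z).2| := by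
  have base : ∀ z z' : ℝ × ℝ, dist z z' ≤ 1 → 2 ≤ |z'.2| → 1 ≤ |z.2| := fun z z' h1 h2 => by
    have := snd_dist z z'
    have := abs_sub_abs_le_abs_sub z'.2 z.2
    rw [abs_sub_comm] at this
    linarith
  induction n generalizing H with
  | zero =>
    refine ⟨1, one_pos, fun z z' _ h1 h2 i hi => ?_⟩
    obtain rfl : i = 0 := by omega
    exact base z z' h1 h2
  | succ n ih =>
    obtain ⟨H', hH'⟩ := bdd hQ hG hT H
    obtain ⟨e1, he1, h1⟩ := ih H'
    obtain ⟨δ, hd, hu⟩ := uc hQ hG hT H (half_pos he1)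
    refine ⟨min 1 (min (e1 / 2) (δ / 3)), by positivity, fun z z' hz hzz hw i hi => ?_⟩
    have a1 := min_le_left (1 : ℝ) (min (e1 / 2) (δ / 3))
    have a2 := (min_le_right (1 : ℝ) (min (e1 / 2) (δ / 3))).trans (min_le_left _ _)
    have a3 := (min_le_right (1 : ℝ) (min (e1 / 2) (δ / 3))).trans (min_le_right _ _)
    obtain ⟨b1, w, ⟨u, b2, b3⟩, b4⟩ := hw
    cases i with
    | zero => exact base z z' (hzz.trans a1) b1
    | succ i =>
      have c1 : dist z u < δ := by
        have := dist_triangle z z' u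
        rw [dist_comm z' u] at this
        linarith
      have c2 := hu z u hz c1
      have c3 := dist_triangle (g z) (g u) w
      rw [Function.iterate_succ_apply]
      exact h1 (g z) w (hH' z hz) (by linarith) (WP_mono (by linarith) b4) i (by omega)

theorem WC_mono {r J n S} (h : WC r J (n + 1) S) : WC r J n S := by
  induction n generalizing S with
  | zero => exact h.1
  | succ n ih => obtain ⟨h1, S', h2, h3⟩ := h; exact ⟨h1, S', h2, ih h3⟩

theorem WC_step {r J n S S'} (hS : S ∈ J) (h : r S S') (h' : WC r J n S') : WC r J n S := WC_mono (n := n) ⟨hS, S', h, h'⟩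

theorem WC_reach {r J n S o} (h : Relation.ReflTransGen (fun S S' => r S S' ∧ S ∈ J ∧ S' ∈ J) S o) (ho : WC r J n o) : WC r J n S := by
  induction h using Relation.ReflTransGen.head_induction_on with
  | refl => exact ho
  | head h _ ih => exact WC_step h.2.1 h.1 ih

theorem WC_WP {r : ℤ × ℤ → ℤ × ℤ → Prop} {J : Set (ℤ × ℤ)} {g ε} (c : ℤ × ℤ → ℝ × ℝ) (hr : ∀ S S', r S S' → AS g ε (c S) (c S'))
    (hJ : ∀ S ∈ J, 2 ≤ |(c S).2|) {n S} (h : WC r J n S) : WP g ε n (c S) := by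
  induction n generalizing S with
  | zero => exact hJ S h
  | succ n ih => obtain ⟨h1, S', h2, h3⟩ := h; exact ⟨hJ S h1, _, hr _ _ h2, ih h3⟩

theorem WC_orb {r : ℤ × ℤ → ℤ × ℤ → Prop} {J : Set (ℤ × ℤ)} {G : ℝ × ℝ → ℝ × ℝ} {K : Set (ℝ × ℝ)} (hr : ∀ p S S', p ∈ sq 1 S → G p ∈ sq 1 S' → r S S')
    (hJ : ∀ p S, p ∈ sq 1 S → p ∈ K → S ∈ J) {n S p} (hp : p ∈ sq 1 S) (h : ∀ i ≤ n, G^[i] p ∈ K) : WC r J n S := by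
  induction n generalizing S p with
  | zero => exact hJ p S hp (h 0 le_rfl)
  | succ n ih =>
    exact ⟨hJ p S hp (h 0 (by omega)), _, hr p S _ hp (sq_ex 1 (G p)), ih (sq_ex 1 (G p)) fun i hi => h (i + 1) (by omega)⟩

theorem CW_B {G δ V J} (hV : V ⊆ J) {n A B} (h : CW G δ V n A B) : WC (fun S S' => Arr G δ S' S) J n B := by
  induction n generalizing B with
  | zero => exact h.1 ▸ hV h.2
  | succ n ih => obtain ⟨z, h1, h2, h3⟩ := h; exact ⟨hV h3, z, h2, ih h1⟩

theorem CW_F {G δ V J} (hV : V ⊆ J) {n B C} (h : CW G δ V n B C) : WC (Arr G δ) J n B := by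
  have tl : ∀ n x y, CW G δ V (n + 1) x y → ∃ z, x ∈ V ∧ Arr G δ x z ∧ CW G δ V n z y := by
    intro n
    induction n with
    | zero => rintro x y ⟨z, ⟨rfl, h1⟩, h2, h3⟩; exact ⟨y, h1, h2, rfl, h3⟩
    | succ n ih =>
      rintro x y ⟨z, h1, h2, h3⟩
      obtain ⟨w, a, b, c⟩ := ih x z h1
      exact ⟨w, a, b, z, c, h2, h3⟩
  induction n generalizing B with
  | zero => exact hV h.2
  | succ n ih => obtain ⟨z, h1, h2, h3⟩ := tl n B C h; exact ⟨hV h1, z, h2, ih h3⟩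

theorem prop_iter {Q : ℝ} (hQ : 0 < Q) (g : ℝ × ℝ ≃ₜ ℝ × ℝ) (hT : Equi Q g.symm) (R : ℝ) (n : ℕ) :
    ∃ R1, ∀ z : ℝ × ℝ, R1 ≤ |z.2| → ∀ i ≤ n, R ≤ |(g^[i] z).2| := by
  induction n with
  | zero => exact ⟨R, fun z hz i hi => by obtain rfl : i = 0 := by omega
                                          exact hz⟩
  | succ n ih =>
    obtain ⟨R1, h1⟩ := ih
    obtain ⟨H, hH⟩ := bdd hQ (g.symm.continuous.iterate (n + 1)) (hT.iter (n + 1)) R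
    refine ⟨max R1 (H + 1), fun z hz i hi => ?_⟩
    rcases Nat.lt_or_ge n i with h | h
    · obtain rfl : i = n + 1 := by omega
      by_contra hc
      have := hH _ (not_le.1 hc).le
      rw [Function.LeftInverse.iterate g.symm_apply_apply] at this
      linarith [le_max_right R1 (H + 1)]
    · exact h1 z ((le_max_left _ _).trans hz) i h
end Mob

namespace Mob
open Set

noncomputable def sc (q : ℤ) (hq : (q : ℝ) ≠ 0) : ℝ × ℝ ≃ₜ ℝ × ℝ := (Homeomorph.mulLeft₀ (q : ℝ) hq).prodCongr (Homeomorph.mulLeft₀ (q : ℝ) hq)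
theorem sc_apply (q : ℤ) (hq) (z) : sc q hq z = (q * z.1, q * z.2) := rfl
theorem sc_tr (q : ℤ) (hq) (a z) : sc q hq (tr a z) = tr (q * a) (sc q hq z) := by
  simp only [sc_apply, tr]; rw [mul_add]

theorem P3_conj {q : ℤ} (hq : (q : ℝ) ≠ 0) {F F' : ℝ × ℝ → ℝ × ℝ} (h : ∀ z, F' (sc q hq z) = sc q hq (F z)) (h3 : P3 2 F) :
    P3 (q * 2) F' := by
  intro X hX hT hne hu hs
  have e : ∀ p, sc q hq (tr (2 : ℤ) p) ∈ X ↔ sc q hq p ∈ X := fun p => by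
    rw [sc_tr, ← hT (sc q hq p)]; push_cast; rfl
  refine h3 (sc q hq ⁻¹' X) (hX.preimage (sc q hq).continuous) e ?_ ?_ ?_
  · obtain ⟨x, hx⟩ := hne
    exact ⟨(sc q hq).symm x, by simpa using hx⟩
  · intro hc; apply hu
    rw [eq_univ_iff_forall] at hc ⊢
    intro x
    simpa using hc ((sc q hq).symm x)
  · rintro _ ⟨p, hp, rfl⟩
    rw [← Homeomorph.preimage_interior, mem_preimage, ← h]
    exact hs ⟨_, hp, rfl⟩

theorem AS_symm {g : ℝ × ℝ ≃ₜ ℝ × ℝ} {ε z w} (h : AS g ε z w) : AS g.symm ε w z := by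
  obtain ⟨u, h1, h2⟩ := h
  exact ⟨g u, h2, by rwa [g.symm_apply_apply]⟩

theorem coarse_hi {g : ℝ × ℝ ≃ₜ ℝ × ℝ} (hT : Equi 2 g) (hT' : Equi 2 g.symm) {R : ℝ} {m : ℕ}
    (hm : ∀ z, (∀ i ≤ m, 1 ≤ |(g^[i] z).2| ∧ 1 ≤ |(g.symm^[i] z).2|) → R < |z.2|) :
    ∃ ε > 0, ∀ ε' ≤ ε, ∀ z, WP g ε' m z → WP g.symm ε' m z → R < |z.2| := by
  obtain ⟨e1, he1, h1⟩ := WP_orb two_pos g.continuous hT R m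
  obtain ⟨e2, he2, h2⟩ := WP_orb two_pos g.symm.continuous hT' R m
  refine ⟨min e1 e2, lt_min he1 he2, fun ε' he z hz hz' => ?_⟩
  by_contra hc
  push Not at hc
  refine hc.not_gt (hm z fun i hi => ⟨?_, ?_⟩)
  · exact h1 z z hc (by simpa using he1.le) (WP_mono (he.trans (min_le_left _ _)) hz) i hi
  · exact h2 z z hc (by simpa using he2.le) (WP_mono (he.trans (min_le_right _ _)) hz') i hi

theorem arr_per {G : ℝ × ℝ → ℝ × ℝ} {Q : ℤ} (hT : Equi Q G) {δ} (n : ℤ) {S S' : ℤ × ℤ} (h : Arr G δ S S') :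
    Arr G δ (S.1 + n * Q, S.2) (S'.1 + n * Q, S'.2) := by
  have hs : ∀ p S, p ∈ sq 1 S → tr (n * Q) p ∈ sq 1 (S.1 + n * Q, S.2) := by
    rintro p S ⟨h1, h2, h3, h4⟩
    refine ⟨?_, ?_, h3, h4⟩ <;> simp only [tr] <;> push_cast at * <;> linarith
  obtain ⟨p, hp, p', hp', hd⟩ := h
  exact ⟨_, hs _ _ hp, _, hs _ _ hp', by rwa [hT.int, tr_dist]⟩

theorem partE (g : ℝ × ℝ ≃ₜ ℝ × ℝ) (hT : Equi 2 g) (hT' : Equi 2 g.symm)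
    (ends : ∀ R : ℝ, ∃ R', ∀ p : ℝ × ℝ, (R' ≤ p.2 → R ≤ (g p).2) ∧ (p.2 ≤ -R' → (g p).2 ≤ -R))
    (P1 : ∀ n, 1 ≤ n → ∀ (p : ℤ) z, g^[n] z ≠ tr (p * 2) z)
    (P2 : ∀ R : ℝ, ∃ m : ℕ, ∀ z, (∀ i ≤ m, 1 ≤ |(g^[i] z).2| ∧ 1 ≤ |(g.symm^[i] z).2|) → R < |z.2|)
    (P3a : P3 2 g) (P3b : P3 2 g.symm) : False := by
  obtain ⟨R0, hR0⟩ := prop_iter two_pos g hT' 4 1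
  obtain ⟨m0, hm0⟩ := P2 (R0 + 1)
  obtain ⟨R1a, hR1a⟩ := prop_iter two_pos g hT' 3 m0
  obtain ⟨R1b, hR1b⟩ := prop_iter two_pos g.symm hT 3 m0
  obtain ⟨R1, hR1⟩ : ∃ R1 : ℤ, R1a ≤ R1 ∧ R1b ≤ R1 ∧ 3 ≤ R1 := by
    obtain ⟨n, hn⟩ := exists_nat_gt (max R1a (max R1b 3))
    have := max_lt_iff.1 hn
    have h2 := max_lt_iff.1 this.2
    exact ⟨n, by exact_mod_cast this.1.le, by exact_mod_cast h2.1.le, by exact_mod_cast h2.2.le⟩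
  obtain ⟨m, hm⟩ := P2 (R1 + 2)
  obtain ⟨e0, he0, H0⟩ := coarse_hi hT hT' hm0
  obtain ⟨e1, he1, H1⟩ := coarse_hi hT hT' hm
  obtain ⟨q, hq1, hqe0, hqe1⟩ : ∃ q : ℤ, 1 ≤ q ∧ 2 / e0 ≤ q ∧ 2 / e1 ≤ q := by
    obtain ⟨n, hn⟩ := exists_nat_gt (max 1 (max (2 / e0) (2 / e1)))
    have := max_lt_iff.1 hn
    have h2 := max_lt_iff.1 this.2
    exact ⟨n, by exact_mod_cast this.1.le, by exact_mod_cast h2.1.le, by exact_mod_cast h2.2.le⟩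
  have hq1' : (1 : ℝ) ≤ q := by exact_mod_cast hq1
  have hq0 : (0 : ℝ) < q := by linarith
  have hq : (q : ℝ) ≠ 0 := hq0.ne'
  let G : ℝ × ℝ ≃ₜ ℝ × ℝ := (sc q hq).symm.trans (g.trans (sc q hq))
  have hG : ∀ z, G (sc q hq z) = sc q hq (g z) := fun z => by simp [G]
  have hG' : ∀ z, G.symm (sc q hq z) = sc q hq (g.symm z) := fun z => by simp [G]
  have hGi : ∀ n z, G^[n] (sc q hq z) = sc q hq (g^[n] z) := fun n z =>
    ((Function.Semiconj.iterate_right (f := sc q hq) (ga := g) (gb := G) (fun z => (hG z).symm) n) z).symm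
  have hGi' : ∀ n z, G.symm^[n] (sc q hq z) = sc q hq (g.symm^[n] z) := fun n z =>
    ((Function.Semiconj.iterate_right (f := sc q hq) (ga := g.symm) (gb := G.symm) (fun z => (hG' z).symm) n) z).symm
  have hs : ∀ p, ∃ z, sc q hq z = p := (sc q hq).surjective
  have hQ2 : ((q * 2 : ℤ) : ℝ) = q * 2 := by push_cast; rfl
  have hTG : Equi ((q * 2 : ℤ) : ℝ) G := fun p => by
    obtain ⟨z, rfl⟩ := hs p
    rw [hQ2, ← sc_tr, hG, hT, sc_tr, hG]
  have sca : ∀ z, (sc q hq z).2 = q * z.2 := fun z => rfl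
  have hsd : ∀ z w, dist (sc q hq z) (sc q hq w) = q * dist z w := fun z w => by
    simp only [Prod.dist_eq, sc_apply, Real.dist_eq, ← mul_sub, abs_mul, abs_of_pos hq0]
    rw [mul_max_of_nonneg _ _ hq0.le]
  set J : Set (ℤ × ℤ) := {S | 2 * q ≤ S.2 ∨ S.2 < -(2 * q)} with hJ
  have toJ : ∀ p S, p ∈ sq 1 S → 3 * (q : ℝ) ≤ |p.2| → S ∈ J := by
    rintro p S ⟨_, _, h3, h4⟩ hp
    push_cast at h3 h4
    rcases le_abs.1 hp with h | h
    · left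
      have : 2 * (q : ℝ) ≤ S.2 := by linarith
      exact_mod_cast this
    · right
      have : (S.2 : ℝ) < -(2 * q) := by linarith
      exact_mod_cast this
  set h1 := q * R1 with hh1
  set r := Arr G 1 with hr
  set r' : ℤ × ℤ → ℤ × ℤ → Prop := fun S S' => Arr G 1 S' S with hr'
  set O : Set (ℤ × ℤ) := {S | h1 ≤ S.2 ∨ S.2 < -h1} with hO
  have hOJ : O ⊆ J := by
    rintro S (h | h)
    · left; nlinarith [hR1.2.2]
    · right; nlinarith [hR1.2.2]
  let rJ : ℤ × ℤ → ℤ × ℤ → Prop := fun S S' => r S S' ∧ S ∈ J ∧ S' ∈ J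
  let N : Set (ℤ × ℤ) := {S | ∃ o ∈ O, Relation.ReflTransGen rJ o S}
  let V : Set (ℤ × ℤ) := {S | S ∈ N ∧ ∃ o ∈ O, Relation.ReflTransGen rJ S o}
  have hNJ : N ⊆ J := by
    rintro S ⟨o, ho, h⟩
    cases h with
    | refl => exact hOJ ho
    | tail _ h => exact h.2.2
  -- orbits of high points
  let c : ℤ × ℤ → ℝ × ℝ := fun S => (S.1 / q, S.2 / q)
  have hc : ∀ S : ℤ × ℤ, sc q hq (c S) = ((S.1 : ℝ), (S.2 : ℝ)) := fun S => by
    rw [sc_apply]; simp only [c]; ext <;> dsimp only <;> field_simp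
  have hcS : ∀ S, sc q hq (c S) ∈ sq 1 S := fun S => by
    rw [hc]; refine ⟨?_, ?_, ?_, ?_⟩ <;> push_cast <;> linarith
  have hcO : ∀ S ∈ O, (R1 : ℝ) ≤ |(c S).2| := by
    rintro S (h | h)
    · have : (q : ℝ) * R1 ≤ S.2 := by exact_mod_cast h
      rw [le_abs]; left; simp only [c]; rw [le_div_iff₀ hq0]; linarith
    · have : (S.2 : ℝ) < -(q * R1) := by exact_mod_cast h
      rw [le_abs]; right; simp only [c]; rw [← neg_div, le_div_iff₀ hq0]; linarith
  have K3 : ∀ t : ℝ, 3 ≤ |t| → 3 * (q : ℝ) ≤ |q * t| := fun t ht => by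
    rw [abs_mul, abs_of_pos hq0]; nlinarith
  have wO : ∀ S ∈ O, WC r J m0 S ∧ WC r' J m0 S := by
    intro S hS
    constructor
    · refine WC_orb (G := G) (K := {p | 3 * (q : ℝ) ≤ |p.2|}) (fun p S S' h h' => ⟨p, h, _, h', by simp⟩) (fun p S h h' => toJ p S h h') (hcS S) ?_
      intro i hi
      rw [hGi]
      exact K3 _ (hR1a _ (hR1.1.trans (hcO S hS)) i hi)
    · refine WC_orb (G := G.symm) (K := {p | 3 * (q : ℝ) ≤ |p.2|}) (fun p S S' h h' => ⟨_, h', p, h, by simp⟩) (fun p S h h' => toJ p S h h') (hcS S) ?_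
      intro i hi
      rw [hGi']
      exact K3 _ (hR1b _ (hR1.2.1.trans (hcO S hS)) i hi)
  have wV : ∀ S ∈ V, WC r J m0 S ∧ WC r' J m0 S := by
    rintro S ⟨⟨o, ho, h⟩, o', ho', h'⟩
    refine ⟨WC_reach h' (wO o' ho').1, WC_reach (o := o) ?_ (wO o ho).2⟩
    rw [← Relation.reflTransGen_swap] at h
    exact Relation.ReflTransGen.mono (fun a b ⟨h1, h2, h3⟩ => ⟨h1, h3, h2⟩) _ _ h
  have dcS : ∀ z S, sc q hq z ∈ sq 1 S → dist z (c S) ≤ 1 / q := by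
    rintro z S ⟨h1, h2, h3, h4⟩
    rw [le_div_iff₀ hq0, mul_comm, ← hsd, hc, Prod.dist_eq, Real.dist_eq, Real.dist_eq]
    push_cast at h1 h2 h3 h4
    refine max_le ?_ ?_ <;> rw [abs_le] <;> constructor <;> dsimp only <;> linarith
  have rAS : ∀ S S', r S S' → AS g (2 / q) (c S) (c S') := by
    rintro S S' ⟨p, hp, p', hp', hd⟩
    obtain ⟨z, rfl⟩ := hs p
    obtain ⟨w, rfl⟩ := hs p'
    rw [hG, hsd] at hd
    have d1 := dcS z S hp
    have d2 := dcS w S' hp'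
    have d3 : dist (g z) w ≤ 1 / q := by rw [le_div_iff₀ hq0]; linarith
    have e : (2 : ℝ) / q = 1 / q + 1 / q := by ring
    have : 0 < 1 / (q : ℝ) := by positivity
    exact ⟨z, by linarith, by linarith [dist_triangle (g z) w (c S')]⟩
  have hJc : ∀ S ∈ J, 2 ≤ |(c S).2| := by
    rintro S (h | h)
    · have : 2 * (q : ℝ) ≤ S.2 := by exact_mod_cast h
      rw [le_abs]; left; simp only [c]; rw [le_div_iff₀ hq0]; linarith
    · have : (S.2 : ℝ) < -(2 * q) := by exact_mod_cast h
      rw [le_abs]; right; simp only [c]; rw [← neg_div, le_div_iff₀ hq0]; linarith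
  have wP : ∀ n S, WC r J n S → WC r' J n S → WP g (2 / q) n (c S) ∧ WP g.symm (2 / q) n (c S) := fun n S h h' =>
    ⟨WC_WP c rAS hJc h, WC_WP c (fun S S' h => AS_symm (rAS S' S h)) hJc h'⟩
  have b0 : 2 / (q : ℝ) ≤ e0 := (div_le_comm₀ he0 hq0).1 hqe0
  have b1 : 2 / (q : ℝ) ≤ e1 := (div_le_comm₀ he1 hq0).1 hqe1
  have c1 : ∀ S ∈ V, ∀ S', r S S' → S' ∈ N := by
    intro S hS S' h
    have hSJ := hNJ hS.1
    have hS'J : S' ∈ J := by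
      obtain ⟨w1, w2⟩ := wP m0 S (wV S hS).1 (wV S hS).2
      have hi := H0 _ b0 _ w1 w2
      obtain ⟨p, hp, p', hp', hd⟩ := h
      obtain ⟨z, rfl⟩ := hs p
      have d1 := (snd_dist _ _).trans (dcS z S hp)
      have d2 := abs_sub_abs_le_abs_sub (c S).2 z.2
      rw [abs_sub_comm] at d2
      have : 1 / (q : ℝ) ≤ 1 := by rw [div_le_one hq0]; exact hq1'
      have d3 := hR0 z (by linarith) 1 le_rfl
      rw [Function.iterate_one] at d3
      refine toJ p' S' hp' ?_
      rw [hG] at hd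
      have d4 := (snd_dist _ _).trans hd
      have d5 := abs_sub_abs_le_abs_sub (sc q hq (g z)).2 p'.2
      rw [sca, abs_mul, abs_of_pos hq0] at d5
      rw [sca] at d4
      nlinarith
    obtain ⟨o, ho, ho'⟩ := hS.1
    exact ⟨o, ho, ho'.tail ⟨h, hSJ, hS'J⟩⟩
  have hJp : ∀ n (S : ℤ × ℤ), S ∈ J → (S.1 + n * (q * 2), S.2) ∈ J := fun n S h => h
  have hRp : ∀ n (S S' : ℤ × ℤ), Relation.ReflTransGen rJ S S' → Relation.ReflTransGen rJ (S.1 + n * (q * 2), S.2) (S'.1 + n * (q * 2), S'.2) :=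
    fun n S S' h => Relation.ReflTransGen.lift (fun S : ℤ × ℤ => (S.1 + n * (q * 2), S.2))
      (fun a b ⟨h1, h2, h3⟩ => ⟨arr_per hTG n h1, h2, h3⟩) _ _ h
  have hN1 : ∀ n (S : ℤ × ℤ), S ∈ N → (S.1 + n * (q * 2), S.2) ∈ N := fun n S ⟨o, ho, h⟩ =>
    ⟨_, (show (o.1 + n * (q * 2), o.2) ∈ O from ho), hRp n _ _ h⟩
  have hV1 : ∀ n (S : ℤ × ℤ), S ∈ V → (S.1 + n * (q * 2), S.2) ∈ V := fun n S ⟨hN, o, ho, h⟩ =>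
    ⟨hN1 n S hN, _, (show (o.1 + n * (q * 2), o.2) ∈ O from ho), hRp n _ _ h⟩
  have per : ∀ P : Set (ℤ × ℤ), (∀ n (S : ℤ × ℤ), S ∈ P → (S.1 + n * (q * 2), S.2) ∈ P) →
      ∀ n (S : ℤ × ℤ), (S.1 + n * (q * 2), S.2) ∈ P ↔ S ∈ P := fun P hP n S => by
    refine ⟨fun h => ?_, hP n S⟩
    have := hP (-n) _ h
    dsimp only at this
    rwa [show S.1 + n * (q * 2) + -n * (q * 2) = S.1 by ring] at this
  refine partD G (q * 2) h1 m one_pos N V (by omega) (by nlinarith [hR1.2.2]) hTG ?_ ?_ (P3_conj hq hG P3a) (P3_conj hq hG' P3b)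
    (fun S hS => hS.1) (per N hN1) (per V hV1) (fun S hS => ⟨⟨S, hS, .refl⟩, S, hS, .refl⟩) ?_ c1 ?_ ?_
  · intro R
    obtain ⟨R', hR'⟩ := ends (R / q)
    refine ⟨q * R', fun p => ?_⟩
    obtain ⟨z, rfl⟩ := hs p
    rw [hG, sca, sca]
    constructor
    · intro h
      have := (hR' z).1 (le_of_mul_le_mul_left h hq0)
      rwa [div_le_iff₀ hq0, mul_comm] at this
    · intro h
      rw [← mul_neg] at h
      have := (hR' z).2 (le_of_mul_le_mul_left h hq0)
      rw [← neg_div, le_div_iff₀ hq0, mul_comm] at this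
      exact this
  · intro n hn p z' h
    obtain ⟨z, rfl⟩ := hs z'
    rw [hGi, hQ2, show (p : ℝ) * (q * 2) = q * (p * 2) by ring, ← sc_tr] at h
    exact P1 n hn p z ((sc q hq).injective h)
  · intro h
    rcases hNJ h with h | h <;> dsimp only at h <;> omega
  · intro S hS hSV S' h hS'
    obtain ⟨hS'N, o, ho, h'⟩ := hS'
    exact hSV ⟨hS, o, ho, h'.head ⟨h, hNJ hS, hNJ hS'N⟩⟩
  · intro A B C hA hC
    have hVJ : V ⊆ J := fun S hS => hNJ hS.1
    obtain ⟨w1, w2⟩ := wP m B (CW_F hVJ hC) (CW_B hVJ hA)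
    have hi := H1 _ b1 _ w1 w2
    rcases lt_abs.1 hi with h | h
    · left
      simp only [c] at h
      rw [lt_div_iff₀ hq0] at h
      have : (h1 : ℝ) + 1 ≤ B.2 := by rw [hh1]; push_cast; nlinarith
      exact_mod_cast this
    · right
      simp only [c] at h
      rw [← neg_div, lt_div_iff₀ hq0] at h
      have : (B.2 : ℝ) ≤ -h1 - 2 := by rw [hh1]; push_cast; nlinarith
      exact_mod_cast this
end Mob

namespace Mob
open Set Topology

def mpr : ℝ × ℝ → MobiusBand := Quotient.mk mobiusSetoid

noncomputable abbrev msg : ℝ × ℝ ≃ₜ ℝ × ℝ := mobiusSigma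

theorem msg_app (p : ℝ × ℝ) : msg p = (p.1 + 1, -p.2) := rfl
theorem msg_inv (p : ℝ × ℝ) : msg⁻¹ p = (p.1 - 1, -p.2) := by
  rw [Homeomorph.inv_apply, Homeomorph.symm_apply_eq, msg_app]
  simp

theorem zp_equiv {X : Type*} [TopologicalSpace X] (f : X ≃ₜ X) (n : ℤ) (p : X) : (f.toEquiv ^ n) p = (f ^ n) p := by
  let φ : (X ≃ₜ X) →* Equiv.Perm X := ⟨⟨fun f => f.toEquiv, rfl⟩, fun _ _ => rfl⟩
  have := map_zpow φ f n
  exact (congrArg (fun e : Equiv.Perm X => e p) this).symm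

theorem msg_zp (n : ℤ) (p : ℝ × ℝ) : ((msg ^ n) p).1 = p.1 + n ∧ |((msg ^ n) p).2| = |p.2| := by
  induction n using Int.induction_on generalizing p with
  | zero => simp
  | succ n ih =>
    rw [zpow_add_one, Homeomorph.mul_apply]
    obtain ⟨a, b⟩ := ih (msg p)
    rw [a, b, msg_app]
    push_cast
    exact ⟨by ring, abs_neg _⟩
  | pred n ih =>
    rw [zpow_sub_one, Homeomorph.mul_apply]
    obtain ⟨a, b⟩ := ih (msg⁻¹ p)
    rw [a, b, msg_inv]
    push_cast
    exact ⟨by ring, abs_neg _⟩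

theorem msg_two (n : ℤ) (p : ℝ × ℝ) : (msg ^ (2 * n)) p = tr (n * 2) p := by
  rw [zpow_mul]
  have h2 : ∀ p, (msg ^ (2 : ℤ)) p = tr 2 p := fun p => by
    rw [show (2:ℤ) = 1 + 1 by rfl, zpow_add, zpow_one, Homeomorph.mul_apply, msg_app, msg_app, tr]
    ext
    · dsimp only; ring
    · simp
  induction n using Int.induction_on generalizing p with
  | zero => simp [tr]
  | succ n ih =>
    rw [zpow_add_one, Homeomorph.mul_apply, ih, h2, tr_tr]
    congr 1
    push_cast; ring
  | pred n ih =>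
    rw [zpow_sub_one, Homeomorph.mul_apply, ih]
    have : (msg ^ (2:ℤ))⁻¹ p = tr (-2) p := by
      rw [Homeomorph.inv_apply, Homeomorph.symm_apply_eq, h2, tr_tr]
      simp [tr]
    rw [this, tr_tr]
    congr 1
    push_cast; ring

theorem mpr_eq (z w : ℝ × ℝ) : mpr z = mpr w ↔ ∃ n : ℤ, (msg ^ n) z = w := by
  refine (Quotient.eq (r := mobiusSetoid) (x := z) (y := w)).trans ?_
  exact exists_congr fun n => by rw [← zp_equiv]

theorem mpr_sg (n : ℤ) (z : ℝ × ℝ) : mpr ((msg ^ n) z) = mpr z := ((mpr_eq _ _).2 ⟨n, rfl⟩).symm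

theorem mpr_qcov : IsQuotientCoveringMap mpr (Subgroup.zpowers mobiusSigma.toEquiv) where
  toIsQuotientMap := isQuotientMap_quot_mk
  continuous_const_smul := by
    rintro ⟨_, n, rfl⟩
    change Continuous fun x => (mobiusSigma.toEquiv ^ n) x
    simp_rw [zp_equiv]
    exact (mobiusSigma ^ n).continuous
  apply_eq_iff_mem_orbit := by
    intro a b
    rw [eq_comm, mpr_eq]
    constructor
    · rintro ⟨n, rfl⟩
      exact ⟨⟨_, n, rfl⟩, zp_equiv _ _ _⟩
    · rintro ⟨⟨_, n, rfl⟩, h⟩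
      exact ⟨n, (zp_equiv _ _ _).symm.trans h⟩
  disjoint := by
    intro e
    refine ⟨Metric.ball e (1/2), Metric.ball_mem_nhds _ (by norm_num), ?_⟩
    rintro ⟨_, n, rfl⟩ ⟨_, ⟨z, hz, rfl⟩, hw⟩
    have hw' : (mobiusSigma ^ n) z ∈ Metric.ball e (1/2) := by rw [← zp_equiv]; exact hw
    have : n = 0 := by
      have h1 := (max_lt_iff.1 (Prod.dist_eq (α := ℝ) (β := ℝ) ▸ Metric.mem_ball.1 hz)).1
      have h2 := (max_lt_iff.1 (Prod.dist_eq (α := ℝ) (β := ℝ) ▸ Metric.mem_ball.1 hw')).1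
      rw [(msg_zp n z).1, Real.dist_eq, abs_lt] at h2
      rw [Real.dist_eq, abs_lt] at h1
      have a : (n:ℝ) < 1 := by linarith
      have b : (-1:ℝ) < n := by linarith
      norm_cast at a b
      omega
    subst this
    simp

theorem mpr_cov : IsCoveringMap mpr := mpr_qcov.isCoveringMap
theorem mpr_cont : Continuous mpr := mpr_cov.continuous
theorem mpr_open : IsOpenMap mpr := mpr_cov.isLocalHomeomorph.isOpenMap
theorem mpr_surj : Function.Surjective mpr := Quotient.mk_surjective

theorem lift_eq {F F' : ℝ × ℝ → ℝ × ℝ} (h : Continuous F) (h' : Continuous F') (he : ∀ p, mpr (F p) = mpr (F' p))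
    (a) (ha : F a = F' a) : F = F' := mpr_cov.eq_of_comp_eq h h' (funext he) a ha

theorem ex_lift (f : MobiusBand ≃ₜ MobiusBand) (z w : ℝ × ℝ) (h : mpr w = f (mpr z)) :
    ∃ F : ℝ × ℝ → ℝ × ℝ, Continuous F ∧ F z = w ∧ ∀ p, mpr (F p) = f (mpr p) := by
  obtain ⟨F, ⟨h1, h2⟩, -⟩ := mpr_cov.existsUnique_continuousMap_lifts (⟨fun p => f (mpr p), f.continuous.comp mpr_cont⟩ : C(ℝ × ℝ, MobiusBand)) z w h
  exact ⟨F, F.continuous, h1, fun p => congrFun h2 p⟩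

theorem ex_Phi (f : MobiusBand ≃ₜ MobiusBand) : ∃ Φ : ℝ × ℝ ≃ₜ ℝ × ℝ, ∀ p, mpr (Φ p) = f (mpr p) := by
  obtain ⟨w, hw⟩ := mpr_surj (f (mpr 0))
  obtain ⟨F, c, h, hF⟩ := ex_lift f 0 w hw
  obtain ⟨F', c', h', hF'⟩ := ex_lift f.symm w 0 (by rw [hw]; simp)
  refine ⟨⟨⟨F, F', fun p => ?_, fun p => ?_⟩, c, c'⟩, hF⟩
  · exact congrFun (lift_eq (F := F' ∘ F) (F' := id) (c'.comp c) continuous_id (fun p => by simp [hF, hF']) 0 (by simp [h, h'])) p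
  · exact congrFun (lift_eq (F := F ∘ F') (F' := id) (c.comp c') continuous_id (fun p => by simp [hF, hF']) w (by simp [h, h'])) p

theorem semi (f : MobiusBand ≃ₜ MobiusBand) (Φ : ℝ × ℝ ≃ₜ ℝ × ℝ) (h : ∀ p, mpr (Φ p) = f (mpr p)) :
    ∃ e : ℤ, SemiconjBy Φ msg (msg ^ e) := by
  have : mpr (Φ 0) = mpr (Φ (msg 0)) := by
    rw [h, h]; congr 1
    exact (mpr_sg 1 0).symm
  obtain ⟨e, he⟩ := (mpr_eq _ _).1 this
  refine ⟨e, ?_⟩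
  have := lift_eq (F := fun p => Φ (msg p)) (F' := fun p => (msg ^ e) (Φ p)) (by fun_prop) (by fun_prop) (fun p => ?_) 0 he.symm
  · ext1 p
    exact congrFun this p
  · rw [mpr_sg, h, h]; congr 1
    exact mpr_sg 1 p

theorem msg_inj {a b : ℤ} (h : msg ^ a = msg ^ b) : a = b := by
  have := (msg_zp a 0).1
  rw [h, (msg_zp b 0).1] at this
  simpa using this.symm

theorem semi' (f : MobiusBand ≃ₜ MobiusBand) (Φ : ℝ × ℝ ≃ₜ ℝ × ℝ) (h : ∀ p, mpr (Φ p) = f (mpr p)) :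
    ∃ e : ℤ, (e = 1 ∨ e = -1) ∧ SemiconjBy Φ msg (msg ^ e) := by
  obtain ⟨e, he⟩ := semi f Φ h
  obtain ⟨e', he'⟩ := semi f.symm Φ⁻¹ (fun p => by
    rw [Homeomorph.eq_symm_apply, ← h]; simp)
  refine ⟨e, ?_, he⟩
  have h1 : SemiconjBy (Φ * Φ⁻¹) msg ((msg ^ e) ^ e') := (he.zpow_right e').mul_left he'
  rw [mul_inv_cancel, SemiconjBy, one_mul, mul_one, ← zpow_mul] at h1
  have := msg_inj ((zpow_one msg).trans h1)
  exact Int.eq_one_or_neg_one_of_mul_eq_one this.symm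
end Mob

namespace Mob
open Set Topology

theorem Phi_zp (f : MobiusBand ≃ₜ MobiusBand) (Φ : ℝ × ℝ ≃ₜ ℝ × ℝ) (h : ∀ p, mpr (Φ p) = f (mpr p)) (n : ℤ) (p) :
    mpr ((Φ ^ n) p) = (f ^ n) (mpr p) := by
  induction n using Int.induction_on generalizing p with
  | zero => simp
  | succ n ih =>
    rw [zpow_add_one, zpow_add_one, Homeomorph.mul_apply, Homeomorph.mul_apply, ih, h]
  | pred n ih =>
    rw [zpow_sub_one, zpow_sub_one, Homeomorph.mul_apply, Homeomorph.mul_apply, ih]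
    congr 1
    rw [Homeomorph.inv_apply, Homeomorph.inv_apply, Homeomorph.eq_symm_apply, ← h]
    simp

theorem dense_lift (f : MobiusBand ≃ₜ MobiusBand) (Φ : ℝ × ℝ ≃ₜ ℝ × ℝ) (h : ∀ p, mpr (Φ p) = f (mpr p))
    (hd : ∀ q, Dense (Set.range fun n : ℤ => (f.toEquiv ^ n) q)) (z : ℝ × ℝ) (W : Set (ℝ × ℝ)) (hW : IsClosed W)
    (hz : ∀ a n : ℤ, (msg ^ a) ((Φ ^ n) z) ∈ W) : W = univ := by
  have h1 := (hd (mpr z)).preimage mpr_open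
  have h2 : mpr ⁻¹' (Set.range fun n : ℤ => (f.toEquiv ^ n) (mpr z)) ⊆ W := by
    rintro w ⟨n, hn⟩
    dsimp only at hn
    rw [zp_equiv, ← Phi_zp f Φ h] at hn
    obtain ⟨a, rfl⟩ := (mpr_eq _ _).1 hn
    exact hz a n
  have := (h1.mono h2).closure_eq
  rwa [hW.closure_eq] at this

theorem inv_zp {h : ℝ × ℝ ≃ₜ ℝ × ℝ} {B : Set (ℝ × ℝ)} (hB : ∀ p, h p ∈ B ↔ p ∈ B) (n : ℤ) (p) : (h ^ n) p ∈ B ↔ p ∈ B := by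
  induction n using Int.induction_on generalizing p with
  | zero => simp
  | succ n ih =>
    rw [zpow_add_one, Homeomorph.mul_apply, ih, hB]
  | pred n ih =>
    rw [zpow_sub_one, Homeomorph.mul_apply, ih, ← hB]
    simp

theorem msg2 (p) : (msg ^ (2:ℤ)) p = tr 2 p := by simpa using msg_two 1 p

theorem T4 (f : MobiusBand ≃ₜ MobiusBand) (Φ : ℝ × ℝ ≃ₜ ℝ × ℝ) (h : ∀ p, mpr (Φ p) = f (mpr p))
    (hd : ∀ q, Dense (Set.range fun n : ℤ => (f.toEquiv ^ n) q)) (Y : Set (ℝ × ℝ)) (hY : IsClosed Y)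
    (hT : ∀ p, tr 2 p ∈ Y ↔ p ∈ Y) (hg : ∀ p, Φ (Φ p) ∈ Y ↔ p ∈ Y) (hne : Y.Nonempty) : Y = univ := by
  obtain ⟨e, he1, he⟩ := semi' f Φ h
  have fr : ∀ k : ℝ × ℝ ≃ₜ ℝ × ℝ, (∀ p, k p ∈ Y ↔ p ∈ Y) → ∀ p, k p ∈ frontier Y ↔ p ∈ frontier Y := by
    intro k hk p
    have : k ⁻¹' Y = Y := Set.ext hk
    have h2 := k.preimage_frontier Y
    rw [this] at h2
    exact Set.ext_iff.1 h2 p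
  set B := frontier Y with hBd
  have hBT : ∀ (n : ℤ) p, (msg ^ (2 * n)) p ∈ B ↔ p ∈ B := fun n p => by
    rw [zpow_mul]
    exact inv_zp (fr (msg ^ (2:ℤ)) (fun p => by rw [msg2]; exact hT p)) n p
  have hBg : ∀ (n : ℤ) p, (Φ ^ (2 * n)) p ∈ B ↔ p ∈ B := fun n p => by
    rw [zpow_mul]
    exact inv_zp (fr (Φ ^ (2:ℤ)) (fun p => by rw [zpow_two]; exact hg p)) n p
  have Bc : IsClosed B := isClosed_frontier
  have Bi : interior B = ∅ := interior_frontier hY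
  have hB : B = ∅ := by
    by_contra hB
    obtain ⟨z, hz⟩ := Set.nonempty_iff_ne_empty.2 hB
    have cl : ∀ k : ℝ × ℝ ≃ₜ ℝ × ℝ, IsClosed (k '' B) := fun k => k.isClosed_image.2 Bc
    have it : ∀ k : ℝ × ℝ ≃ₜ ℝ × ℝ, interior (k '' B) = ∅ := fun k => by
      rw [← k.image_interior, Bi, image_empty]
    have U := dense_lift f Φ h hd z (((1 : ℝ × ℝ ≃ₜ ℝ × ℝ) '' B ∪ msg '' B) ∪ Φ '' B ∪ (msg * Φ) '' B)
      ((((cl _).union (cl _)).union (cl _)).union (cl _)) ?_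
    · have := congrArg interior U
      rw [interior_union_isClosed_of_interior_empty (((cl _).union (cl _)).union (cl _)) (it _),
        interior_union_isClosed_of_interior_empty ((cl _).union (cl _)) (it _),
        interior_union_isClosed_of_interior_empty (cl _) (it _), it, interior_univ] at this
      exact Set.empty_ne_univ this
    · intro a n
      have key : ∀ a' : ℤ, msg ^ (2 * a') * Φ = Φ * msg ^ (2 * (a' * e)) := by
        intro a'
        have := he.zpow_right (2 * (a' * e))
        rw [SemiconjBy, ← zpow_mul] at this
        rw [this]
        congr 2
        rcases he1 with rfl | rfl <;> ring
      obtain ⟨a', ha⟩ := Int.even_or_odd' a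
      obtain ⟨n', hn⟩ := Int.even_or_odd' n
      have hz' : (Φ ^ (2 * n')) z ∈ B := (hBg _ _).2 hz
      rcases hn with hn | hn
      · rcases ha with ha | ha <;> subst ha hn
        · left; left; left
          exact ⟨_, (hBT a' _).2 hz', rfl⟩
        · left; left; right
          refine ⟨_, (hBT a' _).2 hz', ?_⟩
          rw [add_comm, zpow_one_add]; rfl
      · have hz2 : (Φ ^ n) z = Φ ((Φ ^ (2 * n')) z) := by rw [hn, add_comm, zpow_one_add]; rfl
        have k2 : (msg ^ (2 * a')) ((Φ ^ n) z) = Φ ((msg ^ (2 * (a' * e))) ((Φ ^ (2 * n')) z)) := by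
          rw [hz2, ← Homeomorph.mul_apply, key]; rfl
        rcases ha with ha | ha <;> subst ha
        · left; right
          exact ⟨_, (hBT (a' * e) _).2 hz', k2.symm⟩
        · right
          refine ⟨_, (hBT (a' * e) _).2 hz', ?_⟩
          rw [add_comm, zpow_one_add, Homeomorph.mul_apply, Homeomorph.mul_apply, k2]
  have : IsClopen Y := isClopen_iff_frontier_eq_empty.2 hB
  exact this.eq_univ hne

/-- minimality package for `g` -/
def Mn (g : ℝ × ℝ ≃ₜ ℝ × ℝ) : Prop := ∀ (K : Set (ℝ × ℝ)), IsClosed K → (∀ p, tr 2 p ∈ K ↔ p ∈ K) →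
  ∀ z, (∀ n : ℤ, (g ^ n) z ∈ K) → K = univ

theorem Mn.inv {g : ℝ × ℝ ≃ₜ ℝ × ℝ} (h : Mn g) : Mn g⁻¹ := fun K hK hT z hz => h K hK hT z fun n => by
  have := hz (-n)
  rwa [inv_zpow, zpow_neg, inv_inv] at this

theorem com2 (f : MobiusBand ≃ₜ MobiusBand) (Φ : ℝ × ℝ ≃ₜ ℝ × ℝ) (h : ∀ p, mpr (Φ p) = f (mpr p)) :
    Commute (Φ * Φ) msg := by
  obtain ⟨e, he1, he⟩ := semi' f Φ h
  have := (he.zpow_right e).mul_left he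
  rw [← zpow_mul, show e * e = 1 by rcases he1 with rfl | rfl <;> ring, zpow_one] at this
  exact this

theorem equi_of_com {g : ℝ × ℝ ≃ₜ ℝ × ℝ} (h : Commute g msg) : Equi 2 g := fun p => by
  have := congrArg (fun k : ℝ × ℝ ≃ₜ ℝ × ℝ => k p) (h.zpow_right 2).eq
  simp only [Homeomorph.mul_apply, msg2] at this
  exact this

theorem Mn_of (f : MobiusBand ≃ₜ MobiusBand) (Φ : ℝ × ℝ ≃ₜ ℝ × ℝ) (h : ∀ p, mpr (Φ p) = f (mpr p))
    (hd : ∀ q, Dense (Set.range fun n : ℤ => (f.toEquiv ^ n) q)) : Mn (Φ * Φ) := by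
  intro K hK hT z hz
  have : {p | ∀ n : ℤ, ((Φ * Φ) ^ n) p ∈ K} = univ := by
    refine T4 f Φ h hd _ ?_ ?_ ?_ ⟨z, hz⟩
    · simp only [Set.ofPred_forall]
      exact isClosed_iInter fun n => hK.preimage ((Φ * Φ) ^ n).continuous
    · intro p
      have : ∀ n : ℤ, ((Φ * Φ) ^ n) (tr 2 p) = tr 2 (((Φ * Φ) ^ n) p) := fun n =>
        equi_of_com ((com2 f Φ h).zpow_left n) p
      simp only [Set.mem_ofPred_eq, this, hT]
    · intro p
      have : ∀ n : ℤ, ((Φ * Φ) ^ n) (Φ (Φ p)) = ((Φ * Φ) ^ (n + 1)) p := fun n => by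
        rw [zpow_add_one]; rfl
      simp only [Set.mem_ofPred_eq, this]
      constructor
      · intro h n
        simpa using h (n - 1)
      · intro h n
        exact h _
  refine Set.eq_univ_of_forall fun p => ?_
  have h2 : p ∈ {p | ∀ n : ℤ, ((Φ * Φ) ^ n) p ∈ K} := this ▸ mem_univ p
  simpa using h2 0
end Mob

namespace Mob
open Set Topology

def TO (v : ℝ × ℝ) : Set (ℝ × ℝ) := range fun k : ℤ => tr (k * 2) v

theorem TO_closed (v) : IsClosed (TO v) := by
  have : TO v = {w | w.2 = v.2} ∩ (fun w : ℝ × ℝ => (w.1 - v.1) / 2) ⁻¹' (range ((↑) : ℤ → ℝ)) := by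
    ext w
    simp only [TO, mem_range, mem_inter_iff, mem_preimage, Set.mem_ofPred_eq]
    constructor
    · rintro ⟨k, rfl⟩
      exact ⟨rfl, k, by simp [tr]⟩
    · rintro ⟨h, k, hk⟩
      refine ⟨k, Prod.ext ?_ h.symm⟩
      simp only [tr]
      linarith
  rw [this]
  exact (isClosed_eq (by fun_prop) (by fun_prop)).inter (Int.isClosedEmbedding_coe_real.isClosed_range.preimage (by fun_prop))

theorem TO_inv (v p) : tr 2 p ∈ TO v ↔ p ∈ TO v := by
  constructor
  · rintro ⟨k, hk⟩
    refine ⟨k - 1, ?_⟩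
    have : p = tr (-2) (tr 2 p) := by rw [tr_tr]; simp [tr]
    rw [this, ← hk, tr_tr]
    dsimp only
    congr 1; push_cast; ring
  · rintro ⟨k, rfl⟩
    refine ⟨k + 1, ?_⟩
    dsimp only
    rw [tr_tr]
    congr 1; push_cast; ring

theorem TO_self (v) : v ∈ TO v := ⟨0, by simp [tr]⟩

theorem TO_ctb (v) : (TO v).Countable := countable_range _

theorem it_zp (g : ℝ × ℝ ≃ₜ ℝ × ℝ) (n : ℕ) (z) : g^[n] z = (g ^ (n : ℤ)) z := by
  rw [zpow_natCast]
  induction n generalizing z with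
  | zero => rfl
  | succ n ih => rw [Function.iterate_succ_apply, ih, pow_succ]; rfl

theorem P1_of {g : ℝ × ℝ ≃ₜ ℝ × ℝ} (hc : Commute g msg) (hM : Mn g) (n : ℕ) (hn : 1 ≤ n) (p : ℤ) (z) :
    g^[n] z ≠ tr (p * 2) z := by
  intro h
  rw [it_zp, ← msg_two] at h
  have hcab : Commute ((msg ^ (2 * p))⁻¹) (g ^ (n:ℤ)) := ((hc.zpow_left n).zpow_right (2 * p)).symm.inv_left
  have key : ∀ j : ℤ, ((g ^ (n:ℤ)) ^ j) z = ((msg ^ (2 * p)) ^ j) z := by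
    intro j
    have h1 : (((msg ^ (2 * p))⁻¹ * g ^ (n:ℤ)) ^ j) z ∈ ({z} : Set (ℝ × ℝ)) := by
      have h0 : ((msg ^ (2 * p))⁻¹ * g ^ (n:ℤ)) z = z := by
        rw [Homeomorph.mul_apply, h, Homeomorph.inv_apply, Homeomorph.symm_apply_apply]
      refine (inv_zp (fun q => ?_) j z).2 rfl
      rw [mem_singleton_iff, mem_singleton_iff]
      nth_rewrite 1 [← h0]
      exact (Homeomorph.injective _).eq_iff
    rw [hcab.mul_zpow, Homeomorph.mul_apply, inv_zpow, Homeomorph.inv_apply, mem_singleton_iff,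
      Homeomorph.symm_apply_eq] at h1
    exact h1
  have hK := hM (⋃ i : Fin n, TO ((g ^ (i : ℤ)) z)) (isClosed_iUnion_of_finite fun i => TO_closed _)
    (fun q => by simp only [mem_iUnion, TO_inv]) z ?_
  · have hc : (⋃ i : Fin n, TO ((g ^ (i : ℤ)) z)).Countable := countable_iUnion fun i => TO_ctb _
    have := (hc.dense_compl ℝ).nonempty
    rw [hK] at this
    simp at this
  · intro m
    have hn' : (0:ℤ) < n := by exact_mod_cast hn
    obtain ⟨i, hi⟩ := Int.eq_ofNat_of_zero_le (Int.emod_nonneg m hn'.ne')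
    have hi' : i < n := by have := Int.emod_lt_of_pos m hn'; omega
    refine mem_iUnion.2 ⟨⟨i, hi'⟩, ?_⟩
    refine ⟨p * (m / n), ?_⟩
    have hm : m = i + n * (m / n) := by have := Int.emod_add_mul_ediv m n; omega
    dsimp only
    conv_rhs => rw [hm, zpow_add, Homeomorph.mul_apply, zpow_mul, key, ← zpow_mul, ← Homeomorph.mul_apply]
    rw [((hc.zpow_left i).zpow_right _).eq, Homeomorph.mul_apply, mul_assoc, msg_two]

theorem equi_all {g : ℝ × ℝ ≃ₜ ℝ × ℝ} (hc : Commute g msg) (n m : ℤ) (p) : (g ^ n) (tr (m * 2) p) = tr (m * 2) ((g ^ n) p) :=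
  (equi_of_com (hc.zpow_left n)).int m p

theorem sy_zp (g : ℝ × ℝ ≃ₜ ℝ × ℝ) (n : ℕ) (z) : g.symm^[n] z = (g ^ (-n : ℤ)) z := by
  rw [it_zp, zpow_neg, ← inv_zpow]; rfl

theorem P2_of {g : ℝ × ℝ ≃ₜ ℝ × ℝ} (hc : Commute g msg) (hM : Mn g) (R : ℝ) : ∃ m : ℕ, ∀ z,
    (∀ i ≤ m, 1 ≤ |(g^[i] z).2| ∧ 1 ≤ |(g.symm^[i] z).2|) → R < |z.2| := by
  by_contra hcon
  push Not at hcon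
  simp_rw [sy_zp, it_zp] at hcon
  let D : ℕ → Set (ℝ × ℝ) := fun i => {z | 1 ≤ |((g ^ (i:ℤ)) z).2| ∧ 1 ≤ |((g ^ (-i:ℤ)) z).2|}
  have Dc : ∀ i, IsClosed (D i) := fun i => by
    have c1 : Continuous fun z => |((g ^ (i:ℤ)) z).2| := (continuous_snd.comp (g ^ (i:ℤ)).continuous).abs
    have c2 : Continuous fun z => |((g ^ (-i:ℤ)) z).2| := (continuous_snd.comp (g ^ (-i:ℤ)).continuous).abs
    exact (isClosed_le continuous_const c1).inter (isClosed_le continuous_const c2)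
  let C : ℕ → Set (ℝ × ℝ) := fun m => Bnd 2 R ∩ ⋂ i : ℕ, ⋂ _ : i ≤ m, D i
  have Cc : ∀ m, IsClosed (⋂ i : ℕ, ⋂ _ : i ≤ m, D i) := fun m => isClosed_iInter fun i => isClosed_iInter fun _ => Dc i
  have hne := IsCompact.nonempty_iInter_of_sequence_nonempty_isCompact_isClosed C ?_ ?_ ?_ ?_
  · obtain ⟨z, hz⟩ := hne
    rw [mem_iInter] at hz
    have hD : ∀ i, z ∈ D i := fun i => by
      have := (hz i).2
      simp only [mem_iInter] at this
      exact this i le_rfl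
    have hK := hM {p | 1 ≤ |p.2|} (isClosed_le continuous_const (by fun_prop)) (fun p => Iff.rfl) z ?_
    · have : (0 : ℝ × ℝ) ∈ {p : ℝ × ℝ | 1 ≤ |p.2|} := hK ▸ mem_univ _
      rw [Set.mem_ofPred_eq] at this
      norm_num at this
    · intro n
      obtain ⟨k, rfl | rfl⟩ := Int.eq_nat_or_neg n
      · exact (hD k).1
      · exact (hD k).2
  · intro m z hz
    refine ⟨hz.1, ?_⟩
    have := hz.2
    simp only [mem_iInter] at this ⊢
    exact fun i hi => this i (by omega)
  · intro m
    obtain ⟨z, h1, h2⟩ := hcon m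
    obtain ⟨n, h3, h4⟩ := nrm (two_pos) z
    refine ⟨tr (n * 2) z, mem_Bnd h3 h4 h2, ?_⟩
    simp only [mem_iInter]
    intro i hi
    refine ⟨?_, ?_⟩
    · rw [equi_all hc]; exact (h1 i hi).1
    · rw [equi_all hc]; exact (h1 i hi).2
  · exact (Bnd_cpt 2 R).inter_right (Cc 0)
  · exact fun m => (Bnd_cpt 2 R).isClosed.inter (Cc m)

theorem P3_of {g : ℝ × ℝ ≃ₜ ℝ × ℝ} (hc : Commute g msg) (hM : Mn g) : P3 2 g := by
  intro X hX hT hne hnu hsub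
  have hT2 : ∀ p, tr 2 p ∈ X ↔ p ∈ X := fun p => by have := hT p; push_cast at this; exact this
  have hgX : IsClosed (g '' X) := g.isClosed_image.2 hX
  have hgm : ∀ p, p ∈ X → g p ∈ X := fun p hp => interior_subset (hsub ⟨p, hp, rfl⟩)
  have hUo : IsOpen (interior X \ g '' X) := isOpen_interior.sdiff hgX
  have hUn : (interior X \ g '' X).Nonempty := by
    rw [Set.nonempty_iff_ne_empty]
    intro h
    have h1 : g '' X = interior X := Subset.antisymm hsub (sdiff_eq_bot_iff.1 h)
    have : IsClopen (g '' X) := ⟨hgX, h1 ▸ isOpen_interior⟩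
    have h2 := this.eq_univ (hne.image g)
    rw [h1] at h2
    exact hnu (Set.eq_univ_of_univ_subset (h2 ▸ interior_subset))
  have Ti : ∀ p, tr 2 p ∈ interior X ↔ p ∈ interior X := fun p => by
    have h1 : (msg ^ (2:ℤ)) ⁻¹' X = X := Set.ext fun p => by rw [mem_preimage, msg2]; exact hT2 p
    have h2 := (msg ^ (2:ℤ)).preimage_interior X
    rw [h1] at h2
    rw [← msg2]
    exact Set.ext_iff.1 h2 p
  have mg : ∀ p, p ∈ g '' X ↔ g.symm p ∈ X := fun p => by
    rw [Homeomorph.image_eq_preimage_symm]; rfl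
  have Tg : ∀ p, tr 2 p ∈ g '' X ↔ p ∈ g '' X := fun p => by
    rw [mg, mg]
    have := equi_of_com hc.inv_left p
    rw [Homeomorph.inv_apply, Homeomorph.inv_apply] at this
    rw [this, hT2]
  obtain ⟨z, hz⟩ := hUn
  have fw : ∀ (n : ℕ) p, p ∈ X → (g ^ ((n + 1 : ℕ) : ℤ)) p ∈ g '' X := by
    intro n
    induction n with
    | zero => intro p hp; exact ⟨p, hp, by simp⟩
    | succ n ih =>
      intro p hp
      have := ih (g p) (hgm p hp)
      push_cast at this ⊢
      rw [zpow_add_one]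
      exact this
  have hK := hM ((interior X \ g '' X) \ TO z)ᶜ (hUo.sdiff (TO_closed z)).isClosed_compl
    (fun p => by simp only [mem_compl_iff, mem_sdiff, Ti, Tg, TO_inv]) z ?_
  · have hsub : interior X \ g '' X ⊆ TO z := by
      exact sdiff_eq_bot_iff.1 (compl_univ_iff.1 hK)
    obtain ⟨w, hw, hw'⟩ := ((TO_ctb z).dense_compl ℝ).inter_open_nonempty _ hUo ⟨z, hz⟩
    exact hw' (hsub hw)
  · intro n hn
    obtain ⟨k, rfl | rfl⟩ := Int.eq_nat_or_neg n
    · cases k with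
      | zero => exact hn.2 (by simpa using TO_self z)
      | succ k => exact hn.1.2 (fw k z (interior_subset hz.1))
    · cases k with
      | zero => exact hn.2 (by simpa using TO_self z)
      | succ k =>
        have := fw k _ (interior_subset hn.1.1)
        rw [← Homeomorph.mul_apply, ← zpow_add, add_neg_cancel, zpow_zero] at this
        exact hz.2 this
end Mob

namespace Mob
open Set Topology

theorem hgt (f : MobiusBand ≃ₜ MobiusBand) (Φ : ℝ × ℝ ≃ₜ ℝ × ℝ) (h : ∀ p, mpr (Φ p) = f (mpr p)) (n : ℤ) (p) :
    |(Φ (tr (n * 2) p)).2| = |(Φ p).2| := by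
  obtain ⟨e, he⟩ := semi f Φ h
  have := congrArg (fun k : ℝ × ℝ ≃ₜ ℝ × ℝ => k p) (he.zpow_right (2 * n)).eq
  simp only [Homeomorph.mul_apply, msg_two, ← zpow_mul] at this
  rw [this, (msg_zp _ _).2]

theorem bddF (f : MobiusBand ≃ₜ MobiusBand) (Φ : ℝ × ℝ ≃ₜ ℝ × ℝ) (h : ∀ p, mpr (Φ p) = f (mpr p)) (H : ℝ) :
    ∃ H', ∀ p, |p.2| ≤ H → |(Φ p).2| ≤ H' := by
  obtain ⟨C, hC⟩ := (Bnd_cpt 2 H).exists_bound_of_continuousOn (f := fun p => (Φ p).2) (by fun_prop)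
  refine ⟨C, fun p hp => ?_⟩
  obtain ⟨n, h1, h2⟩ := nrm two_pos p
  have := hC _ (mem_Bnd h1 h2 hp)
  rwa [Real.norm_eq_abs, hgt f Φ h] at this

theorem propF (f : MobiusBand ≃ₜ MobiusBand) (Φ : ℝ × ℝ ≃ₜ ℝ × ℝ) (h : ∀ p, mpr (Φ p) = f (mpr p)) (R : ℝ) :
    ∃ R', ∀ p, R' ≤ |p.2| → R ≤ |(Φ p).2| := by
  obtain ⟨H, hH⟩ := bddF f.symm Φ⁻¹ (fun p => by rw [Homeomorph.eq_symm_apply, ← h]; simp) R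
  refine ⟨H + 1, fun p hp => ?_⟩
  by_contra hc
  have := hH (Φ p) (not_le.1 hc).le
  simp at this
  linarith

theorem signF (f : MobiusBand ≃ₜ MobiusBand) (Φ : ℝ × ℝ ≃ₜ ℝ × ℝ) (h : ∀ p, mpr (Φ p) = f (mpr p)) :
    ∃ c R1 : ℝ, ∀ p, R1 ≤ |p.2| → 0 < c * p.2 * (Φ p).2 := by
  obtain ⟨R0, hR0⟩ := propF f Φ h 1
  obtain ⟨e, he1, he⟩ := semi' f Φ h
  set R1 := max R0 1
  have a0 : R0 ≤ R1 := le_max_left _ _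
  have a1 : 1 ≤ R1 := le_max_right _ _
  let s : Set (ℝ × ℝ) := {p | R1 ≤ p.2}
  have hs : IsPreconnected s := by
    have : s = univ ×ˢ Ici R1 := by ext p; simp [s]
    rw [this]
    exact isPreconnected_univ.prod isPreconnected_Ici
  have nz : ∀ q ∈ s, (Φ q).2 ≠ 0 := by
    intro q hq h0
    have hq : R1 ≤ q.2 := hq
    have := hR0 q (by rw [abs_of_nonneg (by linarith)]; linarith)
    rw [h0] at this
    norm_num at this
  set c := (Φ (0, R1)).2
  have hp0 : ((0, R1) : ℝ × ℝ) ∈ s := le_refl R1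
  have hcn : c ≠ 0 := nz _ hp0
  have pos : ∀ q ∈ s, 0 < c * (Φ q).2 := by
    intro q hq
    by_contra hn
    have hiv := hs.intermediate_value hq hp0 (f := fun q => c * (Φ q).2) (by fun_prop)
    obtain ⟨w, hw, hw'⟩ := hiv ⟨not_lt.1 hn, mul_self_nonneg c⟩
    exact mul_ne_zero hcn (nz w hw) hw'
  have neg : ∀ q, (Φ (msg q)).2 = -(Φ q).2 := by
    intro q
    have := congrArg (fun k : ℝ × ℝ ≃ₜ ℝ × ℝ => k q) he.eq
    simp only [Homeomorph.mul_apply] at this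
    rw [this]
    rcases he1 with rfl | rfl
    · rw [zpow_one]; rfl
    · rw [zpow_neg_one, msg_inv]
  refine ⟨c, R1, fun p hp => ?_⟩
  rcases le_abs.1 hp with hp | hp
  · have := pos p hp
    nlinarith
  · have := pos (msg p) (show R1 ≤ -p.2 from hp)
    rw [neg] at this
    nlinarith

theorem endsF (f : MobiusBand ≃ₜ MobiusBand) (Φ : ℝ × ℝ ≃ₜ ℝ × ℝ) (h : ∀ p, mpr (Φ p) = f (mpr p)) (R : ℝ) :
    ∃ R', ∀ p, (R' ≤ p.2 → R ≤ ((Φ * Φ) p).2) ∧ (p.2 ≤ -R' → ((Φ * Φ) p).2 ≤ -R) := by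
  obtain ⟨c, R1, hc⟩ := signF f Φ h
  obtain ⟨Ra, hRa⟩ := propF f Φ h (max R 1)
  obtain ⟨Rb, hRb⟩ := propF f Φ h (max Ra R1)
  have key : ∀ p : ℝ × ℝ, max (max Rb R1) 1 ≤ |p.2| → 0 < p.2 * (Φ (Φ p)).2 ∧ R ≤ |(Φ (Φ p)).2| := by
    intro p hp
    rw [max_le_iff, max_le_iff] at hp
    have h1 := max_le_iff.1 (hRb p hp.1.1)
    have h2 := max_le_iff.1 (hRa _ h1.1)
    refine ⟨?_, h2.1⟩
    have h3 := mul_pos (hc p hp.1.2) (hc _ h1.2)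
    have h4 : 0 < (c * (Φ p).2) ^ 2 * (p.2 * (Φ (Φ p)).2) := by
      calc _ < _ := h3
        _ = _ := by ring
    exact pos_of_mul_pos_right h4 (sq_nonneg _)
  refine ⟨max (max Rb R1) 1, fun p => ⟨fun hp => ?_, fun hp => ?_⟩⟩ <;> rw [Homeomorph.mul_apply]
  · have h1 : 1 ≤ p.2 := (le_max_right _ _).trans hp
    obtain ⟨k1, k2⟩ := key p (by rwa [abs_of_nonneg (by linarith)])
    rwa [abs_of_pos (pos_of_mul_pos_right k1 (by linarith))] at k2
  · have h1 : 1 ≤ -p.2 := (le_max_right _ _).trans (by linarith)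
    obtain ⟨k1, k2⟩ := key p (by rw [abs_of_nonpos (by linarith)]; linarith)
    have : (Φ (Φ p)).2 < 0 := by nlinarith
    rw [abs_of_neg this] at k2
    linarith

end Mob

/-- There is no minimal homeomorphism of the open Möbius band: every homeomorphism `f` of
the Möbius band has a point whose orbit `{f ^ n q : n ∈ ℤ}` is not dense. -/
theorem no_minimal_homeomorphism_of_mobiusBand (f : MobiusBand ≃ₜ MobiusBand) :
    ∃ q : MobiusBand, ¬ Dense (Set.range fun n : ℤ => (f.toEquiv ^ n) q) := by
  by_contra hd
  push Not at hd
  obtain ⟨Φ, hΦ⟩ := Mob.ex_Phi f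
  have hc := Mob.com2 f Φ hΦ
  have hM := Mob.Mn_of f Φ hΦ hd
  exact Mob.partE (Φ * Φ) (Mob.equi_of_com hc) (Mob.equi_of_com hc.inv_left) (Mob.endsF f Φ hΦ)
    (Mob.P1_of hc hM) (Mob.P2_of hc hM) (Mob.P3_of hc hM) (Mob.P3_of hc.inv_left hM.inv)
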